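/- Let G be a finite group, s a positive integer, and π = π(s). Assume that π is strictly contained in π(G/Z(G)), and that G is supersolvable or G/Fit(G) has odd order. If vcs(G) = {s}, then G has a nilpotent Hall π-subgroup. -/

import Mathlib

open scoped Classical

noncomputable section

/-- `g` is a vanishing element of `G`: some irreducible complex character of `G`
takes the value `0` at `g`. -/
def IsVanishing (G : Type) [Group G] (g : G) : Prop :=
  ∃ V : FDRep ℂ G, CategoryTheory.Simple V ∧ V.character g = 0

/-- The conjugacy class size of `g`, i.e. `|G : C_G(g)|`. -/
def classSize {G : Type*} [Group G] (g : G) : ℕ := (Subgroup.centralizer {g}).index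

/-- The set of conjugacy class sizes of vanishing elements of `G`. -/
def vcs (G : Type) [Group G] : Set ℕ :=
  {n | ∃ g : G, IsVanishing G g ∧ classSize g = n}

/-- The set of conjugacy class sizes of `G`. -/
def cs (G : Type*) [Group G] : Set ℕ := {n | ∃ g : G, classSize g = n}

/-- `H` is a Hall `π`-subgroup of `G`. -/
def IsHallSubgroup {G : Type*} [Group G] (π : Set ℕ) (H : Subgroup G) : Prop :=
  (∀ p : ℕ, p.Prime → p ∣ Nat.card H → p ∈ π) ∧
  (∀ p : ℕ, p.Prime → p ∣ H.index → p ∉ π)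

/-- The set of prime divisors of `n`. -/
def primesOf (n : ℕ) : Set ℕ := {p | p.Prime ∧ p ∣ n}

/-- The `π`-part `n_π` of `n`: the largest divisor of `n` all of whose prime
factors lie in `π`. -/
noncomputable def piPart (π : Set ℕ) (n : ℕ) : ℕ :=
  ∏ p ∈ n.primeFactors, p ^ (if p ∈ π then n.factorization p else 0)

/-- The subgroup `H` is abelian. -/
def IsAbelianSubgroup {G : Type*} [Group G] (H : Subgroup G) : Prop :=
  ∀ a ∈ H, ∀ b ∈ H, a * b = b * a

/-- `X` is a Frobenius group with kernel `K`: `K` is a nontrivial proper normal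
subgroup and the centralizer of every nontrivial element of `K` lies in `K`. -/
def IsFrobeniusWithKernel {X : Type*} [Group X] (K : Subgroup X) : Prop :=
  K ≠ ⊥ ∧ K ≠ ⊤ ∧ K.Normal ∧ ∀ k ∈ K, k ≠ 1 → Subgroup.centralizer {k} ≤ K

/-- `X` is a Frobenius group with kernel `K` and complement `C`. -/
def IsFrobenius {X : Type*} [Group X] (K C : Subgroup X) : Prop :=
  IsFrobeniusWithKernel K ∧ K ⊔ C = ⊤ ∧ K ⊓ C = ⊥

/-- `G` is supersolvable: there is a chain of subgroups from `⊥` to `⊤`, each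
normal in `G`, with all successive quotients cyclic (equivalently, each term is
generated by the previous one together with a single element). -/
def IsSupersolvable (G : Type*) [Group G] : Prop :=
  ∃ (n : ℕ) (c : Fin (n + 1) → Subgroup G),
    c 0 = ⊥ ∧ c (Fin.last n) = ⊤ ∧
    (∀ i : Fin n, c i.castSucc ≤ c i.succ) ∧
    (∀ i : Fin (n + 1), (c i).Normal) ∧
    (∀ i : Fin n, ∃ g : G, c i.castSucc ⊔ Subgroup.zpowers g = c i.succ)

/-- The Fitting subgroup of `G`: the subgroup generated by all nilpotent normal
subgroups of `G`. -/
def Fitting (G : Type*) [Group G] : Subgroup G :=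
  ⨆ H ∈ {H : Subgroup G | H.Normal ∧ Group.IsNilpotent ↥H}, H

/-- `O_p(G)`: the subgroup generated by all normal `p`-subgroups of `G`
(the largest normal `p`-subgroup). -/
def pCore' (p : ℕ) (G : Type*) [Group G] : Subgroup G :=
  ⨆ K ∈ {K : Subgroup G | K.Normal ∧ IsPGroup p ↥K}, K


/-- `χ` is the character of an irreducible complex matrix representation of `N`. -/
def IsIrrChar {N : Type*} [Group N] (χ : N → ℂ) : Prop :=
  ∃ (d : ℕ) (ρ : MonoidAlgebra ℂ N →ₐ[ℂ] Matrix (Fin d) (Fin d) ℂ),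
    0 < d ∧ Function.Surjective ρ ∧ ∀ x, χ x = (ρ (MonoidAlgebra.single x 1)).trace

theorem Matrix.card_mul_eq_mul_trace {n : ℕ} (f : Matrix (Fin n) (Fin n) ℂ →ₗ[ℂ] ℂ)
    (hf : ∀ a b, f (a * b) = f (b * a)) (a : Matrix (Fin n) (Fin n) ℂ) :
    (n : ℂ) * f a = f 1 * a.trace := by
  have h1 : ∀ i j : Fin n, i ≠ j → f (Matrix.single i j 1) = 0 := by
    intro i j hij
    have := hf (Matrix.single i i 1) (Matrix.single i j 1)
    rw [Matrix.single_mul_single_same, Matrix.single_mul_single_of_ne _ _ _ _ hij.symm] at this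
    simpa using this
  have h2 : ∀ i j : Fin n, f (Matrix.single i i 1) = f (Matrix.single j j 1) := by
    intro i j
    have := hf (Matrix.single i j 1) (Matrix.single j i 1)
    rw [Matrix.single_mul_single_same, Matrix.single_mul_single_same] at this
    simpa using this
  have h3 : ∀ b : Matrix (Fin n) (Fin n) ℂ, f b = ∑ i, b i i * f (Matrix.single i i 1) := by
    intro b
    conv_lhs => rw [Matrix.matrix_eq_sum_single b]
    simp only [map_sum]
    refine Finset.sum_congr rfl fun i _ => ?_
    rw [Finset.sum_eq_single i]
    · rw [← mul_one (b i i), ← smul_eq_mul, ← Matrix.smul_single, map_smul]; simp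
    · intro j _ hj
      rw [← mul_one (b i j), ← smul_eq_mul, ← Matrix.smul_single, map_smul, h1 i j hj.symm]; simp
    · simp
  rw [h3 a, h3 1]
  rcases Nat.eq_zero_or_pos n with rfl | hn
  · simp [Matrix.trace]
  · have h4 : ∀ i, f (Matrix.single i i 1) = f (Matrix.single ⟨0, hn⟩ ⟨0, hn⟩ 1) := fun i => h2 _ _
    simp only [h4, Matrix.trace, Matrix.one_apply_eq, one_mul, Finset.sum_const, Finset.card_univ,
      Fintype.card_fin, nsmul_eq_mul, ← Finset.sum_mul, Matrix.diag_apply]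
    ring

theorem trace_mulLeft_pi_matrix {n : ℕ} (d : Fin n → ℕ)
    (m : Π i, Matrix (Fin (d i)) (Fin (d i)) ℂ) :
    LinearMap.trace ℂ _ (LinearMap.mulLeft ℂ m) = ∑ i, (d i : ℂ) * (m i).trace := by
  rw [LinearMap.trace_eq_matrix_trace ℂ
    (Pi.basis fun i => Matrix.stdBasis ℂ (Fin (d i)) (Fin (d i)))]
  rw [Matrix.trace, Fintype.sum_sigma]
  refine Finset.sum_congr rfl fun i _ => ?_
  rw [Fintype.sum_prod_type]
  simp only [Matrix.diag_apply, LinearMap.toMatrix_apply, LinearMap.mulLeft_apply, Pi.basis_apply,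
    Pi.basis_repr]
  simp only [Matrix.stdBasis_eq_single, Pi.mul_apply, Pi.single_eq_same]
  have : ∀ p q : Fin (d i), ((Matrix.stdBasis ℂ (Fin (d i)) (Fin (d i))).repr
      (m i * Matrix.single p q 1)) (p, q) = m i p p := by
    intro p q
    simp [Matrix.stdBasis, Matrix.mul_apply, Matrix.single_apply]
  simp only [this]
  simp [Matrix.trace, Finset.mul_sum]

theorem trace_mulLeft_monoidAlgebra {N : Type*} [Group N] [Finite N] (a : MonoidAlgebra ℂ N) :
    LinearMap.trace ℂ _ (LinearMap.mulLeft ℂ a) = (Nat.card N : ℂ) * a.coeff 1 := by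
  have := Fintype.ofFinite N
  rw [LinearMap.trace_eq_matrix_trace ℂ (MonoidAlgebra.basis N ℂ), Matrix.trace]
  have : ∀ x : N, (a * MonoidAlgebra.single x 1).coeff x = a.coeff 1 := by
    intro x
    simp
  have h2 : ∀ x : N, LinearMap.toMatrix (MonoidAlgebra.basis N ℂ) (MonoidAlgebra.basis N ℂ)
      (LinearMap.mulLeft ℂ a) x x = a.coeff 1 := by
    intro x
    rw [LinearMap.toMatrix_apply, MonoidAlgebra.basis_apply, LinearMap.mulLeft_apply]
    exact this x
  simp only [Matrix.diag_apply, h2]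
  simp

/-- The linear extension of a function on `N` to the group algebra. -/
def charLin {N : Type*} [Group N] (χ : N → ℂ) : MonoidAlgebra ℂ N →ₗ[ℂ] ℂ :=
  (MonoidAlgebra.basis N ℂ).constr ℂ χ

@[simp]
theorem charLin_single {N : Type*} [Group N] (χ : N → ℂ) (x : N) (c : ℂ) :
    charLin χ (MonoidAlgebra.single x c) = c * χ x := by
  have h : MonoidAlgebra.single x c = c • MonoidAlgebra.basis N ℂ x := by simp
  rw [h, map_smul, charLin, Module.Basis.constr_basis, smul_eq_mul]

theorem MonoidAlgebra.linearMap_ext {N M : Type*} [Group N] [AddCommMonoid M] [Module ℂ M]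
    {f g : MonoidAlgebra ℂ N →ₗ[ℂ] M}
    (h : ∀ x, f (MonoidAlgebra.single x 1) = g (MonoidAlgebra.single x 1)) : f = g :=
  (MonoidAlgebra.basis N ℂ).ext fun x => by simpa using h x

theorem charLin_eq_trace {N : Type*} [Group N] {χ : N → ℂ} {d : ℕ}
    {ρ : MonoidAlgebra ℂ N →ₐ[ℂ] Matrix (Fin d) (Fin d) ℂ}
    (h : ∀ x, χ x = (ρ (MonoidAlgebra.single x 1)).trace) (a : MonoidAlgebra ℂ N) :
    charLin χ a = (ρ a).trace := by
  have : charLin χ = Matrix.traceLinearMap (Fin d) ℂ ℂ ∘ₗ ρ.toLinearMap :=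
    MonoidAlgebra.linearMap_ext fun x => by simp [h]
  rw [this]; rfl

theorem exists_wedderburn (N : Type*) [Group N] [Finite N] :
    ∃ (n : ℕ) (d : Fin n → ℕ)
      (_ : MonoidAlgebra ℂ N ≃ₐ[ℂ] Π i, Matrix (Fin (d i)) (Fin (d i)) ℂ), ∀ i, 0 < d i := by
  have : NeZero (Nat.card N : ℂ) := ⟨by exact_mod_cast Nat.card_pos.ne'⟩
  have : Module.Finite ℂ (MonoidAlgebra ℂ N) := Module.Finite.of_basis (MonoidAlgebra.basis N ℂ)
  obtain ⟨n, d, hd, ⟨e⟩⟩ :=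
    IsSemisimpleRing.exists_algEquiv_pi_matrix_of_isAlgClosed ℂ (MonoidAlgebra ℂ N)
  exact ⟨n, d, e, fun i => (hd i).pos⟩

section Wedderburn

variable {N : Type*} [Group N] {n : ℕ} {d : Fin n → ℕ}
  (e : MonoidAlgebra ℂ N ≃ₐ[ℂ] Π i, Matrix (Fin (d i)) (Fin (d i)) ℂ)

/-- The representation afforded by a block of the group algebra. -/
def blockRep (i : Fin n) : MonoidAlgebra ℂ N →ₐ[ℂ] Matrix (Fin (d i)) (Fin (d i)) ℂ :=
  (Pi.evalAlgHom ℂ _ i).comp e.toAlgHom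

/-- The character afforded by a block of the group algebra. -/
def blockChar (i : Fin n) (x : N) : ℂ := (e (MonoidAlgebra.single x 1) i).trace

theorem blockRep_surjective (i : Fin n) : Function.Surjective (blockRep e i) := fun m =>
  ⟨e.symm (Pi.single i m), by simp [blockRep]⟩

theorem blockChar_one (i : Fin n) : blockChar e i 1 = d i := by
  have : (MonoidAlgebra.single 1 1 : MonoidAlgebra ℂ N) = 1 := rfl
  simp [blockChar, this]

theorem charLin_blockChar (i : Fin n) (a : MonoidAlgebra ℂ N) :
    charLin (blockChar e i) a = (e a i).trace :=
  charLin_eq_trace (ρ := blockRep e i) (fun _ => rfl) a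

theorem isIrrChar_blockChar (hd : ∀ i, 0 < d i) (i : Fin n) : IsIrrChar (blockChar e i) :=
  ⟨d i, blockRep e i, hd i, blockRep_surjective e i, fun _ => rfl⟩

theorem sum_blockChar [Finite N] (a : MonoidAlgebra ℂ N) :
    ∑ i, (d i : ℂ) * (e a i).trace = (Nat.card N : ℂ) * a.coeff 1 := by
  rw [← trace_mulLeft_pi_matrix, ← trace_mulLeft_monoidAlgebra,
    ← LinearMap.trace_conj' (LinearMap.mulLeft ℂ a) e.toLinearEquiv]
  congr 1
  ext1 i
  ext1 m
  simp [LinearEquiv.conj_apply]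

theorem card_mul_trace_of_block {m : ℕ} (ρ : MonoidAlgebra ℂ N →ₐ[ℂ] Matrix (Fin m) (Fin m) ℂ)
    {j : Fin n} (h : ρ (e.symm (Pi.single j 1)) = 1) (a : MonoidAlgebra ℂ N) :
    (d j : ℂ) * (ρ a).trace = m * (e a j).trace := by
  let f : Matrix (Fin (d j)) (Fin (d j)) ℂ →ₗ[ℂ] ℂ :=
    Matrix.traceLinearMap (Fin m) ℂ ℂ ∘ₗ ρ.toLinearMap ∘ₗ e.symm.toLinearMap ∘ₗ
      LinearMap.single ℂ (fun i => Matrix (Fin (d i)) (Fin (d i)) ℂ) j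
  have hfa : ∀ b, f b = (ρ (e.symm (Pi.single j b))).trace := fun b => rfl
  have hf : ∀ b c, f (b * c) = f (c * b) := by
    intro b c
    rw [hfa, hfa, Pi.single_mul, Pi.single_mul, map_mul, map_mul, map_mul, map_mul,
      Matrix.trace_mul_comm]
  have h1 : f 1 = m := by rw [hfa, h]; simp
  have h2 : ρ a = ρ (e.symm (Pi.single j (e a j))) := by
    rw [← mul_one (ρ a), ← h, ← map_mul]
    congr 1
    apply e.injective
    rw [map_mul, e.apply_symm_apply, e.apply_symm_apply]
    ext1 i
    by_cases hij : i = j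
    · subst hij; simp
    · simp [hij]
  rw [h2, ← hfa, Matrix.card_mul_eq_mul_trace f hf, h1]

theorem coeff_blockIdem [Finite N] (j : Fin n) (x : N) :
    (Nat.card N : ℂ) * (e.symm (Pi.single j 1)).coeff x = d j * blockChar e j x⁻¹ := by
  have h := sum_blockChar e (e.symm (Pi.single j 1) * MonoidAlgebra.single x⁻¹ 1)
  rw [Finset.sum_eq_single j] at h
  · simpa [blockChar] using h.symm
  · intro i _ hij
    simp [hij]
  · simp

theorem blockChar_injective [Finite N] (hd : ∀ i, 0 < d i) :
    Function.Injective (blockChar e) := by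
  intro i j hij
  by_contra hne
  have h0 : d i = d j := by
    have := congrFun hij 1
    rw [blockChar_one, blockChar_one] at this
    exact_mod_cast this
  have h1 : e.symm (Pi.single i 1) = e.symm (Pi.single j 1) := by
    ext x
    have h2 := coeff_blockIdem e i x
    have h3 := coeff_blockIdem e j x
    rw [hij, show (d i : ℂ) = d j by rw [h0], ← h3] at h2
    exact mul_left_cancel₀ (by exact_mod_cast Nat.card_pos.ne') h2
  have h2 := congrFun (e.symm.injective h1) i
  have h3 := congrArg Matrix.trace h2
  rw [Pi.single_eq_same, Pi.single_eq_of_ne hne] at h3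
  simp at h3
  exact (hd i).ne' h3

theorem Matrix.eq_zero_or_one_of_isIdempotentElem_of_commute {m : ℕ}
    {a : Matrix (Fin m) (Fin m) ℂ} (h : a * a = a) (hc : ∀ b, a * b = b * a) : a = 0 ∨ a = 1 := by
  obtain ⟨c, rfl⟩ : ∃ c : ℂ, Matrix.scalar (Fin m) c = a := by
    have := Matrix.mem_range_scalar_of_commute_single (M := a) fun i j _ => (hc _).symm
    exact this
  rcases Nat.eq_zero_or_pos m with rfl | hm
  · exact Or.inl (Subsingleton.elim _ _)
  have : NeZero m := ⟨hm.ne'⟩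
  rw [← map_mul] at h
  have h1 := Matrix.scalar_inj.mp h
  rcases eq_or_ne c 0 with rfl | h0
  · left; simp
  · right
    rw [mul_eq_left₀ h0] at h1
    rw [h1, map_one]

theorem exists_block_of_surjective {m : ℕ} (hm : 0 < m)
    (ρ : MonoidAlgebra ℂ N →ₐ[ℂ] Matrix (Fin m) (Fin m) ℂ) (hρ : Function.Surjective ρ) :
    ∃ j, ρ (e.symm (Pi.single j 1)) = 1 := by
  by_contra! hcon
  have h0 : ∀ j, ρ (e.symm (Pi.single j 1)) = 0 := by
    intro j
    refine (Matrix.eq_zero_or_one_of_isIdempotentElem_of_commute ?_ ?_).resolve_right (hcon j)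
    · rw [← map_mul, ← map_mul, ← Pi.single_mul, one_mul]
    · intro b
      obtain ⟨b, rfl⟩ := hρ b
      rw [← map_mul, ← map_mul]
      congr 1
      apply e.injective
      ext1 i
      by_cases hij : i = j
      · subst hij; simp
      · simp [hij]
  have h1 : (1 : MonoidAlgebra ℂ N) = ∑ j, e.symm (Pi.single j 1) := by
    rw [← map_sum, Finset.univ_sum_single (fun i => (1 : Matrix (Fin (d i)) (Fin (d i)) ℂ))]
    exact (map_one e.symm).symm
  have h2 := congrArg ρ h1
  rw [map_one, map_sum, Finset.sum_eq_zero fun j _ => h0 j] at h2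
  have : NeZero m := ⟨hm.ne'⟩
  exact one_ne_zero h2

theorem card_eq_of_block {m : ℕ} (hm : 0 < m) (hd : ∀ i, 0 < d i)
    (ρ : MonoidAlgebra ℂ N →ₐ[ℂ] Matrix (Fin m) (Fin m) ℂ) (hρ : Function.Surjective ρ)
    {j : Fin n} (h : ρ (e.symm (Pi.single j 1)) = 1) : m = d j := by
  have : NeZero m := ⟨hm.ne'⟩
  have : NeZero (d j) := ⟨(hd j).ne'⟩
  let f : Matrix (Fin (d j)) (Fin (d j)) ℂ →+* Matrix (Fin m) (Fin m) ℂ :=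
    { toFun := fun b => ρ (e.symm (Pi.single j b))
      map_one' := h
      map_mul' := fun b c => by rw [Pi.single_mul, map_mul, map_mul]
      map_zero' := by simp
      map_add' := fun b c => by rw [Pi.single_add, map_add, map_add] }
  have hf : ∀ b, f b = ρ (e.symm (Pi.single j b)) := fun b => rfl
  have hinj : Function.Injective f := RingHom.injective f
  have hsurj : Function.Surjective f := by
    intro b
    obtain ⟨a, rfl⟩ := hρ b
    refine ⟨e a j, ?_⟩
    rw [hf]
    conv_rhs => rw [← mul_one (ρ a), ← h, ← map_mul]
    congr 1
    apply e.injective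
    rw [map_mul, e.apply_symm_apply, e.apply_symm_apply]
    ext1 i
    by_cases hij : i = j
    · subst hij; simp
    · simp [hij]
  let g : Matrix (Fin (d j)) (Fin (d j)) ℂ →ₗ[ℂ] Matrix (Fin m) (Fin m) ℂ :=
    ρ.toLinearMap ∘ₗ e.symm.toLinearMap ∘ₗ
      LinearMap.single ℂ (fun i => Matrix (Fin (d i)) (Fin (d i)) ℂ) j
  have h2 := (LinearEquiv.ofBijective g ⟨hinj, hsurj⟩).finrank_eq
  rw [Module.finrank_matrix, Module.finrank_matrix] at h2
  simp only [Fintype.card_fin, Module.finrank_self, mul_one] at h2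
  exact (Nat.mul_self_inj.mp h2).symm

theorem IsIrrChar.exists_block (hd : ∀ i, 0 < d i) {χ : N → ℂ} (h : IsIrrChar χ) :
    ∃ j, blockChar e j = χ := by
  obtain ⟨m, ρ, hm, hρ, hχ⟩ := h
  obtain ⟨j, hj⟩ := exists_block_of_surjective e hm ρ hρ
  have hmj := card_eq_of_block e hm hd ρ hρ hj
  refine ⟨j, funext fun x => ?_⟩
  have := card_mul_trace_of_block e ρ hj (MonoidAlgebra.single x 1)
  rw [← hχ, ← show (m : ℂ) = d j by rw [hmj]] at this
  exact (mul_left_cancel₀ (by exact_mod_cast hm.ne') this).symm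

end Wedderburn

/-- The irreducible complex characters of `N`. -/
abbrev Irr (N : Type*) [Group N] : Type _ := {χ : N → ℂ // IsIrrChar χ}

theorem exists_block_equiv (N : Type*) [Group N] [Finite N] :
    ∃ (n : ℕ) (d : Fin n → ℕ)
      (e : MonoidAlgebra ℂ N ≃ₐ[ℂ] Π i, Matrix (Fin (d i)) (Fin (d i)) ℂ) (φ : Fin n ≃ Irr N),
      (∀ i, 0 < d i) ∧ ∀ i, (φ i).1 = blockChar e i := by
  obtain ⟨n, d, e, hd⟩ := exists_wedderburn N
  refine ⟨n, d, e, Equiv.ofBijective (fun i => ⟨blockChar e i, isIrrChar_blockChar e hd i⟩)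
    ⟨fun i j hij => blockChar_injective e hd (congrArg Subtype.val hij), fun χ => ?_⟩, hd,
    fun i => rfl⟩
  obtain ⟨j, hj⟩ := χ.2.exists_block e hd
  exact ⟨j, Subtype.ext hj⟩

instance Irr.finite (N : Type*) [Group N] [Finite N] : Finite (Irr N) := by
  obtain ⟨n, d, e, φ, -⟩ := exists_block_equiv N
  exact Finite.of_equiv _ φ

instance Irr.fintype (N : Type*) [Group N] [Finite N] : Fintype (Irr N) := Fintype.ofFinite _

theorem sum_irr_mul_charLin {N : Type*} [Group N] [Finite N] (a : MonoidAlgebra ℂ N) :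
    ∑ χ : Irr N, χ.1 1 * charLin χ.1 a = (Nat.card N : ℂ) * a.coeff 1 := by
  obtain ⟨n, d, e, φ, hd, hφ⟩ := exists_block_equiv N
  rw [← sum_blockChar e, ← φ.sum_comp]
  refine Finset.sum_congr rfl fun i _ => ?_
  rw [hφ, charLin_blockChar, blockChar_one]

theorem exists_irreducible_apply_ne_zero {N : Type*} [Group N] [Finite N] {a : MonoidAlgebra ℂ N}
    (ha : a ≠ 0) : ∃ (m : ℕ) (ρ : MonoidAlgebra ℂ N →ₐ[ℂ] Matrix (Fin m) (Fin m) ℂ),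
      0 < m ∧ Function.Surjective ρ ∧ ρ a ≠ 0 := by
  obtain ⟨n, d, e, hd⟩ := exists_wedderburn N
  obtain ⟨i, hi⟩ : ∃ i, e a i ≠ 0 := by
    by_contra! h
    exact ha (e.injective (by rw [map_zero]; exact funext h))
  exact ⟨d i, blockRep e i, hd i, blockRep_surjective e i, hi⟩

/-- The primitive central idempotent attached to an irreducible character. -/
theorem IsIrrChar.exists_idempotent {N : Type*} [Group N] [Finite N] {θ : N → ℂ}
    (h : IsIrrChar θ) : ∃ u : MonoidAlgebra ℂ N, u * u = u ∧ charLin θ u = θ 1 ∧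
      (∀ x, (Nat.card N : ℂ) * u.coeff x = θ 1 * θ x⁻¹) ∧
      ∀ (m : ℕ) (ρ : MonoidAlgebra ℂ N →ₐ[ℂ] Matrix (Fin m) (Fin m) ℂ), ρ u = 1 →
        ∀ a, θ 1 * (ρ a).trace = m * charLin θ a := by
  obtain ⟨n, d, e, hd⟩ := exists_wedderburn N
  obtain ⟨j, rfl⟩ := h.exists_block e hd
  refine ⟨e.symm (Pi.single j 1), ?_, ?_, ?_, ?_⟩
  · rw [← map_mul, ← Pi.single_mul, one_mul]
  · rw [charLin_blockChar, blockChar_one]; simp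
  · intro x
    rw [coeff_blockIdem, blockChar_one]
  · intro m ρ hρ a
    rw [charLin_blockChar, blockChar_one, card_mul_trace_of_block e ρ hρ]

theorem IsIrrChar.exists_degree {N : Type*} [Group N] {θ : N → ℂ} (h : IsIrrChar θ) :
    ∃ d : ℕ, 0 < d ∧ θ 1 = d := by
  obtain ⟨d, ρ, hd, -, hχ⟩ := h
  refine ⟨d, hd, ?_⟩
  have : (MonoidAlgebra.single 1 1 : MonoidAlgebra ℂ N) = 1 := rfl
  rw [hχ, this]; simp

theorem IsIrrChar.map_one_ne_zero {N : Type*} [Group N] {θ : N → ℂ} (h : IsIrrChar θ) :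
    θ 1 ≠ 0 := by
  obtain ⟨d, hd, h1⟩ := h.exists_degree
  rw [h1]; exact_mod_cast hd.ne'

theorem charLin_eq_sum {N : Type*} [Group N] [Fintype N] (θ : N → ℂ) (a : MonoidAlgebra ℂ N) :
    charLin θ a = ∑ x, a.coeff x * θ x := by
  simp [charLin, Module.Basis.constr_apply_fintype, Module.Basis.equivFun_apply,
    MonoidAlgebra.basis]

theorem IsIrrChar.sum_mul_inv {N : Type*} [Group N] [Fintype N] {θ : N → ℂ} (h : IsIrrChar θ) :
    ∑ x, θ x * θ x⁻¹ = Nat.card N := by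
  obtain ⟨u, -, h1, h2, -⟩ := h.exists_idempotent
  rw [charLin_eq_sum] at h1
  refine mul_left_cancel₀ h.map_one_ne_zero ?_
  calc θ 1 * ∑ x, θ x * θ x⁻¹ = ∑ x, Nat.card N * (u.coeff x * θ x) := by
        rw [Finset.mul_sum]
        exact Finset.sum_congr rfl fun x _ => by rw [← mul_assoc (Nat.card N : ℂ), h2]; ring
    _ = θ 1 * Nat.card N := by rw [← Finset.mul_sum, h1, mul_comm]

theorem IsIrrChar.isVanishing {G : Type} [Group G] [Finite G] {χ : G → ℂ} (h : IsIrrChar χ)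
    {g : G} (hg : χ g = 0) : IsVanishing G g := by
  have := Fintype.ofFinite G
  obtain ⟨d, ρ, hd, hρ, hχ⟩ := id h
  let r : Representation ℂ G (Fin d → ℂ) :=
    { toFun := fun x => Matrix.toLin' (ρ (MonoidAlgebra.single x 1))
      map_one' := by
        have : (MonoidAlgebra.single 1 1 : MonoidAlgebra ℂ G) = 1 := rfl
        rw [this, map_one, Matrix.toLin'_one]; rfl
      map_mul' := fun x y => by
        have : (MonoidAlgebra.single (x * y) 1 : MonoidAlgebra ℂ G) =
          MonoidAlgebra.single x 1 * MonoidAlgebra.single y 1 := by simp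
        rw [this, map_mul, Matrix.toLin'_mul]; rfl }
  have hr : ∀ x, (FDRep.of r).character x = χ x := by
    intro x
    rw [hχ]
    exact Matrix.trace_toLin'_eq _
  refine ⟨FDRep.of r, ?_, by rw [hr, hg]⟩
  rw [FDRep.simple_iff_char_is_norm_one, ← h.sum_mul_inv]
  simp only [hr]

theorem IsIrrChar.comp {M N : Type*} [Group M] [Group N] {χ : N → ℂ} (h : IsIrrChar χ)
    {f : M →* N} (hf : Function.Surjective f) : IsIrrChar (χ ∘ f) := by
  obtain ⟨d, ρ, hd, hρ, hχ⟩ := h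
  refine ⟨d, ρ.comp (MonoidAlgebra.mapDomainAlgHom ℂ ℂ f), hd, ?_, fun x => ?_⟩
  · have : Function.Surjective (MonoidAlgebra.mapDomainAlgHom ℂ ℂ f) := by
      intro a
      induction a using MonoidAlgebra.induction_linear with
      | zero => exact ⟨0, map_zero _⟩
      | add a b ha hb =>
        obtain ⟨a, rfl⟩ := ha
        obtain ⟨b, rfl⟩ := hb
        exact ⟨a + b, map_add _ _ _⟩
      | single x c =>
        obtain ⟨y, rfl⟩ := hf x
        exact ⟨MonoidAlgebra.single y c, by simp⟩
    exact hρ.comp this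
  · simp [hχ]

instance irrMulAction {G : Type*} [Group G] (N : Subgroup G) [N.Normal] :
    MulAction G (Irr N) where
  smul g χ := ⟨χ.1 ∘ MulAut.conjNormal g⁻¹,
    χ.2.comp (f := (MulAut.conjNormal g⁻¹ : MulAut N).toMonoidHom) (MulEquiv.surjective _)⟩
  one_smul χ := Subtype.ext (funext fun x => by
    change χ.1 (MulAut.conjNormal (1 : G)⁻¹ x) = χ.1 x
    simp)
  mul_smul g h χ := Subtype.ext (funext fun x => by
    change χ.1 (MulAut.conjNormal (g * h)⁻¹ x) =
      χ.1 (MulAut.conjNormal h⁻¹ (MulAut.conjNormal g⁻¹ x))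
    rw [mul_inv_rev, map_mul, MulAut.mul_apply])

theorem irr_smul_apply {G : Type*} [Group G] {N : Subgroup G} [N.Normal] (g : G) (χ : Irr N)
    (x : N) : (g • χ).1 x = χ.1 (MulAut.conjNormal g⁻¹ x) := rfl

theorem IsIrrChar.map_conj {N : Type*} [Group N] {χ : N → ℂ} (h : IsIrrChar χ) (y x : N) :
    χ (y * x * y⁻¹) = χ x := by
  obtain ⟨d, ρ, hd, hρ, hχ⟩ := h
  have h1 : MonoidAlgebra.single (y * x * y⁻¹) (1 : ℂ) = MonoidAlgebra.single y 1 *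
      MonoidAlgebra.single x 1 * MonoidAlgebra.single y⁻¹ 1 := by simp
  have h2 : MonoidAlgebra.single y⁻¹ (1 : ℂ) * (MonoidAlgebra.single y 1 *
      MonoidAlgebra.single x 1) = MonoidAlgebra.single x 1 := by simp
  rw [hχ, hχ, h1, map_mul, Matrix.trace_mul_comm, ← map_mul, h2]

theorem isIrrChar_of_monoidHom {N : Type*} [Group N] (f : N →* ℂˣ) :
    IsIrrChar (fun x => (f x : ℂ)) := by
  let F : N →* Matrix (Fin 1) (Fin 1) ℂ :=
    (algebraMap ℂ (Matrix (Fin 1) (Fin 1) ℂ)).toMonoidHom.comp ((Units.coeHom ℂ).comp f)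
  refine ⟨1, MonoidAlgebra.lift ℂ _ N F, one_pos, fun m => ?_, fun x => ?_⟩
  · refine ⟨algebraMap ℂ _ (m 0 0), ?_⟩
    rw [AlgHom.commutes]
    ext i j
    rw [Subsingleton.elim i 0, Subsingleton.elim j 0]
    simp [Matrix.algebraMap_matrix_apply]
  · simp [F, Matrix.trace, Matrix.algebraMap_matrix_apply]

theorem IsIrrChar.exists_monoidHom {N : Type*} [Group N] {χ : N → ℂ} (h : IsIrrChar χ)
    (h1 : χ 1 = 1) : ∃ f : N →* ℂˣ, ∀ x, χ x = f x := by
  obtain ⟨d, ρ, hd, hρ, hχ⟩ := h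
  have hone : (MonoidAlgebra.single 1 1 : MonoidAlgebra ℂ N) = 1 := rfl
  obtain rfl : d = 1 := by
    rw [hχ, hone, map_one, Matrix.trace_one] at h1
    simpa using h1
  have hmul : ∀ x y, χ (x * y) = χ x * χ y := by
    intro x y
    have : (MonoidAlgebra.single (x * y) 1 : MonoidAlgebra ℂ N) =
          MonoidAlgebra.single x 1 * MonoidAlgebra.single y 1 := by simp
    rw [hχ, hχ, hχ, this, map_mul]
    simp [Matrix.trace, Matrix.mul_apply]
  exact ⟨MonoidHom.toHomUnits { toFun := χ, map_one' := h1, map_mul' := hmul }, fun x => rfl⟩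

/-- A central element acts by a scalar in an irreducible representation. -/
theorem exists_scalar_of_commute {N : Type*} [Group N] {m : ℕ}
    {ρ : MonoidAlgebra ℂ N →ₐ[ℂ] Matrix (Fin m) (Fin m) ℂ} (hρ : Function.Surjective ρ)
    {a : MonoidAlgebra ℂ N}
    (ha : ∀ x, MonoidAlgebra.single x 1 * a = a * MonoidAlgebra.single x 1) :
    ∃ c : ℂ, ρ a = algebraMap ℂ _ c := by
  have h1 : ∀ b, b * a = a * b := by
    intro b
    have : LinearMap.mulRight ℂ a = LinearMap.mulLeft ℂ a :=
      MonoidAlgebra.linearMap_ext fun x => ha x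
    exact LinearMap.congr_fun this b
  obtain ⟨c, hc⟩ : ρ a ∈ Set.range (Matrix.scalar (Fin m)) :=
    Matrix.mem_range_scalar_of_commute_single fun i j _ => by
      obtain ⟨b, hb⟩ := hρ (Matrix.single i j 1)
      change _ * _ = _ * _
      rw [← hb, ← map_mul, ← map_mul, h1]
  exact ⟨c, hc.symm⟩

theorem isVanishing_of_invariant {G : Type} [Group G] [Finite G] {N : Subgroup G} [N.Normal]
    {θ : N → ℂ} (h : IsIrrChar θ) (hinv : ∀ (g : G) x, θ (MulAut.conjNormal g x) = θ x) {x : N}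
    (hx : θ x = 0) : IsVanishing G x := by
  obtain ⟨u, huu, hu1, hu, hfac⟩ := h.exists_idempotent
  let ι := MonoidAlgebra.mapDomainAlgHom ℂ ℂ N.subtype
  have hι : ∀ y : N, ι (MonoidAlgebra.single y 1) = MonoidAlgebra.single (y : G) 1 := fun y => by
    simp [ι]
  have hcard : (Nat.card N : ℂ) ≠ 0 := by exact_mod_cast Nat.card_pos.ne'
  have hcomm : ∀ g : G, MonoidAlgebra.single g 1 * ι u = ι u * MonoidAlgebra.single g 1 := by
    intro g
    have h1 : MonoidAlgebra.domCongr ℂ ℂ (MulAut.conjNormal g : N ≃* N) u = u := by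
      ext y
      obtain ⟨z, rfl⟩ := (MulAut.conjNormal g : N ≃* N).surjective y
      refine mul_left_cancel₀ hcard ?_
      rw [hu, ← map_inv, hinv, ← hu]
      congr 1
      simp
    have h2 : LinearMap.mulRight ℂ (MonoidAlgebra.single g 1) ∘ₗ ι.toLinearMap ∘ₗ
        (MonoidAlgebra.domCongr ℂ ℂ (MulAut.conjNormal g : N ≃* N)).toLinearMap =
        LinearMap.mulLeft ℂ (MonoidAlgebra.single g 1) ∘ₗ ι.toLinearMap :=
      MonoidAlgebra.linearMap_ext fun y => by simp [ι]
    have h3 := LinearMap.congr_fun h2 u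
    simp only [LinearMap.comp_apply, LinearMap.mulRight_apply, LinearMap.mulLeft_apply,
      AlgEquiv.toLinearMap_apply, AlgHom.toLinearMap_apply, h1] at h3
    exact h3.symm
  have hu0 : ι u ≠ 0 := by
    intro h0
    have : u = 0 :=
      MonoidAlgebra.mapDomain_injective N.subtype_injective (h0.trans (map_zero ι).symm)
    rw [this, map_zero] at hu1
    exact h.map_one_ne_zero hu1.symm
  obtain ⟨m, ρ, hm, hρ, hne⟩ := exists_irreducible_apply_ne_zero hu0
  have h1 : ρ (ι u) = 1 := by
    obtain ⟨c, hc⟩ := exists_scalar_of_commute hρ hcomm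
    refine (Matrix.eq_zero_or_one_of_isIdempotentElem_of_commute ?_ fun b => ?_).resolve_left hne
    · rw [← map_mul, ← map_mul, huu]
    · rw [hc, Algebra.commutes]
  have h2 := hfac m (ρ.comp ι) h1 (MonoidAlgebra.single x 1)
  rw [charLin_single, hx, AlgHom.comp_apply, hι] at h2
  refine IsIrrChar.isVanishing (χ := fun y => (ρ (MonoidAlgebra.single y 1)).trace)
    ⟨m, ρ, hm, hρ, fun _ => rfl⟩ ?_
  simpa [h.map_one_ne_zero] using h2

theorem IsPGroup.sum_eq_sum_fixedPoints {P X k : Type*} [Group P] [Finite P] [Fintype X] {r : ℕ}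
    [Fact r.Prime] (hP : IsPGroup r P) [MulAction P X] [Ring k] [CharP k r] (f : X → k)
    (hf : ∀ (p : P) x, f (p • x) = f x) :
    ∑ x, f x = ∑ x with x ∈ MulAction.fixedPoints P X, f x := by
  have key : ∀ v : k, ((Finset.univ.filter fun x => f x = v).card : k) =
      ((Finset.univ.filter fun x => x ∈ MulAction.fixedPoints P X ∧ f x = v).card : k) := by
    intro v
    let Y : SubMulAction P X :=
      { carrier := {x | f x = v}, smul_mem' := fun p x hx => (hf p x).trans hx }
    have h1 := hP.card_modEq_card_fixedPoints Y
    rw [← CharP.natCast_eq_natCast k] at h1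
    have h2 : Nat.card Y = (Finset.univ.filter fun x => f x = v).card := by
      change Nat.card {x // f x = v} = _
      rw [Nat.card_eq_fintype_card, Fintype.card_subtype]
    have h3 : Nat.card (MulAction.fixedPoints P Y) =
        (Finset.univ.filter fun x => x ∈ MulAction.fixedPoints P X ∧ f x = v).card := by
      rw [← Fintype.card_subtype, ← Nat.card_eq_fintype_card]
      exact Nat.card_congr
        { toFun := fun y => ⟨y.1.1, fun p => congrArg Subtype.val (y.2 p), y.1.2⟩
          invFun := fun y => ⟨⟨y.1, y.2.2⟩, fun p => Subtype.ext (y.2.1 p)⟩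
          left_inv := fun y => rfl
          right_inv := fun y => rfl }
    rw [← h2, ← h3, h1]
  have key2 : ∀ s : Finset X, ∑ x ∈ s, f x =
      ∑ v ∈ Finset.univ.image f, ((s.filter fun x => f x = v).card : k) * v := by
    intro s
    rw [← Finset.sum_fiberwise_of_maps_to (t := Finset.univ.image f) (g := f) (by simp)]
    refine Finset.sum_congr rfl fun v _ => ?_
    rw [Finset.sum_congr rfl fun x hx => (Finset.mem_filter.mp hx).2, Finset.sum_const,
      nsmul_eq_mul]
  rw [key2, key2]
  refine Finset.sum_congr rfl fun v _ => ?_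
  rw [key, Finset.filter_filter]

section ConjugacySums

variable {G : Type*} [Group G] (N : Subgroup G) [Finite N]

/-- The sum of the conjugates of `x` by the elements of `N`. -/
def conjSum (x : G) : MonoidAlgebra ℂ G :=
  letI := Fintype.ofFinite N
  ∑ n : N, MonoidAlgebra.single (n * x * n⁻¹ : G) 1

theorem conjSum_eq [Fintype N] (x : G) :
    conjSum N x = ∑ n : N, MonoidAlgebra.single (n * x * n⁻¹ : G) 1 := by
  unfold conjSum
  congr!

theorem coeff_conjSum (x t : G) :
    (conjSum N x).coeff t = (Nat.card {n : N // (n * x * n⁻¹ : G) = t} : ℂ) := by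
  have := Fintype.ofFinite N
  rw [conjSum_eq, Nat.card_eq_fintype_card, Fintype.card_subtype]
  simp [MonoidAlgebra.coeff_sum, Finsupp.finsetSum_apply, Finsupp.single_apply,
    Finset.sum_boole]

theorem conjSum_conj_mem {m : G} (hm : m ∈ N) (x : G) :
    conjSum N (m * x * m⁻¹) = conjSum N x := by
  have := Fintype.ofFinite N
  rw [conjSum_eq N x, ← Equiv.sum_comp (Equiv.mulRight (⟨m, hm⟩ : N)), conjSum_eq]
  exact Finset.sum_congr rfl fun n _ => by simp [mul_assoc]

theorem single_mul_conjSum [N.Normal] (h x : G) :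
    MonoidAlgebra.single h 1 * conjSum N x =
      conjSum N (h * x * h⁻¹) * MonoidAlgebra.single h 1 := by
  have := Fintype.ofFinite N
  rw [conjSum_eq N (h * x * h⁻¹), ← (MulAut.conjNormal h : MulAut N).toEquiv.sum_comp, conjSum_eq,
    Finset.mul_sum, Finset.sum_mul]
  exact Finset.sum_congr rfl fun n _ => by simp [mul_assoc]

theorem conjSum_commute [N.Normal] {x y : G} (hy : y ∈ N) :
    conjSum N x * conjSum N y = conjSum N y * conjSum N x := by
  have := Fintype.ofFinite N
  have h : ∀ z ∈ N, conjSum N x * MonoidAlgebra.single z 1 =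
      MonoidAlgebra.single z 1 * conjSum N x := fun z hz => by
    rw [single_mul_conjSum, conjSum_conj_mem N hz]
  rw [conjSum_eq N y, Finset.mul_sum, Finset.sum_mul]
  exact Finset.sum_congr rfl fun n _ =>
    h _ (N.mul_mem (N.mul_mem n.2 hy) (N.inv_mem n.2))

theorem MonoidAlgebra.coeff_mul_one [Fintype G] (a b : MonoidAlgebra ℂ G) :
    (a * b).coeff 1 = ∑ t, a.coeff t * b.coeff t⁻¹ := by
  have h : LinearMap.mulRight ℂ b = (MonoidAlgebra.basis G ℂ).constr ℂ
      (fun t => MonoidAlgebra.single t 1 * b) :=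
    MonoidAlgebra.linearMap_ext fun x => by
      rw [← MonoidAlgebra.basis_apply, Module.Basis.constr_basis]; rfl
  have h1 := LinearMap.congr_fun h a
  rw [LinearMap.mulRight_apply] at h1
  rw [h1, Module.Basis.constr_apply_fintype]
  simp [MonoidAlgebra.coeff_sum, Finsupp.finsetSum_apply, MonoidAlgebra.basis,
    Module.Basis.equivFun_apply]

theorem coeff_conjSum_inv (x t : G) :
    (conjSum N x⁻¹).coeff t⁻¹ = (conjSum N x).coeff t := by
  rw [coeff_conjSum, coeff_conjSum]
  congr 1
  refine Nat.card_congr (Equiv.subtypeEquivRight fun n => ?_)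
  rw [← inv_inj]
  simp [mul_assoc]

end ConjugacySums

theorem exists_conj_of_not_isVanishing {G : Type} [Group G] [Finite G] (N : Subgroup G) [N.Normal]
    {g : G} (hg : ¬ IsVanishing G g)
    (hcomm : ∀ h : G, ∀ x ∈ N, ∃ n ∈ N,
      (h * g) * x * (h * g)⁻¹ = n * ((g * h) * x * (g * h)⁻¹) * n⁻¹) :
    ∀ x ∈ N, ∃ n ∈ N, g * x * g⁻¹ = n * x * n⁻¹ := by
  intro x hx
  have := Fintype.ofFinite G
  let S : G → MonoidAlgebra ℂ G := fun h => MonoidAlgebra.single h 1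
  have hS : ∀ h k, S h * S k = S (h * k) := fun h k => by simp [S]
  have hS1 : S 1 = 1 := rfl
  let y := conjSum N (g * x * g⁻¹) - conjSum N x
  let z := conjSum N (g * x⁻¹ * g⁻¹) - conjSum N x⁻¹
  by_cases hy : y = 0
  · have h1 := congrArg (fun a => a.coeff (g * x * g⁻¹)) (sub_eq_zero.mp hy)
    simp only [coeff_conjSum] at h1
    have h2 : Nonempty {n : N // (n * x * n⁻¹ : G) = g * x * g⁻¹} := by
      have : Nonempty {n : N // (n * (g * x * g⁻¹) * n⁻¹ : G) = g * x * g⁻¹} := ⟨1, by simp⟩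
      have h3 := Nat.card_pos (α := {n : N // (n * (g * x * g⁻¹) * n⁻¹ : G) = g * x * g⁻¹})
      rw [Nat.cast_inj.mp h1] at h3
      exact (Nat.card_pos_iff.mp h3).1
    obtain ⟨n, hn⟩ := h2
    exact ⟨n, n.2, hn.symm⟩
  exfalso
  let c := ∑ h : G, S h * (y * z) * S h⁻¹
  have hc : ∀ k, S k * c = c * S k := by
    intro k
    have h1 : c = ∑ h : G, S (k * h) * (y * z) * S (k * h)⁻¹ :=
      (Equiv.sum_comp (Equiv.mulLeft k) fun h => S h * (y * z) * S h⁻¹).symm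
    conv_rhs => rw [h1]
    rw [Finset.mul_sum, Finset.sum_mul]
    refine Finset.sum_congr rfl fun h _ => ?_
    rw [mul_assoc _ _ (S k), hS, ← mul_assoc, ← mul_assoc, hS]
    simp
  have hyz : ∃ q : ℝ, 0 < q ∧ (y * z).coeff 1 = q := by
    have h1 : ∀ t, z.coeff t⁻¹ = y.coeff t := by
      intro t
      have : g * x⁻¹ * g⁻¹ = (g * x * g⁻¹)⁻¹ := by simp [mul_assoc]
      simp only [y, z, MonoidAlgebra.coeff_sub, Finsupp.sub_apply, coeff_conjSum_inv, this]
    have h2 : ∀ t, ∃ w : ℝ, y.coeff t = w := fun t => by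
      simp only [y, MonoidAlgebra.coeff_sub, Finsupp.sub_apply, coeff_conjSum]
      exact ⟨Nat.card {n : N // (n * (g * x * g⁻¹) * n⁻¹ : G) = t} -
        Nat.card {n : N // (n * x * n⁻¹ : G) = t}, by push_cast; rfl⟩
    choose w hw using h2
    refine ⟨∑ t, w t * w t, ?_, ?_⟩
    · obtain ⟨t, ht⟩ : ∃ t, w t ≠ 0 := by
        by_contra! h0
        exact hy (MonoidAlgebra.ext (Finsupp.ext fun t => by simp [hw, h0]))
      exact Finset.sum_pos' (fun t _ => mul_self_nonneg _)
        ⟨t, Finset.mem_univ _, mul_self_pos.mpr ht⟩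
    · rw [MonoidAlgebra.coeff_mul_one]
      push_cast
      exact Finset.sum_congr rfl fun t _ => by rw [h1, hw]
  have hc0 : c ≠ 0 := by
    obtain ⟨q, hq, hyz⟩ := hyz
    have h1 : c.coeff 1 = Nat.card G * q := by
      simp only [c, MonoidAlgebra.coeff_sum, Finsupp.finsetSum_apply]
      rw [Finset.sum_congr rfl fun h _ => show (S h * (y * z) * S h⁻¹).coeff 1 = q by
        rw [← hyz]; simp [S]]
      simp
    intro h0
    rw [h0] at h1
    have : (Nat.card G * q : ℂ) ≠ 0 := by
      have := Nat.card_pos (α := G)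
      exact mul_ne_zero (by exact_mod_cast this.ne') (by exact_mod_cast hq.ne')
    exact this (by simpa using h1.symm)
  obtain ⟨m, ρ, hm, hρ, hne⟩ := exists_irreducible_apply_ne_zero hc0
  obtain ⟨μ, hμ⟩ := exists_scalar_of_commute hρ hc
  have hμ0 : μ ≠ 0 := by
    rintro rfl
    exact hne (by rw [hμ, map_zero])
  have htr : ∀ a b, (ρ (a * b)).trace = (ρ (b * a)).trace := fun a b => by
    rw [map_mul, map_mul, Matrix.trace_mul_comm]
  have hterm : ∀ h : G, (ρ (S h * (y * z) * S h⁻¹ * S g)).trace = 0 := by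
    intro h
    let k := conjSum N (h * x * h⁻¹)
    let k' := conjSum N (g * (h * x * h⁻¹) * g⁻¹)
    let w := S h * z * S h⁻¹
    have hx' : h * x * h⁻¹ ∈ N := ‹N.Normal›.conj_mem _ hx _
    have hx'' : g * (h * x * h⁻¹) * g⁻¹ ∈ N := ‹N.Normal›.conj_mem _ hx' _
    have hmove : ∀ u, S h * conjSum N u = conjSum N (h * u * h⁻¹) * S h := single_mul_conjSum N h
    have hk' : S g * k = k' * S g := single_mul_conjSum N g _
    have hy1 : S h * y = (k' - k) * S h := by
      simp only [y, mul_sub, sub_mul, hmove]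
      congr 2
      obtain ⟨n, hn, hn1⟩ := hcomm h x hx
      have e1 : h * (g * x * g⁻¹) * h⁻¹ = (h * g) * x * (h * g)⁻¹ := by simp [mul_assoc]
      have e2 : (g * h) * x * (g * h)⁻¹ = g * (h * x * h⁻¹) * g⁻¹ := by simp [mul_assoc]
      rw [e1, hn1, conjSum_conj_mem N hn, e2]
    have hw : ∀ u ∈ N, conjSum N u * w = w * conjSum N u := by
      intro u hu
      have e1 : w = (conjSum N (h * (g * x⁻¹ * g⁻¹) * h⁻¹) - conjSum N (h * x⁻¹ * h⁻¹)) := by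
        simp only [w, z, mul_sub, sub_mul, hmove]
        simp only [mul_assoc, hS]
        simp [hS1]
      rw [e1, mul_sub, sub_mul, conjSum_commute N hu, conjSum_commute N hu]
    have e2 : S h * (y * z) * S h⁻¹ * S g = k' * (w * S g) - k * (w * S g) := by
      rw [← sub_mul, ← mul_assoc (S h), hy1]
      simp only [w, mul_assoc]
    have e3 : k' * (w * S g) = w * S g * k := by
      rw [← mul_assoc, hw _ hx'', mul_assoc w, ← hk', mul_assoc w]
    rw [e2, e3, map_sub, Matrix.trace_sub, htr, sub_self]
  have h1 : (ρ (c * S g)).trace = 0 := by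
    simp only [c, Finset.sum_mul, map_sum, Matrix.trace_sum, hterm, Finset.sum_const_zero]
  rw [map_mul, hμ, ← Algebra.smul_def, Matrix.trace_smul, smul_eq_mul] at h1
  exact hg (IsIrrChar.isVanishing (χ := fun t => (ρ (S t)).trace) ⟨m, ρ, hm, hρ, fun _ => rfl⟩
    ((mul_eq_zero.mp h1).resolve_left hμ0))

open Polynomial in
theorem Matrix.exists_trace_pow_eq_sum {d n : ℕ} (hn : 0 < n) (A : Matrix (Fin d) (Fin d) ℂ)
    (hA : A ^ n = 1) :
    ∃ m : ℂ → ℕ, ∀ k, (A ^ k).trace = ∑ z ∈ nthRootsFinset n (1 : ℂ), m z * z ^ k := by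
  set s := nthRootsFinset n (1 : ℂ)
  have hvan : ∀ q : ℂ[X], (∀ z ∈ s, q.eval z = 0) → aeval A q = 0 := by
    intro q hq
    have h1 : (X ^ n - 1 : ℂ[X]) ∣ q := by
      rw [X_pow_sub_one_eq_prod hn (Complex.isPrimitiveRoot_exp n hn.ne')]
      refine Finset.prod_dvd_of_coprime ?_ fun z hz => dvd_iff_isRoot.mpr (hq z hz)
      intro a _ b _ hab
      exact isCoprime_X_sub_C_of_isUnit_sub (sub_ne_zero.mpr hab).isUnit
    obtain ⟨c, rfl⟩ := h1
    simp [hA]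
  have hinj : Set.InjOn (id : ℂ → ℂ) s := Set.injOn_id _
  let L : ℂ → ℂ[X] := fun z => Lagrange.basis s id z
  have hL : ∀ z ∈ s, ∀ w ∈ s, (L z).eval w = if w = z then 1 else 0 := by
    intro z hz w hw
    split_ifs with h
    · subst h; exact Lagrange.eval_basis_self hinj hz
    · exact Lagrange.eval_basis_of_ne (v := id) (Ne.symm h) hw
  have htr : ∀ z ∈ s, ∃ m : ℕ, (aeval A (L z)).trace = m := by
    intro z hz
    have hid : IsIdempotentElem (Matrix.toLin' (aeval A (L z))) := by
      have h2 : aeval A (L z * L z - L z) = 0 := hvan _ fun w hw => by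
        rw [eval_sub, eval_mul, hL z hz w hw]; split_ifs <;> simp
      rw [map_sub, map_mul, sub_eq_zero] at h2
      change _ * _ = _
      rw [Module.End.mul_eq_comp, ← Matrix.toLin'_mul, h2]
    exact ⟨_, (Matrix.trace_toLin'_eq _).symm.trans
      (LinearMap.IsProj.trace (LinearMap.IsIdempotentElem.isProj_range _ hid))⟩
  choose! m hm using htr
  refine ⟨m, fun k => ?_⟩
  have h3 : aeval A (X ^ k - ∑ z ∈ s, C (z ^ k) * L z) = 0 := hvan _ fun w hw => by
    simp only [eval_sub, eval_pow, eval_X, eval_finsetSum, eval_mul, eval_C]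
    rw [Finset.sum_congr rfl fun z hz => by rw [hL z hz w hw]]
    simp [hw]
  rw [map_sub, sub_eq_zero, map_pow, aeval_X] at h3
  rw [h3, map_sum, Matrix.trace_sum]
  refine Finset.sum_congr rfl fun z hz => ?_
  rw [map_mul, aeval_C, ← Algebra.smul_def, Matrix.trace_smul, hm z hz, smul_eq_mul, mul_comm]

open Polynomial in
theorem IsIrrChar.exists_eigenvalue_mult {N : Type*} [Group N] [Finite N] {χ : N → ℂ}
    (h : IsIrrChar χ) : ∃ m : N → ℂ → ℕ, ∀ x k,
      χ (x ^ k) = ∑ z ∈ nthRootsFinset (Nat.card N) (1 : ℂ), m x z * z ^ k := by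
  obtain ⟨d, ρ, -, -, hχ⟩ := h
  have hs : ∀ (x : N) k, MonoidAlgebra.single (x ^ k) (1 : ℂ) = MonoidAlgebra.single x 1 ^ k :=
    fun x k => by simp [MonoidAlgebra.single_pow]
  have hone : (MonoidAlgebra.single 1 1 : MonoidAlgebra ℂ N) = 1 := rfl
  choose m hm using fun x : N => Matrix.exists_trace_pow_eq_sum Nat.card_pos
    (ρ (MonoidAlgebra.single x 1)) (by rw [← map_pow, ← hs, pow_card_eq_one', hone, map_one])
  exact ⟨m, fun x k => by rw [hχ, hs, map_pow, hm]⟩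

theorem IsIrrChar.isIntegral {N : Type*} [Group N] [Finite N] {χ : N → ℂ}
    (h : IsIrrChar χ) (x : N) : IsIntegral ℤ (χ x) := by
  obtain ⟨m, hm⟩ := h.exists_eigenvalue_mult
  rw [← pow_one x, hm]
  refine IsIntegral.sum _ fun z hz => IsIntegral.mul ?_ (IsIntegral.pow ?_ _)
  · exact_mod_cast isIntegral_algebraMap (R := ℤ) (A := ℂ) (x := (m x z : ℤ))
  · refine IsIntegral.of_pow (n := Nat.card N) Nat.card_pos ?_
    rw [(Polynomial.mem_nthRootsFinset Nat.card_pos _).mp hz]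
    exact isIntegral_one

open Polynomial in
theorem IsIrrChar.map_inv {N : Type*} [Group N] [Finite N] {χ : N → ℂ}
    (h : IsIrrChar χ) (x : N) : χ x⁻¹ = starRingEnd ℂ (χ x) := by
  obtain ⟨m, hm⟩ := h.exists_eigenvalue_mult
  have hx : x⁻¹ = x ^ (Nat.card N - 1) := by
    rw [inv_eq_iff_mul_eq_one, ← pow_succ', Nat.sub_add_cancel Nat.card_pos, pow_card_eq_one']
  conv_rhs => rw [← pow_one x]
  rw [hx, hm, hm, map_sum]
  refine Finset.sum_congr rfl fun z hz => ?_
  have hz1 := (mem_nthRootsFinset Nat.card_pos _).mp hz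
  have hz2 : starRingEnd ℂ z = z⁻¹ :=
    (Complex.inv_eq_conj (Complex.norm_eq_one_of_pow_eq_one hz1 Nat.card_pos.ne')).symm
  have hz3 : z ^ (Nat.card N - 1) = z⁻¹ := by
    refine eq_inv_of_mul_eq_one_left ?_
    rw [← pow_succ, Nat.sub_add_cancel Nat.card_pos, hz1]
  rw [map_mul, map_natCast, pow_one, hz2, hz3]

open Polynomial in
/-- The product of all values of an irreducible character is rational. -/
theorem IsIrrChar.exists_rat_prod {N : Type*} [Group N] [Fintype N] {χ : N → ℂ}
    (h : IsIrrChar χ) : ∃ q : ℚ, ∏ x, χ x = q := by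
  obtain ⟨m, hm⟩ := h.exists_eigenvalue_mult
  have hn := Nat.card_pos (α := N)
  set n := Nat.card N
  let L := algebraicClosure ℚ ℂ
  have hL : ∀ z ∈ nthRootsFinset n (1 : ℂ), z ∈ L := by
    intro z hz
    rw [mem_algebraicClosure_iff']
    refine IsIntegral.of_pow (n := n) hn ?_
    rw [(mem_nthRootsFinset hn _).mp hz]
    exact isIntegral_one
  let c : N → ℂ → L := fun x z => if hz : z ∈ nthRootsFinset n (1 : ℂ) then ⟨z, hL z hz⟩ else 0
  let v : N → ℕ → L := fun x k => ∑ z ∈ nthRootsFinset n (1 : ℂ), (m x z : L) * c x z ^ k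
  have hc : ∀ x, ∀ z ∈ nthRootsFinset n (1 : ℂ), (c x z : ℂ) = z := fun x z hz => by
    simp only [c, dif_pos hz]
  have hv : ∀ x k, (v x k : ℂ) = χ (x ^ k) := by
    intro x k
    rw [hm]
    simp only [v]
    push_cast
    exact Finset.sum_congr rfl fun z hz => by rw [hc x z hz]
  have hζ0 := Complex.isPrimitiveRoot_exp n hn.ne'
  let ζ : L := ⟨_, hL _ ((mem_nthRootsFinset hn _).mpr hζ0.pow_eq_one)⟩
  have hζ : IsPrimitiveRoot ζ n := IsPrimitiveRoot.of_map_of_injective (f := L.val) hζ0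
    L.val.injective
  have : IsAlgClosure ℚ L := algebraicClosure.isAlgClosure ℚ ℂ
  have : Normal ℚ L := IsAlgClosure.normal ℚ L
  have : IsGalois ℚ L := ⟨⟩
  have hfix : ∏ x, v x 1 ∈ (⊥ : IntermediateField ℚ L) := by
    rw [InfiniteGalois.mem_bot_iff_fixed]
    intro σ
    obtain ⟨k, -, hk⟩ := hζ.eq_pow_of_pow_eq_one (ξ := σ ζ)
      (by rw [← map_pow, hζ.pow_eq_one, map_one])
    have hk1 : IsPrimitiveRoot (ζ ^ k) n := by
      rw [hk]; exact hζ.map_of_injective σ.injective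
    have hcop : k.Coprime n := (hζ.pow_iff_coprime hn k).mp hk1
    have hσ : ∀ z : L, z ^ n = 1 → σ z = z ^ k := by
      intro z hz
      obtain ⟨i, -, rfl⟩ := hζ.eq_pow_of_pow_eq_one hz
      rw [map_pow, ← hk, ← pow_mul, ← pow_mul, mul_comm]
    have hσv : ∀ x, σ (v x 1) = v x k := by
      intro x
      simp only [v, map_sum, map_mul, map_natCast, pow_one]
      refine Finset.sum_congr rfl fun z hz => ?_
      rw [hσ]
      refine Subtype.ext ?_
      push_cast
      rw [hc x z hz, (mem_nthRootsFinset hn _).mp hz]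
    have hperm : ∀ x, v x k = v (x ^ k) 1 := by
      intro x
      refine Subtype.ext ?_
      rw [hv, hv, pow_one]
    rw [map_prod, Finset.prod_congr rfl fun x _ => (hσv x).trans (hperm x)]
    exact Equiv.prod_comp (powCoprime (Nat.Coprime.symm hcop)) fun x => v x 1
  obtain ⟨q, hq⟩ := IntermediateField.mem_bot.mp hfix
  refine ⟨q, ?_⟩
  have h1 := congrArg (fun z : L => (z : ℂ)) hq
  have h2 : ((∏ x, v x 1 : L) : ℂ) = ∏ x, χ x := by
    push_cast
    exact Finset.prod_congr rfl fun x _ => by rw [hv, pow_one]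
  rw [← h2, ← h1]
  simp

theorem IsIrrChar.exists_eq_zero {N : Type*} [Group N] [Finite N] {χ : N → ℂ}
    (h : IsIrrChar χ) (h1 : χ 1 ≠ 1) : ∃ x, χ x = 0 := by
  have := Fintype.ofFinite N
  by_contra! hne
  obtain ⟨q, hq⟩ := h.exists_rat_prod
  have hqi : IsIntegral ℤ q := by
    have : IsIntegral ℤ (∏ x, χ x) := IsIntegral.prod _ fun x _ => h.isIntegral x
    rw [hq] at this
    exact (isIntegral_algebraMap_iff (A := ℚ) (B := ℂ) (algebraMap ℚ ℂ).injective).mp this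
  obtain ⟨p, rfl⟩ := IsIntegrallyClosed.isIntegral_iff.mp hqi
  have hp : p ≠ 0 := by
    rintro rfl
    simp only [map_zero, Rat.cast_zero] at hq
    exact Finset.prod_ne_zero_iff.mpr (fun x _ => hne x) hq
  have hprod : 1 ≤ ∏ x, ‖χ x‖ ^ 2 := by
    rw [Finset.prod_pow, ← norm_prod, hq]
    have : (1 : ℝ) ≤ ‖(((algebraMap ℤ ℚ) p : ℚ) : ℂ)‖ := by
      have : (1 : ℝ) ≤ |(p : ℝ)| := by exact_mod_cast Int.one_le_abs hp
      simpa using this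
    exact one_le_pow₀ this
  have hpos : ∀ x, 0 < ‖χ x‖ ^ 2 := fun x => pow_pos (norm_pos_iff.mpr (hne x)) 2
  have hsum : ∑ x, (‖χ x‖ ^ 2 - 1) = 0 := by
    have h2 := h.sum_mul_inv
    have h3 : ∀ x, χ x * χ x⁻¹ = ((‖χ x‖ ^ 2 : ℝ) : ℂ) := fun x => by
      rw [h.map_inv, Complex.mul_conj, Complex.normSq_eq_norm_sq]
    simp only [h3] at h2
    rw [Finset.sum_sub_distrib, sub_eq_zero]
    have : ((∑ x, ‖χ x‖ ^ 2 : ℝ) : ℂ) = ((Nat.card N : ℝ) : ℂ) := by push_cast at h2 ⊢; exact h2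
    rw [Complex.ofReal_inj.mp this]
    simp
  have hlog : 0 ≤ ∑ x, Real.log (‖χ x‖ ^ 2) := by
    rw [← Real.log_prod fun x _ => (hpos x).ne']
    exact Real.log_nonneg hprod
  have hlt : ∑ x, Real.log (‖χ x‖ ^ 2) < ∑ x, (‖χ x‖ ^ 2 - 1) := by
    refine Finset.sum_lt_sum (fun x _ => Real.log_le_sub_one_of_pos (hpos x))
      ⟨1, Finset.mem_univ _, Real.log_lt_sub_one_of_pos (hpos 1) ?_⟩
    obtain ⟨d, hd, hd1⟩ := h.exists_degree
    rw [hd1] at h1 ⊢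
    have : d ≠ 1 := by rintro rfl; simp at h1
    have h2 : d ^ 2 ≠ 1 := by simpa using this
    rw [Complex.norm_natCast]
    exact_mod_cast h2
  linarith

/-- The ring of algebraic integers in `ℂ`. -/
abbrev AlgInt := integralClosure ℤ ℂ

theorem exists_residueField {r : ℕ} (hr : r.Prime) :
    ∃ (k : Type) (_ : Field k) (_ : CharP k r), Nonempty (AlgInt →+* k) := by
  have hu : ¬ IsUnit (r : AlgInt) := by
    intro h
    obtain ⟨y, hy⟩ := h.exists_right_inv
    have h1 : (r : ℂ) * (y : ℂ) = 1 := by exact_mod_cast congrArg (fun z : AlgInt => (z : ℂ)) hy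
    have hr0 : (r : ℂ) ≠ 0 := by exact_mod_cast hr.ne_zero
    have h2 : (y : ℂ) = algebraMap ℚ ℂ (1 / r) := by
      rw [eq_div_of_mul_eq hr0 ((mul_comm _ _).trans h1)]; simp
    have h3 : IsIntegral ℤ (1 / r : ℚ) :=
      (isIntegral_algebraMap_iff (A := ℚ) (B := ℂ) (algebraMap ℚ ℂ).injective).mp (h2 ▸ y.2)
    obtain ⟨m, hm⟩ := IsIntegrallyClosed.isIntegral_iff.mp h3
    have hr1 : (r : ℚ) ≠ 0 := by exact_mod_cast hr.ne_zero
    have h4 : (r : ℤ) * m = 1 := by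
      have : (r : ℚ) * (m : ℚ) = 1 := by
        have : (m : ℚ) = 1 / r := by simpa using hm
        rw [this]; field_simp
      exact_mod_cast this
    have h5 := Int.isUnit_iff.mp (IsUnit.of_mul_eq_one _ h4)
    have := hr.two_le
    omega
  obtain ⟨P, hP, hle⟩ := Ideal.exists_le_maximal _ ((Ideal.span_singleton_ne_top hu))
  let k := AlgInt ⧸ P
  let _ : Field k := Ideal.Quotient.field P
  refine ⟨k, inferInstance, ?_, ⟨Ideal.Quotient.mk P⟩⟩
  have h0 : (r : k) = 0 := by
    have : Ideal.Quotient.mk P (r : AlgInt) = 0 :=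
      Ideal.Quotient.eq_zero_iff_mem.mpr (hle (Ideal.mem_span_singleton_self _))
    simpa using this
  have := CharP.exists k
  obtain ⟨q, hq⟩ := this
  have h1 : q ∣ r := (CharP.cast_eq_zero_iff k q r).mp h0
  rcases (Nat.dvd_prime hr).mp h1 with rfl | rfl
  · exact absurd rfl (CharP.char_ne_one k 1)
  · exact hq

section
variable {N : Type*} [Group N]

/-- An element of the center of `ℤ̄[N]` acts through `θ` by an algebraic integer. -/
theorem IsIrrChar.exists_scalar [Finite N] {m : ℕ}
    {ρ : MonoidAlgebra ℂ N →ₐ[ℂ] Matrix (Fin m) (Fin m) ℂ} (hm : 0 < m)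
    (hρ : Function.Surjective ρ)
    {z : MonoidAlgebra AlgInt N} (hz : z ∈ Subring.center (MonoidAlgebra AlgInt N)) :
    ∃ c : AlgInt, ρ (MonoidAlgebra.mapRingHom N (algebraMap AlgInt ℂ) z) =
      algebraMap ℂ _ (c : ℂ) := by
  set ι := MonoidAlgebra.mapRingHom N (algebraMap AlgInt ℂ)
  have hι : ∀ x : N, ι (MonoidAlgebra.single x 1) = MonoidAlgebra.single x 1 := fun x => by
    simp [ι]
  obtain ⟨c, hc⟩ := exists_scalar_of_commute hρ (a := ι z) fun x => by
    rw [← hι, ← map_mul, ← map_mul, Subring.mem_center_iff.mp hz]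
  have : Module.Finite AlgInt (MonoidAlgebra AlgInt N) :=
    Module.Finite.of_basis (MonoidAlgebra.basis N AlgInt)
  have h1 : IsIntegral AlgInt z := IsIntegral.of_finite AlgInt z
  have : Nonempty (Fin m) := ⟨⟨0, hm⟩⟩
  have h2 : IsIntegral AlgInt (algebraMap ℂ (Matrix (Fin m) (Fin m) ℂ) c) := by
    rw [← hc]
    exact h1.map (({ (ρ : MonoidAlgebra ℂ N →+* _).comp ι with
      commutes' := fun a => by
        change ρ (ι (algebraMap _ _ a)) = _
        have : ι (algebraMap AlgInt (MonoidAlgebra AlgInt N) a) =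
            algebraMap ℂ _ (a : ℂ) := by
          simp [ι]
        rw [this, AlgHom.commutes]
        rfl }) : MonoidAlgebra AlgInt N →ₐ[AlgInt] Matrix (Fin m) (Fin m) ℂ)
  have h3 : IsIntegral AlgInt c :=
    (isIntegral_algHom_iff (Algebra.ofId ℂ (Matrix (Fin m) (Fin m) ℂ) |>.restrictScalars AlgInt)
      (algebraMap ℂ (Matrix (Fin m) (Fin m) ℂ)).injective).mp h2
  exact ⟨⟨c, isIntegral_trans c h3⟩, hc⟩

theorem IsIrrChar.charLin_mul_of_central [Finite N] {θ : N → ℂ} (h : IsIrrChar θ)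
    {z : MonoidAlgebra AlgInt N} (hz : z ∈ Subring.center (MonoidAlgebra AlgInt N)) :
    ∃ c : AlgInt, ∀ a, charLin θ (MonoidAlgebra.mapRingHom N (algebraMap AlgInt ℂ) z * a) =
      c * charLin θ a := by
  obtain ⟨m, ρ, hm, hρ, hθ⟩ := h
  obtain ⟨c, hc⟩ := IsIrrChar.exists_scalar hm hρ hz
  refine ⟨c, fun a => ?_⟩
  rw [charLin_eq_trace hθ, charLin_eq_trace hθ, map_mul, hc, ← Algebra.smul_def,
    Matrix.trace_smul, smul_eq_mul]

theorem charLin_one (θ : N → ℂ) : charLin θ 1 = θ 1 := by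
  rw [MonoidAlgebra.one_def, charLin_single, one_mul]

/-- The central character of `θ`, as a map on the center of `ℤ̄[N]`. -/
theorem IsIrrChar.exists_centralChar [Finite N] {θ : N → ℂ} (h : IsIrrChar θ) :
    ∃ ω : Subring.center (MonoidAlgebra AlgInt N) →* AlgInt,
      ∀ z, charLin θ (MonoidAlgebra.mapRingHom N (algebraMap AlgInt ℂ) z.1) = ω z * θ 1 := by
  choose c hc using fun z : Subring.center (MonoidAlgebra AlgInt N) =>
    h.charLin_mul_of_central z.2
  have h1 : ∀ z, charLin θ (MonoidAlgebra.mapRingHom N (algebraMap AlgInt ℂ) z.1) = c z * θ 1 :=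
    fun z => by rw [← charLin_one θ, ← hc, mul_one]
  refine ⟨⟨⟨c, ?_⟩, ?_⟩, h1⟩
  · refine Subtype.ext (mul_right_cancel₀ h.map_one_ne_zero ?_)
    rw [← h1]
    simp [charLin_one]
  · intro x y
    refine Subtype.ext (mul_right_cancel₀ h.map_one_ne_zero ?_)
    rw [← h1]
    simp only [Subring.coe_mul, map_mul]
    rw [hc, h1]
    push_cast
    ring

/-- The degree of an irreducible character. -/
def Irr.degree (χ : Irr N) : ℕ := χ.2.exists_degree.choose

theorem Irr.map_one (χ : Irr N) : χ.1 1 = χ.degree := χ.2.exists_degree.choose_spec.2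

/-- The central character of an irreducible character. -/
def Irr.centralChar [Finite N] (χ : Irr N) :
    Subring.center (MonoidAlgebra AlgInt N) →* AlgInt := χ.2.exists_centralChar.choose

theorem Irr.charLin_eq [Finite N] (χ : Irr N) (z : Subring.center (MonoidAlgebra AlgInt N)) :
    charLin χ.1 (MonoidAlgebra.mapRingHom N (algebraMap AlgInt ℂ) z.1) =
      χ.centralChar z * χ.1 1 := χ.2.exists_centralChar.choose_spec z

theorem Irr.sum_coeff_mul [Fintype N] (χ : Irr N)
    (z : Subring.center (MonoidAlgebra AlgInt N)) :
    ∑ x, (z.1.coeff x : ℂ) * χ.1 x = χ.centralChar z * χ.1 1 := by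
  rw [← χ.charLin_eq, charLin_eq_sum]
  rfl

theorem Irr.sum_degree_sq_mul [Finite N] (z : Subring.center (MonoidAlgebra AlgInt N)) :
    ∑ χ : Irr N, (χ.degree : AlgInt) ^ 2 * χ.centralChar z = Nat.card N * z.1.coeff 1 := by
  refine Subtype.ext ?_
  have h := sum_irr_mul_charLin (MonoidAlgebra.mapRingHom N (algebraMap AlgInt ℂ) z.1)
  push_cast
  simp only [Irr.charLin_eq, Irr.map_one] at h
  have h2 : ((MonoidAlgebra.mapRingHom N (algebraMap AlgInt ℂ) z.1).coeff 1) =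
    (z.1.coeff 1 : ℂ) := rfl
  rw [h2] at h
  rw [← h]
  exact Finset.sum_congr rfl fun χ _ => by ring

/-- The trivial character. -/
def Irr.trivial (N : Type*) [Group N] : Irr N := ⟨fun _ => 1, isIrrChar_of_monoidHom 1⟩

end

section
variable {N : Type*} [Group N]

theorem MonoidAlgebra.mem_center_of_coeff_conj {R : Type*} [CommRing R] [Finite N]
    {z : MonoidAlgebra R N} (hz : ∀ x y, z.coeff (x * y * x⁻¹) = z.coeff y) :
    z ∈ Subring.center (MonoidAlgebra R N) := by
  refine Subring.mem_center_iff.mpr fun a => ?_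
  induction a using MonoidAlgebra.induction_linear with
  | zero => simp
  | add f g hf hg => rw [add_mul, mul_add, hf, hg]
  | single x c =>
    refine MonoidAlgebra.ext (Finsupp.ext fun t => ?_)
    rw [MonoidAlgebra.coeff_single_mul_apply, MonoidAlgebra.coeff_mul_single_apply,
      ← hz x⁻¹ (t * x⁻¹), mul_comm]
    congr 2
    group

theorem MonoidAlgebra.coeff_conj_of_mem_center {R : Type*} [CommRing R]
    {z : MonoidAlgebra R N} (hz : z ∈ Subring.center (MonoidAlgebra R N)) (x y : N) :
    z.coeff (x * y * x⁻¹) = z.coeff y := by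
  have h := congrArg (fun a => a.coeff (x * y))
    (Subring.mem_center_iff.mp hz (MonoidAlgebra.single x 1))
  simp only [MonoidAlgebra.coeff_single_mul_apply, MonoidAlgebra.coeff_mul_single_apply,
    one_mul, mul_one, inv_mul_cancel_left] at h
  exact h.symm

/-- The central element with prescribed coefficients. -/
def centralOf [Finite N] (c : N → AlgInt) (hc : ∀ x y, c (x * y * x⁻¹) = c y) :
    Subring.center (MonoidAlgebra AlgInt N) :=
  ⟨⟨Finsupp.equivFunOnFinite.symm c⟩, MonoidAlgebra.mem_center_of_coeff_conj hc⟩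

theorem Irr.sum_centralOf [Fintype N] (χ : Irr N) (c : N → AlgInt)
    (hc : ∀ x y, c (x * y * x⁻¹) = c y) :
    ∑ x, (c x : ℂ) * χ.1 x = χ.centralChar (centralOf c hc) * χ.1 1 :=
  χ.sum_coeff_mul (centralOf c hc)

/-- The degree of an irreducible character divides the group order (in `ℤ̄`). -/
theorem Irr.degree_dvd [Finite N] (χ : Irr N) : (χ.degree : AlgInt) ∣ (Nat.card N : AlgInt) := by
  have := Fintype.ofFinite N
  have h := χ.sum_centralOf (fun x => ⟨χ.1 x⁻¹, χ.2.isIntegral _⟩) fun x y => by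
    refine Subtype.ext ?_
    change χ.1 (x * y * x⁻¹)⁻¹ = χ.1 y⁻¹
    rw [mul_inv_rev, mul_inv_rev, inv_inv, ← mul_assoc, χ.2.map_conj]
  generalize χ.centralChar _ = w at h
  refine ⟨w, Subtype.ext ?_⟩
  push_cast
  rw [← χ.map_one, mul_comm, ← h, ← χ.2.sum_mul_inv]
  exact Finset.sum_congr rfl fun x _ => mul_comm _ _

theorem Irr.degree_ne_zero [Finite N] (χ : Irr N) {r : ℕ} {k : Type*} [Field k]
    [CharP k r] (red : AlgInt →+* k) (hN : ¬ r ∣ Nat.card N) : (χ.degree : k) ≠ 0 := by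
  intro h0
  have := map_dvd red χ.degree_dvd
  rw [map_natCast, map_natCast, h0, zero_dvd_iff, CharP.cast_eq_zero_iff k r] at this
  exact hN this

/-- `χ` lies in the principal block, with respect to a reduction map `red`. -/
def InPrincipalBlock [Finite N] {k : Type*} [Field k] (red : AlgInt →+* k) (χ : Irr N) : Prop :=
  ∀ z, red (χ.centralChar z) = red ((Irr.trivial N).centralChar z)

theorem sum_principalBlock [Finite N] {r : ℕ} {k : Type*} [Field k] [CharP k r]
    (red : AlgInt →+* k) (hN : r ∣ Nat.card N) :
    ∑ χ : Irr N with InPrincipalBlock red χ, (χ.degree : k) ^ 2 = 0 := by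
  let Z := Subring.center (MonoidAlgebra AlgInt N)
  let lam : Irr N → (Z →* k) := fun χ => (red : AlgInt →* k).comp χ.centralChar
  have hli := linearIndependent_monoidHom Z k
  have h1 : ∑ f ∈ Finset.univ.image lam,
      (∑ χ : Irr N with lam χ = f, (χ.degree : k) ^ 2) • (f : Z → k) = 0 := by
    funext z
    have h2 := congrArg red (Irr.sum_degree_sq_mul z)
    rw [map_mul, map_natCast, (CharP.cast_eq_zero_iff k r _).mpr hN, zero_mul, map_sum] at h2
    rw [Finset.sum_apply, Pi.zero_apply, ← h2,
      ← Finset.sum_fiberwise_of_maps_to (g := lam) (t := Finset.univ.image lam)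
        fun χ _ => Finset.mem_image_of_mem _ (Finset.mem_univ χ)]
    refine Finset.sum_congr rfl fun f _ => ?_
    rw [Pi.smul_apply, smul_eq_mul, Finset.sum_mul]
    refine Finset.sum_congr rfl fun χ hχ => ?_
    rw [← (Finset.mem_filter.mp hχ).2]
    simp [lam]
  have h3 := linearIndependent_iff'.mp hli _ _ h1 (lam (Irr.trivial N))
    (Finset.mem_image_of_mem _ (Finset.mem_univ _))
  rw [← h3]
  refine Finset.sum_congr ?_ fun _ _ => rfl
  ext χ
  simp only [Finset.mem_filter, Finset.mem_univ, true_and]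
  exact ⟨fun h => MonoidHom.ext h, fun h z => DFunLike.congr_fun h z⟩

theorem inPrincipalBlock_iff [Fintype N] {k : Type*} [Field k] {red : AlgInt →+* k} {χ : Irr N} :
    InPrincipalBlock red χ ↔ ∀ (c : N → AlgInt), (∀ x y, c (x * y * x⁻¹) = c y) →
      ∃ w : AlgInt, ∑ x, (c x : ℂ) * χ.1 x = w * χ.1 1 ∧ red w = red (∑ x, c x) := by
  have htriv : ∀ z, (Irr.trivial N).centralChar z = ∑ x, z.1.coeff x := fun z => by
    refine Subtype.ext ?_
    have h := (Irr.trivial N).sum_coeff_mul z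
    simp only [Irr.trivial, mul_one] at h
    push_cast
    exact h.symm
  constructor
  · intro h c hc
    exact ⟨_, χ.sum_centralOf c hc, (h _).trans (congrArg red (htriv _))⟩
  · intro h z
    obtain ⟨w, hw, hr⟩ := h (fun x => z.1.coeff x) (MonoidAlgebra.coeff_conj_of_mem_center z.2)
    rw [htriv, ← hr]
    congr 1
    refine Subtype.ext (mul_right_cancel₀ χ.2.map_one_ne_zero ?_)
    rw [← hw, χ.sum_coeff_mul]

end

theorem InPrincipalBlock.smul {G : Type*} [Group G] {N : Subgroup G} [N.Normal] [Finite N]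
    {k : Type*} [Field k] {red : AlgInt →+* k} {χ : Irr N} (h : InPrincipalBlock red χ) (g : G) :
    InPrincipalBlock red (g • χ) := by
  have := Fintype.ofFinite N
  rw [inPrincipalBlock_iff] at h ⊢
  intro c hc
  let e : MulAut N := MulAut.conjNormal g
  have he : ∀ x, MulAut.conjNormal g⁻¹ (e x) = x := fun x => by simp [e]
  obtain ⟨w, hw, hr⟩ := h (fun x => c (e x)) fun x y => by
    simp only [map_mul, map_inv, hc]
  refine ⟨w, ?_, hr.trans (congrArg red (Equiv.sum_comp e.toEquiv c))⟩
  rw [irr_smul_apply, map_one, ← hw, ← Equiv.sum_comp e.toEquiv]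
  refine Finset.sum_congr rfl fun x _ => ?_
  rw [irr_smul_apply]
  change _ * χ.1 (MulAut.conjNormal g⁻¹ (e x)) = _
  rw [he]
  rfl

theorem InPrincipalBlock.not_dvd_eq_zero {N : Type*} [Group N] [Fintype N] {k : Type*} [Field k]
    {r : ℕ} [CharP k r] {red : AlgInt →+* k} {χ : Irr N} (h : InPrincipalBlock red χ) {x : N}
    (hx : χ.1 x = 0) : r ∣ (Finset.univ.filter fun y => IsConj x y).card := by
  have hconj : ∀ a y : N, IsConj x (a * y * a⁻¹) ↔ IsConj x y := fun a y =>
    ⟨fun h => h.trans (isConj_iff.mpr ⟨a⁻¹, by group⟩), fun h => h.trans (isConj_iff.mpr ⟨a, rfl⟩)⟩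
  obtain ⟨w, hw, hr⟩ := inPrincipalBlock_iff.mp h (fun y => if IsConj x y then 1 else 0)
    fun a y => by simp only [hconj]
  have h0 : ∑ y, ((if IsConj x y then 1 else 0 : AlgInt) : ℂ) * χ.1 y = 0 := by
    refine Finset.sum_eq_zero fun y _ => ?_
    split_ifs with hy
    · obtain ⟨a, rfl⟩ := isConj_iff.mp hy
      rw [χ.2.map_conj, hx, mul_zero]
    · simp
  have hw0 : w = 0 := by
    refine Subtype.ext ?_
    rw [h0] at hw
    exact (mul_eq_zero.mp hw.symm).resolve_right χ.2.map_one_ne_zero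
  rw [hw0, map_zero, Finset.sum_boole, map_natCast] at hr
  exact (CharP.cast_eq_zero_iff k r _).mp hr.symm

/-- The linear characters in the principal block invariant under `P`. -/
def principalLinear {G : Type*} [Group G] (N : Subgroup G) [N.Normal] [Fintype N] (P : Subgroup G)
    {k : Type*} [Field k] (red : AlgInt →+* k) : Submonoid (N →* ℂˣ) where
  carrier := {f | InPrincipalBlock red (⟨_, isIrrChar_of_monoidHom f⟩ : Irr N) ∧
    ∀ g ∈ P, ∀ x, f (MulAut.conjNormal g x) = f x}
  one_mem' := ⟨fun z => rfl, fun _ _ _ => rfl⟩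
  mul_mem' := by
    rintro f _ ⟨hf, hf2⟩ ⟨hg, hg2⟩
    refine ⟨?_, fun a ha x => by simp only [MonoidHom.mul_apply, hf2 a ha, hg2 a ha]⟩
    rw [inPrincipalBlock_iff] at hf hg ⊢
    intro c hc
    obtain ⟨w, hw, hr⟩ := hf c hc
    obtain ⟨w', hw', hr'⟩ := hg
      (fun x => c x * ⟨f x, (isIrrChar_of_monoidHom f).isIntegral x⟩) fun x y => by
        simp only [hc]
        congr 2
        rw [map_mul, map_mul, map_inv, mul_comm (f x), mul_inv_cancel_right]
    refine ⟨w', ?_, ?_⟩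
    · simp only [map_one, Units.val_one, mul_one] at hw' ⊢
      rw [← hw']
      refine Finset.sum_congr rfl fun x _ => ?_
      simp only [MonoidHom.mul_apply, Units.val_mul]
      push_cast
      ring
    · rw [hr', ← hr]
      congr 1
      refine Subtype.ext ?_
      simp only [map_one, Units.val_one, mul_one] at hw
      rw [← hw]
      push_cast
      rfl

instance {N : Type*} [Group N] [Finite N] : Finite (N →* ℂˣ) :=
  Finite.of_injective (fun f => (⟨_, isIrrChar_of_monoidHom f⟩ : Irr N)) fun _ _ h =>
    MonoidHom.ext fun x => Units.ext (congrFun (congrArg Subtype.val h) x)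

/-- If every `P`-invariant character in the principal block of `N` is linear, and `r` divides
`|N|`, then there is a `P`-invariant linear character of order `r`. -/
theorem exists_invariant_monoidHom {G : Type*} [Group G] (N : Subgroup G) [N.Normal] [Finite N]
    (P : Subgroup G) [Finite P] {r : ℕ} [Fact r.Prime] (hP : IsPGroup r P) {k : Type*} [Field k]
    [CharP k r] (red : AlgInt →+* k) (hN : r ∣ Nat.card N)
    (hlin : ∀ χ : Irr N, InPrincipalBlock red χ → (∀ g ∈ P, g • χ = χ) → χ.1 1 = 1) :
    ∃ f : N →* ℂˣ, f ≠ 1 ∧ f ^ r = 1 ∧ ∀ g ∈ P, ∀ x, f (MulAut.conjNormal g x) = f x := by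
  have := Fintype.ofFinite N
  have hdeg : ∀ (g : P) (χ : Irr N), (g • χ).degree = χ.degree := fun g χ => by
    have h : ((g : G) • χ).1 1 = χ.1 1 := by rw [irr_smul_apply, map_one]
    rw [Irr.map_one, Irr.map_one] at h
    exact_mod_cast h
  have hblk : ∀ (g : P) (χ : Irr N), InPrincipalBlock red (g • χ) ↔ InPrincipalBlock red χ :=
    fun g χ => ⟨fun h => by
      have h1 := h.smul (g : G)⁻¹
      rwa [show (g : G)⁻¹ • g • χ = χ from inv_smul_smul (g : G) χ] at h1, fun h => h.smul (g : G)⟩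
  have h1 := sum_principalBlock red hN
  rw [Finset.sum_filter, hP.sum_eq_sum_fixedPoints _ fun g χ => by rw [hdeg, hblk],
    ← Finset.sum_filter, Finset.filter_filter] at h1
  have h2 : ∀ χ ∈ Finset.univ.filter fun χ : Irr N =>
      χ ∈ MulAction.fixedPoints P (Irr N) ∧ InPrincipalBlock red χ, (χ.degree : k) ^ 2 = 1 := by
    intro χ hχ
    obtain ⟨-, hfix, hb⟩ := Finset.mem_filter.mp hχ
    have h := hlin χ hb fun g hg => hfix ⟨g, hg⟩
    rw [Irr.map_one] at h
    have : χ.degree = 1 := by exact_mod_cast h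
    rw [this]; simp
  rw [Finset.sum_congr rfl h2, Finset.sum_const, nsmul_one, CharP.cast_eq_zero_iff k r] at h1
  let F := principalLinear N P red
  let F' : Subgroup (N →* ℂˣ) :=
    { F with
      inv_mem' := fun {f} hf => by
        have : f⁻¹ = f ^ (Nat.card (N →* ℂˣ) - 1) := by
          exact (eq_inv_of_mul_eq_one_right (α := N →* ℂˣ)
            ((mul_pow_sub_one Nat.card_pos.ne' f).trans pow_card_eq_one')).symm
        rw [this]
        exact F.pow_mem hf _ }
  have hcard : Nat.card F' = (Finset.univ.filter fun χ : Irr N =>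
      χ ∈ MulAction.fixedPoints P (Irr N) ∧ InPrincipalBlock red χ).card := by
    rw [← Nat.card_eq_finsetCard]
    refine Nat.card_congr (Equiv.ofBijective (fun f => ⟨⟨_, isIrrChar_of_monoidHom f.1⟩, ?_⟩)
      ⟨?_, ?_⟩)
    · refine Finset.mem_filter.mpr ⟨Finset.mem_univ _,
        fun g => Subtype.ext (funext fun x => ?_), f.2.1⟩
      have := f.2.2 g⁻¹ (P.inv_mem g.2) x
      exact congrArg Units.val this
    · intro f g h
      exact Subtype.ext (MonoidHom.ext fun x =>
        Units.ext (congrFun (congrArg Subtype.val (congrArg Subtype.val h)) x))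
    · rintro ⟨χ, hχ⟩
      obtain ⟨-, hfix, hb⟩ := Finset.mem_filter.mp hχ
      have hfix' : ∀ g ∈ P, g • χ = χ := fun g hg => hfix ⟨g, hg⟩
      obtain ⟨f, hf⟩ := χ.2.exists_monoidHom (hlin χ hb hfix')
      have hfχ : (⟨_, isIrrChar_of_monoidHom f⟩ : Irr N) = χ :=
        Subtype.ext (funext fun x => (hf x).symm)
      refine ⟨⟨f, by rwa [hfχ], fun g hg x => Units.ext ?_⟩, Subtype.ext hfχ⟩
      have h3 := congrFun (congrArg Subtype.val (hfix' g⁻¹ (P.inv_mem hg))) x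
      rw [irr_smul_apply, inv_inv, hf, hf] at h3
      exact h3
  rw [← hcard] at h1
  obtain ⟨f, hf⟩ := exists_prime_orderOf_dvd_card' r h1
  refine ⟨f, ?_, ?_, f.2.2⟩
  · rintro h
    have : f = 1 := Subtype.ext h
    rw [this, orderOf_one] at hf
    exact (Fact.out : r.Prime).one_lt.ne hf
  · exact_mod_cast congrArg Subtype.val (hf ▸ pow_orderOf_eq_one f)

theorem card_isConj_eq_index {N : Type*} [Group N] [Fintype N] (x : N) :
    (Finset.univ.filter fun y => IsConj x y).card = (Subgroup.centralizer {x}).index := by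
  have h := MulAction.index_stabilizer (ConjAct N) x
  rw [ConjAct.stabilizer_eq_centralizer] at h
  have h1 : (Subgroup.centralizer {x}).index =
      (Subgroup.centralizer {ConjAct.toConjAct x} : Subgroup (ConjAct N)).index := rfl
  rw [h1, h, ← Set.ncard_coe_finset]
  congr 1
  ext y
  simp only [Finset.coe_filter, Finset.mem_univ, true_and, Set.mem_ofPred_eq,
    ConjAct.mem_orbit_conjAct, isConj_comm]

theorem IsPGroup.exists_conj_mem {G : Type*} [Group G] {r : ℕ} [Fact r.Prime] {P : Subgroup G}
    [Finite P] (hP : IsPGroup r P) (H : Subgroup G) (hH : ¬ r ∣ H.index) :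
    ∃ g : G, ∀ p ∈ P, g * p * g⁻¹ ∈ H := by
  have : H.FiniteIndex := ⟨fun h => hH (h ▸ dvd_zero r)⟩
  obtain ⟨q, hq⟩ := hP.nonempty_fixed_point_of_prime_not_dvd_card (G ⧸ H) hH
  induction q using QuotientGroup.induction_on with
  | H g =>
    refine ⟨g⁻¹, fun p hp => ?_⟩
    have h : (QuotientGroup.mk (p * g) : G ⧸ H) = QuotientGroup.mk g := hq ⟨p, hp⟩
    have h1 := QuotientGroup.eq.mp h.symm
    rwa [inv_inv, mul_assoc]

theorem Subgroup.commutator_mem_iff {G : Type*} [Group G] {K : Subgroup G} [K.Normal] {x y : G} :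
    x * y * x⁻¹ * y⁻¹ ∈ K ↔ (x : G ⧸ K) * y = y * x := by
  rw [← QuotientGroup.eq_one_iff]
  change (x : G ⧸ K) * y * (x : G ⧸ K)⁻¹ * (y : G ⧸ K)⁻¹ = 1 ↔ _
  rw [mul_inv_eq_one, mul_inv_eq_iff_eq_mul]

theorem Subgroup.index_centralizer_dvd {G : Type*} [Group G] [Finite G] (N : Subgroup G) [N.Normal]
    (x : N) : (Subgroup.centralizer {x}).index ∣ (Subgroup.centralizer {(x : G)}).index := by
  have h1 : (Subgroup.centralizer {x}) = (Subgroup.centralizer {(x : G)}).subgroupOf N := by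
    ext y
    simp only [Subgroup.mem_subgroupOf, Subgroup.mem_centralizer_singleton_iff, Subtype.ext_iff,
      Subgroup.coe_mul]
  rw [h1]
  change (Subgroup.centralizer {(x : G)}).relIndex N ∣ _
  set C := Subgroup.centralizer {(x : G)}
  have h2 := Subgroup.relIndex_mul_index (inf_le_right : C ⊓ N ≤ N)
  have h3 := Subgroup.relIndex_mul_index (inf_le_left : C ⊓ N ≤ C)
  have h4 := Subgroup.relIndex_mul_index (le_sup_left : N ≤ N ⊔ C)
  rw [Subgroup.inf_relIndex_right] at h2
  rw [Subgroup.inf_relIndex_left] at h3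
  rw [Subgroup.relIndex_sup_left] at h4
  rw [← h4, ← h3, mul_left_comm] at h2
  exact Dvd.intro _ (Nat.eq_of_mul_eq_mul_left
    (Nat.pos_of_ne_zero (Subgroup.index_ne_zero_of_finite (H := N.subgroupOf C))) h2)

theorem mem_center_of_classes {G : Type} [Group G] [Finite G] {r : ℕ} [Fact r.Prime]
    (hv : ∀ x : G, IsVanishing G x → ¬ r ∣ classSize x) {K : Subgroup G} [K.Normal]
    (hK : IsPGroup r (G ⧸ K)) {x : G} (hx : IsVanishing G x) (y : G) :
    x * y * x⁻¹ * y⁻¹ ∈ K := by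
  have h1 : ((Subgroup.centralizer {x}).map (QuotientGroup.mk' K)).index ∣ classSize x :=
    Subgroup.index_map_dvd _ (QuotientGroup.mk'_surjective K)
  obtain ⟨n, hn⟩ := hK.index ((Subgroup.centralizer {x}).map (QuotientGroup.mk' K))
  have h2 : n = 0 := by
    by_contra h
    exact hv x hx ((dvd_pow_self r h).trans (hn ▸ h1))
  rw [h2, pow_zero, Subgroup.index_eq_one] at hn
  have h3 : (y : G ⧸ K) ∈ (Subgroup.centralizer {x}).map (QuotientGroup.mk' K) :=
    hn ▸ Subgroup.mem_top _
  obtain ⟨c, hc, hcy⟩ := h3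
  have h4 : (y : G ⧸ K) = (c : G ⧸ K) := hcy.symm
  rw [Subgroup.commutator_mem_iff, h4]
  exact congrArg _ (Subgroup.mem_centralizer_singleton_iff.mp hc).symm

theorem exists_irrChar_eq_zero {Q : Type*} [Group Q] [Finite Q] {x y z : Q}
    (hz : z ∈ Subgroup.center Q) (hz1 : z ≠ 1) (h : x * y = z * (y * x)) :
    ∃ χ : Q → ℂ, IsIrrChar χ ∧ χ x = 0 := by
  have ha : MonoidAlgebra.single z (1 : ℂ) - 1 ≠ 0 := by
    intro h0
    rw [sub_eq_zero, MonoidAlgebra.one_def] at h0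
    have := congrArg (fun a => a.coeff z) h0
    simp [Ne.symm hz1] at this
  obtain ⟨m, ρ, hm, hρ, hne⟩ := exists_irreducible_apply_ne_zero ha
  obtain ⟨c, hc⟩ := exists_scalar_of_commute hρ (a := MonoidAlgebra.single z 1) fun w => by
    rw [MonoidAlgebra.single_mul_single, MonoidAlgebra.single_mul_single,
      Subgroup.mem_center_iff.mp hz]
  have hc1 : c ≠ 1 := by
    rintro rfl
    rw [map_sub, hc, map_one, map_one, sub_self] at hne
    exact hne rfl
  have hχ : IsIrrChar fun w => (ρ (MonoidAlgebra.single w 1)).trace := ⟨m, ρ, hm, hρ, fun _ => rfl⟩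
  refine ⟨_, hχ, ?_⟩
  have h1 : x = z * (y * x * y⁻¹) := by
    rw [← mul_assoc, ← h, mul_inv_cancel_right]
  have h2 := hχ.map_conj y x
  have h3 : (ρ (MonoidAlgebra.single x 1)).trace =
      c * (ρ (MonoidAlgebra.single (y * x * y⁻¹) 1)).trace := by
    conv_lhs => rw [h1, ← one_mul (1 : ℂ), ← MonoidAlgebra.single_mul_single, map_mul, hc,
      ← Algebra.smul_def, Matrix.trace_smul, smul_eq_mul]
  change _ = (ρ (MonoidAlgebra.single x 1)).trace at h2
  rw [h2] at h3
  have h4 : (1 - c) * (ρ (MonoidAlgebra.single x 1)).trace = 0 := by linear_combination h3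
  exact (mul_eq_zero.mp h4).resolve_left (sub_ne_zero.mpr hc1.symm)

/-- If every vanishing class has size prime to `r`, any normal subgroup with an `r`-group quotient
has an abelian quotient. -/
theorem commutator_mem_of_isPGroup_quotient {G : Type} [Group G] [Finite G] {r : ℕ} [Fact r.Prime]
    (hv : ∀ x : G, IsVanishing G x → ¬ r ∣ classSize x) {K : Subgroup G} [K.Normal]
    (hK : IsPGroup r (G ⧸ K)) (x y : G) : x * y * x⁻¹ * y⁻¹ ∈ K := by
  have hcomm : Subgroup.center (G ⧸ K) = ⊤ := by
    by_contra hne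
    let Z := Subgroup.center (G ⧸ K)
    have : Nontrivial ((G ⧸ K) ⧸ Z) := by
      rw [QuotientGroup.nontrivial_iff]; exact hne
    have hp : IsPGroup r ((G ⧸ K) ⧸ Z) := hK.to_quotient Z
    have := hp.center_nontrivial
    obtain ⟨⟨w, hw⟩, hw1⟩ := exists_ne (1 : Subgroup.center ((G ⧸ K) ⧸ Z))
    obtain ⟨u, rfl⟩ := QuotientGroup.mk_surjective w
    have hu : u ∉ Z := fun h => hw1 (Subtype.ext ((QuotientGroup.eq_one_iff u).mpr h))
    have hcz : ∀ v, u * v * u⁻¹ * v⁻¹ ∈ Z := fun v => by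
      rw [Subgroup.commutator_mem_iff, Subgroup.mem_center_iff.mp hw]
    obtain ⟨v, hv'⟩ : ∃ v, u * v * u⁻¹ * v⁻¹ ≠ 1 := by
      by_contra! hall
      refine hu (Subgroup.mem_center_iff.mpr fun v => ?_)
      have := hall v
      rw [mul_inv_eq_one, mul_inv_eq_iff_eq_mul] at this
      exact this.symm
    obtain ⟨χ, hχ, h0⟩ := exists_irrChar_eq_zero (hcz v) hv' (x := u) (y := v) (by group)
    obtain ⟨x, rfl⟩ := QuotientGroup.mk_surjective u
    have hxv : IsVanishing G x :=
      (hχ.comp (QuotientGroup.mk'_surjective K)).isVanishing h0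
    refine hu (Subgroup.mem_center_iff.mpr fun v => ?_)
    obtain ⟨y, rfl⟩ := QuotientGroup.mk_surjective v
    exact (Subgroup.commutator_mem_iff.mp (mem_center_of_classes hv hK hxv y)).symm
  have : (x : G ⧸ K) ∈ Subgroup.center (G ⧸ K) := hcomm ▸ Subgroup.mem_top _
  rw [Subgroup.commutator_mem_iff, Subgroup.mem_center_iff.mp this]

theorem Sylow.sup_eq_top_of_index {G : Type*} [Group G] [Finite G] {r n : ℕ} [Fact r.Prime]
    (R : Sylow r G) {D : Subgroup G} (hD : D.index = r ^ n) : (R : Subgroup G) ⊔ D = ⊤ := by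
  rw [← Subgroup.index_eq_one]
  obtain ⟨m, -, hm⟩ := (Nat.dvd_prime_pow (Fact.out : r.Prime)).mp
    (hD ▸ Subgroup.index_dvd_of_le (le_sup_right : D ≤ (R : Subgroup G) ⊔ D))
  rcases Nat.eq_zero_or_pos m with rfl | h
  · simpa using hm
  · exact absurd (((dvd_pow_self r h.ne').trans (dvd_of_eq hm.symm)).trans
      (Subgroup.index_dvd_of_le le_sup_left)) R.not_dvd_index

/-- If every vanishing class has size prime to `r`, then `G` has a normal `r`-complement. -/
theorem exists_normal_complement {G : Type} [Group G] [Finite G] {r : ℕ} [hr : Fact r.Prime]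
    (hv : ∀ x : G, IsVanishing G x → ¬ r ∣ classSize x) :
    ∃ K : Subgroup G, K.Normal ∧ ¬ r ∣ Nat.card K ∧ ∃ n, K.index = r ^ n := by
  obtain ⟨D, ⟨hDn, n, hn⟩, hmin⟩ := exists_minimal_of_wellFoundedLT
    (fun D : Subgroup G => D.Normal ∧ ∃ n, D.index = r ^ n) ⟨⊤, inferInstance, 0, by simp⟩
  refine ⟨D, hDn, fun hdvd => ?_, n, hn⟩
  have := Fintype.ofFinite D
  obtain ⟨k, _, _, ⟨red⟩⟩ := exists_residueField hr.out
  obtain ⟨R⟩ : Nonempty (Sylow r G) := inferInstance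
  have hRD := R.sup_eq_top_of_index hn
  obtain ⟨f, hf1, hfr, hfR⟩ := exists_invariant_monoidHom D (R : Subgroup G) R.2 red hdvd (by
    intro χ hχ hfix
    by_contra h1
    obtain ⟨x, hx⟩ := χ.2.exists_eq_zero h1
    have hinv : ∀ g : G, g • χ = χ := by
      have : (⊤ : Subgroup G) ≤ MulAction.stabilizer G χ := by
        rw [← hRD, sup_le_iff]
        refine ⟨fun g hg => hfix g hg, fun g hg => Subtype.ext (funext fun y => ?_)⟩
        have := χ.2.map_conj (⟨g, hg⟩⁻¹ : D) y
        rw [irr_smul_apply, ← this]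
        congr 1
      exact fun g => this (Subgroup.mem_top g)
    have hvx : IsVanishing G x := isVanishing_of_invariant χ.2 (fun g y => by
      have := congrFun (congrArg Subtype.val (hinv g⁻¹)) y
      rwa [irr_smul_apply, inv_inv] at this) hx
    have h2 := hχ.not_dvd_eq_zero (r := r) hx
    rw [card_isConj_eq_index] at h2
    exact hv x hvx (h2.trans (Subgroup.index_centralizer_dvd D x)))
  let E := f.ker.map D.subtype
  have hfG : ∀ (g : G) x, f (MulAut.conjNormal g x) = f x := by
    let S : Subgroup G :=
      { carrier := {g | ∀ x, f (MulAut.conjNormal g x) = f x}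
        one_mem' := fun x => by simp
        mul_mem' := fun {a b} ha hb x => by rw [map_mul, MulAut.mul_apply, ha, hb]
        inv_mem' := fun {a} ha x => by
          rw [← ha, ← MulAut.mul_apply, ← map_mul, mul_inv_cancel, map_one, MulAut.one_apply] }
    have : (⊤ : Subgroup G) ≤ S := by
      rw [← hRD, sup_le_iff]
      refine ⟨fun g hg => hfR g hg, fun g hg x => ?_⟩
      have : MulAut.conjNormal g x = ⟨g, hg⟩ * x * (⟨g, hg⟩ : D)⁻¹ := Subtype.ext (by simp)
      rw [this, map_mul, map_mul, map_inv, mul_comm (f _), mul_inv_cancel_right]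
    exact fun g => this (Subgroup.mem_top g)
  have hEn : E.Normal := ⟨by
    rintro _ ⟨x, hx, rfl⟩ g
    exact ⟨MulAut.conjNormal g x, (hfG g x).trans hx, by simp⟩⟩
  have hrange : IsPGroup r f.range := by
    rintro ⟨_, x, rfl⟩
    exact ⟨1, Subtype.ext (by simpa using DFunLike.congr_fun hfr x)⟩
  obtain ⟨m, hm⟩ := hrange.exists_card_eq
  have hE : D ≤ E := hmin ⟨hEn, m + n, by
    rw [Subgroup.index_map_subtype, Subgroup.index_ker, hm, hn, pow_add]⟩
    (Subgroup.map_subtype_le _)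
  refine hf1 (MonoidHom.ext fun x => ?_)
  obtain ⟨y, hy, hyx⟩ := hE x.2
  rwa [← Subtype.ext hyx]

/-- The conjugates of a proper subgroup do not cover a finite group. -/
theorem Subgroup.eq_top_of_forall_conj_mem {N : Type*} [Group N] [Finite N] {H : Subgroup N}
    (h : ∀ x, ∃ n : N, n * x * n⁻¹ ∈ H) : H = ⊤ := by
  have := Fintype.ofFinite N
  have := Fintype.ofFinite (N ⧸ H)
  have h1 := MulAction.sum_card_fixedBy_eq_card_orbits_mul_card_group N (N ⧸ H)
  have h2 : Fintype.card (Quotient (MulAction.orbitRel N (N ⧸ H))) = 1 := by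
    rw [Fintype.card_eq_one_iff_nonempty_unique]
    exact (MulAction.pretransitive_iff_unique_quotient_of_nonempty N (N ⧸ H)).mp inferInstance
  rw [h2, one_mul] at h1
  have h3 : ∀ x : N, 1 ≤ Fintype.card (MulAction.fixedBy (N ⧸ H) x) := fun x => by
    obtain ⟨n, hn⟩ := h x
    refine Fintype.card_pos_iff.mpr ⟨⟨(n⁻¹ : N), ?_⟩⟩
    change ((x * n⁻¹ : N) : N ⧸ H) = (n⁻¹ : N)
    rw [eq_comm, QuotientGroup.eq, inv_inv, ← mul_assoc]
    exact hn
  have h4 : Fintype.card (MulAction.fixedBy (N ⧸ H) (1 : N)) = H.index := by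
    rw [Subgroup.index, ← Nat.card_eq_fintype_card, MulAction.fixedBy_one_eq_univ,
      Nat.card_univ]
  by_contra hne
  have h5 : 1 < Fintype.card (MulAction.fixedBy (N ⧸ H) (1 : N)) := by
    have h6 : H.index ≠ 1 := fun h => hne (Subgroup.index_eq_one.mp h)
    have := h3 1
    omega
  have := Finset.sum_lt_sum (fun x _ => h3 x) ⟨1, Finset.mem_univ _, h5⟩
  rw [h1] at this
  simp at this

/-- An element of order prime to `|N|` fixing every conjugacy class of `N` centralizes `N`. -/
theorem commute_of_fixes_classes {G : Type*} [Group G] [Finite G] (N : Subgroup G) [N.Normal]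
    {q : ℕ} [hq : Fact q.Prime] {a : G} (ha : IsPGroup q (Subgroup.zpowers a))
    (hN : ¬ q ∣ Nat.card N)
    (hfix : ∀ x ∈ N, ∃ n ∈ N, a * x * a⁻¹ = n * x * n⁻¹) : ∀ x ∈ N, a * x = x * a := by
  have := Fintype.ofFinite N
  have hconj : ∀ (g : G) {x y : N}, IsConj x y →
      IsConj (MulAut.conjNormal g x) (MulAut.conjNormal g y) := fun g x y h =>
    (MulAut.conjNormal g : MulAut N).toMonoidHom.map_isConj h
  let S : Subgroup G :=
    { carrier := {g | ∀ x : N, IsConj x (MulAut.conjNormal g x)}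
      one_mem' := fun x => by
        rw [map_one, MulAut.one_apply]
      mul_mem' := fun {g h} hg hh x => by
        rw [map_mul, MulAut.mul_apply]
        exact (hh x).trans (hg _)
      inv_mem' := fun {g} hg x => by
        have := hg (MulAut.conjNormal g⁻¹ x)
        rw [← MulAut.mul_apply, ← map_mul, mul_inv_cancel, map_one, MulAut.one_apply] at this
        exact this.symm }
  have hS : Subgroup.zpowers a ≤ S := by
    rw [Subgroup.zpowers_le]
    intro x
    obtain ⟨n, hn, h⟩ := hfix x x.2
    exact isConj_iff.mpr ⟨⟨n, hn⟩, Subtype.ext (by simp [h])⟩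
  have key : ∀ x : N, ∃ y : N, IsConj x y ∧ MulAut.conjNormal a y = y := by
    intro x
    let act : MulAction (Subgroup.zpowers a) {y : N // IsConj x y} :=
      { smul := fun p y => ⟨MulAut.conjNormal (p : G) y.1, y.2.trans (hS p.2 y.1)⟩
        one_smul := fun y => Subtype.ext (by
          change MulAut.conjNormal (1 : G) y.1 = y.1
          simp)
        mul_smul := fun p q y => Subtype.ext (by
          change MulAut.conjNormal (p * q : G) y.1 =
            MulAut.conjNormal (p : G) (MulAut.conjNormal (q : G) y.1)
          rw [map_mul, MulAut.mul_apply]) }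
    obtain ⟨y, hy⟩ := ha.nonempty_fixed_point_of_prime_not_dvd_card {y : N // IsConj x y} (by
      have : Nat.card {y : N // IsConj x y} = (Subgroup.centralizer {x}).index := by
        rw [← card_isConj_eq_index, Nat.card_eq_fintype_card, Fintype.card_subtype]
        congr
      rw [this]
      exact fun h => hN (h.trans (Subgroup.index_dvd_card _)))
    exact ⟨y.1, y.2, congrArg Subtype.val (hy ⟨a, Subgroup.mem_zpowers a⟩)⟩
  have htop : (Subgroup.centralizer {a}).subgroupOf N = ⊤ :=
    Subgroup.eq_top_of_forall_conj_mem fun x => by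
      obtain ⟨y, hxy, hy⟩ := key x
      obtain ⟨n, rfl⟩ := isConj_iff.mp hxy
      refine ⟨n, ?_⟩
      rw [Subgroup.mem_subgroupOf, Subgroup.mem_centralizer_singleton_iff]
      have := congrArg Subtype.val hy
      rw [MulAut.conjNormal_apply, mul_inv_eq_iff_eq_mul] at this
      exact this.symm
  intro x hx
  have : (⟨x, hx⟩ : N) ∈ (Subgroup.centralizer {a}).subgroupOf N := htop ▸ Subgroup.mem_top _
  rw [Subgroup.mem_subgroupOf, Subgroup.mem_centralizer_singleton_iff] at this
  exact this.symm

theorem Subgroup.eq_of_le_of_index_eq_index {G : Type*} [Group G] [Finite G] {H K : Subgroup G}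
    (h : H ≤ K) (hi : H.index = K.index) : H = K :=
  le_antisymm h (Subgroup.relIndex_eq_one.mp (Nat.eq_of_mul_eq_mul_right
    (Nat.pos_of_ne_zero K.index_ne_zero_of_finite)
    (by rw [Subgroup.relIndex_mul_index h, hi, one_mul])))

/-- The structure of a group all of whose vanishing elements have class size `s`, relative to a
prime `r` not dividing `s` that divides `|G : Z(G)|`: the Sylow `r`-subgroup `R` has a normal
complement `K`, and `R` contains a non-central element `a` with an abelian centralizer. -/
structure AbelianCentralizer {G : Type} [Group G] [Finite G] (s r : ℕ) (K : Subgroup G)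
    (R : Sylow r G) (a : G) : Prop where
  normal : K.Normal
  not_dvd : ¬ r ∣ Nat.card K
  index : ∃ n, K.index = r ^ n
  mem : a ∈ R
  pow_mem : a ^ r ∈ Subgroup.center G
  comm : ∀ x ∈ Subgroup.centralizer {a}, ∀ y ∈ Subgroup.centralizer {a}, x * y = y * x
  index_centralizer : (Subgroup.centralizer {a}).index = s
  le : (R : Subgroup G) ≤ Subgroup.centralizer {a}
  normalizer_le : Subgroup.normalizer (R : Set G) ≤ Subgroup.centralizer {a}
  vanishing : ∀ x, IsVanishing G x → (Subgroup.centralizer {x}).index = s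

theorem isPGroup_zpowers_of_mem {G : Type*} [Group G] {r : ℕ} {R : Subgroup G}
    (hR : IsPGroup r R) {a : G} (ha : a ∈ R) :
    IsPGroup r (Subgroup.zpowers a) :=
  hR.to_le ((Subgroup.zpowers_le).mpr ha)

section

variable {G : Type} [Group G] [Finite G]

theorem eq_one_of_mem_of_mem {G : Type*} [Group G] [Finite G] {r : ℕ} [hr : Fact r.Prime]
    {R K : Subgroup G} (hR : IsPGroup r R) (hK : ¬ r ∣ Nat.card K) {x : G} (h1 : x ∈ R) (h2 : x ∈ K) :
    x = 1 := by
  obtain ⟨n, hn⟩ := hR.exists_card_eq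
  have : R ⊓ K = ⊥ := disjoint_iff.mp (Subgroup.disjoint_of_coprime_natCard
    (hn ▸ ((Nat.Prime.coprime_iff_not_dvd hr.out).mpr hK).pow_left n))
  exact Subgroup.mem_bot.mp (this ▸ ⟨h1, h2⟩)

theorem exists_noncentral_pow_mem {r : ℕ} [hr : Fact r.Prime] (R : Sylow r G)
    (hdvd : r ∣ (Subgroup.center G).index) :
    ∃ a ∈ R, a ∉ Subgroup.center G ∧ a ^ r ∈ Subgroup.center G := by
  have h1 : ¬ (R : Subgroup G) ≤ Subgroup.center G := fun h =>
    R.not_dvd_index (hdvd.trans (Subgroup.index_dvd_of_le h))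
  obtain ⟨b, hb, hbZ⟩ := SetLike.not_le_iff_exists.mp h1
  obtain ⟨k, hk⟩ := R.2 ⟨b, hb⟩
  have hex : ∃ k, b ^ r ^ k ∈ Subgroup.center G := ⟨k, by
    have : b ^ r ^ k = 1 := congrArg Subtype.val hk
    rw [this]; exact one_mem _⟩
  have h0 : Nat.find hex ≠ 0 := fun h => hbZ (by
    have := Nat.find_spec hex
    rwa [h, pow_zero, pow_one] at this)
  obtain ⟨m, hm⟩ := Nat.exists_eq_succ_of_ne_zero h0
  refine ⟨b ^ r ^ m, pow_mem hb _, Nat.find_min hex (by omega), ?_⟩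
  have := Nat.find_spec hex
  rwa [hm, pow_succ, pow_mul] at this

theorem centralizer_mul_le {r : ℕ} [hr : Fact r.Prime] {K : Subgroup G} (hK : ¬ r ∣ Nat.card K)
    {a c : G} (ha : IsPGroup r (Subgroup.zpowers a)) (hc : c ∈ K) (hac : a * c = c * a) :
    Subgroup.centralizer {a * c} ≤ Subgroup.centralizer {a} := by
  intro g hg
  rw [Subgroup.mem_centralizer_singleton_iff] at hg ⊢
  have h1 : (a * c) ^ Nat.card K = a ^ Nat.card K := by
    rw [Commute.mul_pow hac]
    have : c ^ Nat.card K = 1 :=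
      congrArg Subtype.val (pow_card_eq_one' (x := (⟨c, hc⟩ : K)))
    rw [this, mul_one]
  have h2 : Commute g (a ^ Nat.card K) := h1 ▸ Commute.pow_right hg _
  obtain ⟨n, hn⟩ := ha.exists_card_eq
  rw [Nat.card_zpowers] at hn
  have hco : (orderOf a).Coprime (Nat.card K) :=
    hn ▸ ((Nat.Prime.coprime_iff_not_dvd hr.out).mpr hK).pow_left n
  obtain ⟨m, hm⟩ := exists_pow_eq_self_of_coprime hco.symm
  exact hm ▸ h2.pow_right m

theorem exists_abelianCentralizer {s r : ℕ} [hr : Fact r.Prime] (hrs : ¬ r ∣ s)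
    (hv : ∀ x : G, IsVanishing G x → (Subgroup.centralizer {x}).index = s)
    (hdvd : r ∣ (Subgroup.center G).index) :
    ∃ (K : Subgroup G) (R : Sylow r G) (a : G), AbelianCentralizer s r K R a := by
  have hv' : ∀ x : G, IsVanishing G x → ¬ r ∣ classSize x := fun x hx h => hrs (hv x hx ▸ h)
  obtain ⟨K, hKn, hKr, n, hn⟩ := exists_normal_complement hv'
  obtain ⟨R⟩ : Nonempty (Sylow r G) := inferInstance
  have hcomm : ∀ x y : G, x * y * x⁻¹ * y⁻¹ ∈ K :=
    commutator_mem_of_isPGroup_quotient hv' (IsPGroup.of_card (n := n) hn)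
  have hRK := R.sup_eq_top_of_index hn
  have hRab : ∀ x ∈ R, ∀ y ∈ R, x * y = y * x := fun x hx y hy => by
    have := eq_one_of_mem_of_mem R.2 hKr
      (mul_mem (mul_mem (mul_mem hx hy) (inv_mem hx)) (inv_mem hy)) (hcomm x y)
    rwa [mul_inv_eq_one, mul_inv_eq_iff_eq_mul] at this
  obtain ⟨a, haR, haZ, harZ⟩ := exists_noncentral_pow_mem R hdvd
  have hap := isPGroup_zpowers_of_mem R.2 haR
  have hvan : ∀ c ∈ K, a * c = c * a → IsVanishing G (a * c) := by
    intro c hc hac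
    by_contra hnv
    have h1 := exists_conj_of_not_isVanishing K hnv (fun h x hx =>
      ⟨h * (a * c) * h⁻¹ * (a * c)⁻¹, hcomm _ _, by group⟩)
    have h2 := commute_of_fixes_classes K hap hKr (fun x hx => by
      obtain ⟨m, hm, he⟩ := h1 (c⁻¹ * x * c) (by
        simpa using hKn.conj_mem x hx c⁻¹)
      refine ⟨m * c⁻¹, mul_mem hm (inv_mem hc), ?_⟩
      calc a * x * a⁻¹ = a * c * (c⁻¹ * x * c) * (a * c)⁻¹ := by group
        _ = _ := by rw [he]; group)
    refine haZ (Subgroup.mem_center_iff.mpr fun g => ?_)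
    have : (⊤ : Subgroup G) ≤ Subgroup.centralizer {a} := by
      rw [← hRK, sup_le_iff]
      exact ⟨fun x hx => Subgroup.mem_centralizer_singleton_iff.mpr (hRab x hx a haR),
        fun x hx => Subgroup.mem_centralizer_singleton_iff.mpr (h2 x hx).symm⟩
    exact Subgroup.mem_centralizer_singleton_iff.mp (this (Subgroup.mem_top g))
  have hidx : (Subgroup.centralizer {a}).index = s := by
    have := hv _ (hvan 1 K.one_mem (by simp))
    rwa [mul_one] at this
  have hcen : ∀ c ∈ K, a * c = c * a → ∀ g ∈ Subgroup.centralizer {a}, g * c = c * g := by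
    intro c hc hac g hg
    have h1 : Subgroup.centralizer {a * c} = Subgroup.centralizer {a} :=
      Subgroup.eq_of_le_of_index_eq_index (centralizer_mul_le hKr hap hc hac)
        ((hv _ (hvan c hc hac)).trans hidx.symm)
    have h2 : g * (a * c) = a * c * g := by
      rw [← h1] at hg
      exact Subgroup.mem_centralizer_singleton_iff.mp hg
    have h3 := Subgroup.mem_centralizer_singleton_iff.mp hg
    rw [← mul_assoc, h3, mul_assoc, mul_assoc] at h2
    exact mul_left_cancel h2
  have hle : (R : Subgroup G) ≤ Subgroup.centralizer {a} := fun x hx =>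
    Subgroup.mem_centralizer_singleton_iff.mpr (hRab x hx a haR)
  have hdec : ∀ x ∈ Subgroup.centralizer {a}, ∃ p ∈ R, ∃ c ∈ K, a * c = c * a ∧ p * c = x := by
    intro x hx
    obtain ⟨p, hp, c, hc, rfl⟩ := Subgroup.mem_sup_of_normal_right.mp
      (hRK ▸ Subgroup.mem_top x : x ∈ (R : Subgroup G) ⊔ K)
    refine ⟨p, hp, c, hc, ?_, rfl⟩
    have := Subgroup.mem_centralizer_singleton_iff.mp
      ((Subgroup.mul_mem_cancel_left _ (hle hp)).mp hx)
    exact this.symm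
  refine ⟨K, R, a, hKn, hKr, ⟨n, hn⟩, haR, harZ, ?_, hidx, hle, ?_, hv⟩
  · intro x hx y hy
    obtain ⟨p, hp, c, hc, hac, rfl⟩ := hdec x hx
    obtain ⟨q, hq, d, hd, had, rfl⟩ := hdec y hy
    have e1 : Commute (p * c) d := hcen d hd had _ hx
    have e2 : Commute q c := hcen c hc hac q (hle hq)
    have e3 : Commute p q := hRab p hp q hq
    have e4 : Commute (p * c) q := Commute.mul_left e3 e2.symm
    exact Commute.mul_right e4 e1
  · intro g hg
    rw [Subgroup.mem_centralizer_singleton_iff]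
    have h1 : g * a * g⁻¹ * a⁻¹ ∈ (R : Subgroup G) :=
      mul_mem ((Subgroup.mem_normalizer_iff.mp hg a).mp haR) (inv_mem haR)
    have := eq_one_of_mem_of_mem R.2 hKr h1 (hcomm g a)
    rwa [mul_inv_eq_one, mul_inv_eq_iff_eq_mul] at this

namespace AbelianCentralizer

variable {s r : ℕ} [hr : Fact r.Prime] {K : Subgroup G} {R : Sylow r G} {a : G}

theorem conj_eq_self (hA : AbelianCentralizer s r K R a) {x g : G}
    (hx : x ∈ Subgroup.centralizer {a}) (hg : g⁻¹ * x * g ∈ Subgroup.centralizer {a}) :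
    g⁻¹ * x * g = x := by
  have hle : Subgroup.centralizer {a} ≤ Subgroup.centralizer (R : Set G) := fun y hy p hp =>
    hA.comm p (hA.le hp) y hy
  obtain ⟨n, hn, h⟩ := R.conj_eq_normalizer_conj_of_mem_centralizer x g (hle hx) (hle hg)
  rw [h, mul_assoc, hA.comm x hx n (hA.normalizer_le hn), inv_mul_cancel_left]

theorem exists_conj_mem_centralizer (hA : AbelianCentralizer s r K R a) (hrs : ¬ r ∣ s) {x : G}
    (hx : IsVanishing G x) :
    ∃ g : G, g * x * g⁻¹ ∈ Subgroup.centralizer {a} := by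
  obtain ⟨g, hg⟩ := IsPGroup.exists_conj_mem R.2 (Subgroup.centralizer {x})
    (by rw [hA.vanishing x hx]; exact hrs)
  have := Subgroup.mem_centralizer_singleton_iff.mp (hg a hA.mem)
  refine ⟨g⁻¹, Subgroup.mem_centralizer_singleton_iff.mpr ?_⟩
  calc g⁻¹ * x * g⁻¹⁻¹ * a = g⁻¹ * (x * (g * a * g⁻¹)) * g := by group
    _ = a * (g⁻¹ * x * g⁻¹⁻¹) := by rw [← this]; group

theorem exists_normal_hall (hA : AbelianCentralizer s r K R a) :
    ∃ H : Subgroup G, H.Normal ∧ IsHallSubgroup (primesOf s) H ∧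
      ∀ x y : G, x * y * x⁻¹ * y⁻¹ ∈ H := by
  obtain ⟨H, ⟨hHn, hHi, hHc⟩, hmin⟩ := exists_minimal_of_wellFoundedLT
    (fun D : Subgroup G => D.Normal ∧ (D.index.Coprime s) ∧
      ∀ x y : G, x * y * x⁻¹ * y⁻¹ ∈ D) ⟨⊤, inferInstance, by simp, fun _ _ => Subgroup.mem_top _⟩
  refine ⟨H, hHn, ⟨fun p hp hpH => ⟨hp, ?_⟩, fun p hp hpH h => ?_⟩, hHc⟩
  · by_contra hps
    have := Fact.mk hp
    obtain ⟨T0⟩ : Nonempty (Sylow p G) := inferInstance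
    obtain ⟨g, hg⟩ := IsPGroup.exists_conj_mem T0.2 (Subgroup.centralizer {a})
      (by rw [hA.index_centralizer]; exact hps)
    let T := g • T0
    have hT : ∀ x ∈ T, x ∈ Subgroup.centralizer {a} := by
      intro x hx
      obtain ⟨y, hy, rfl⟩ := hx
      exact hg y hy
    have hN : Subgroup.normalizer (T : Set G) ≤ Subgroup.centralizer (T : Set G) := by
      intro n hn x hx
      have := hA.conj_eq_self (g := n) (hT x hx)
        (hT _ ((Subgroup.mem_normalizer_iff''.mp hn x).mp hx))
      rwa [mul_assoc, inv_mul_eq_iff_eq_mul] at this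
    let D := (MonoidHom.transferSylow T hN).ker
    have hD1 : ¬ p ∣ Nat.card D := MonoidHom.not_dvd_card_ker_transferSylow T hN
    have hD2 : D.index = Nat.card T :=
      (MonoidHom.ker_transferSylow_isComplement' T hN).symm.index_eq_card
    have hTc : ∀ x y : T, x * y = y * x := fun x y =>
      Subtype.ext (hA.comm x (hT x x.2) y (hT y y.2))
    have hDc : ∀ x y : G, x * y * x⁻¹ * y⁻¹ ∈ D := fun x y => by
      rw [MonoidHom.mem_ker, map_mul, map_mul, map_mul, map_inv, map_inv,
        hTc (MonoidHom.transferSylow T hN x), mul_inv_cancel_right, mul_inv_cancel]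
    have hle : H ≤ H ⊓ D := hmin ⟨inferInstance, by
      rw [← Subgroup.relIndex_mul_index (inf_le_right : H ⊓ D ≤ D), Subgroup.inf_relIndex_right]
      refine Nat.Coprime.mul_left
        (hHi.coprime_dvd_left (Subgroup.relIndex_dvd_index_of_normal H D)) ?_
      rw [hD2, T.card_eq_multiplicity]
      exact ((Nat.Prime.coprime_iff_not_dvd hp).mpr hps).pow_left _,
      fun x y => ⟨hHc x y, hDc x y⟩⟩ inf_le_left
    exact hD1 (hpH.trans (Subgroup.card_dvd_of_le (hle.trans inf_le_right)))
  · exact Nat.not_coprime_of_dvd_of_dvd hp.one_lt hpH h.2 hHi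

end AbelianCentralizer

end

/-- If `θ` vanishes at `c`, then the class sum of `c` acts as zero. -/
theorem IsIrrChar.sum_conj_mul_eq_zero {N : Type*} [Group N] [Fintype N] {θ : N → ℂ}
    (h : IsIrrChar θ) {c : N} (hc : θ c = 0) (y : N) :
    ∑ x, (if IsConj c x then θ (x * y) else 0) = 0 := by
  have hconj : ∀ a y : N, IsConj c (a * y * a⁻¹) ↔ IsConj c y := fun a y =>
    ⟨fun h => h.trans (isConj_iff.mpr ⟨a⁻¹, by group⟩), fun h => h.trans (isConj_iff.mpr ⟨a, rfl⟩)⟩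
  let z := centralOf (fun x : N => (if IsConj c x then 1 else 0 : AlgInt)) fun a y => by
    simp only [hconj]
  obtain ⟨w, hw⟩ := h.charLin_mul_of_central z.2
  set Z := MonoidAlgebra.mapRingHom N (algebraMap AlgInt ℂ) z.1
  have hZ : ∀ x, Z.coeff x = if IsConj c x then 1 else 0 := fun x => by
    change algebraMap AlgInt ℂ (if IsConj c x then 1 else 0) = _
    split_ifs <;> simp
  have h0 : (w : ℂ) = 0 := by
    have h1 := hw 1
    rw [mul_one, charLin_eq_sum, charLin_one] at h1
    refine (mul_eq_zero.mp (h1.symm.trans (Finset.sum_eq_zero fun x _ => ?_))).resolve_right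
      h.map_one_ne_zero
    rw [hZ]
    split_ifs with hx
    · obtain ⟨a, rfl⟩ := isConj_iff.mp hx
      rw [h.map_conj, hc, mul_zero]
    · simp
  have h1 := hw (MonoidAlgebra.single y 1)
  rw [h0, zero_mul, charLin_eq_sum, ← Equiv.sum_comp (Equiv.mulRight y)] at h1
  refine Eq.trans (Finset.sum_congr rfl fun x _ => ?_) h1
  rw [Equiv.coe_mulRight, MonoidAlgebra.coeff_mul_single_apply, mul_inv_cancel_right, hZ]
  split_ifs <;> simp

namespace AbelianCentralizer

variable {G : Type} [Group G] [Finite G] {s r : ℕ} [hr : Fact r.Prime] {K : Subgroup G}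
  {R : Sylow r G} {a : G}

theorem map_one_of_invariant (hA : AbelianCentralizer s r K R a) (hrs : ¬ r ∣ s) [K.Normal]
    {χ : Irr K} (hχ : ∀ g ∈ R, g • χ = χ) : χ.1 1 = 1 := by
  have := Fintype.ofFinite K
  by_contra h1
  obtain ⟨x, hx⟩ := χ.2.exists_eq_zero h1
  obtain ⟨n, hn⟩ := hA.index
  have hinv : ∀ g : G, g • χ = χ := by
    have : (⊤ : Subgroup G) ≤ MulAction.stabilizer G χ := by
      rw [← R.sup_eq_top_of_index hn, sup_le_iff]
      refine ⟨fun g hg => hχ g hg, fun g hg => Subtype.ext (funext fun y => ?_)⟩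
      have := χ.2.map_conj (⟨g, hg⟩⁻¹ : K) y
      rw [irr_smul_apply, ← this]
      congr 1
    exact fun g => this (Subgroup.mem_top g)
  have hinv' : ∀ (g : G) (y : K), χ.1 (MulAut.conjNormal g y) = χ.1 y := fun g y => by
    have := congrFun (congrArg Subtype.val (hinv g⁻¹)) y
    rwa [irr_smul_apply, inv_inv] at this
  obtain ⟨g, hg⟩ := hA.exists_conj_mem_centralizer hrs (isVanishing_of_invariant χ.2 hinv' hx)
  set c : K := MulAut.conjNormal g x with hcdef
  have hc : χ.1 c = 0 := (hinv' g x).trans hx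
  have hcM : (c : G) ∈ Subgroup.centralizer {a} := by simpa [hcdef] using hg
  have hRc : ∀ p ∈ R, p * (c : G) * p⁻¹ = c := fun p hp => by
    rw [hA.comm p (hA.le hp) c hcM, mul_inv_cancel_right]
  let act : MulAction R K :=
    { smul := fun p y => MulAut.conjNormal (p : G) y
      one_smul := fun y => by
        change MulAut.conjNormal (1 : G) y = y
        rw [map_one, MulAut.one_apply]
      mul_smul := fun p q y => by
        change MulAut.conjNormal (p * q : G) y =
          MulAut.conjNormal (p : G) (MulAut.conjNormal (q : G) y)
        rw [map_mul, MulAut.mul_apply] }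
  have hact : ∀ (p : R) (y : K), p • y = MulAut.conjNormal (p : G) y := fun _ _ => rfl
  have hactc : ∀ p : R, p • c = c := fun p => Subtype.ext (by
    rw [hact, MulAut.conjNormal_apply]; exact hRc p p.2)
  have hmul : ∀ (p : R) (x y : K), p • (x * y) = p • x * p • y := fun p x y => map_mul _ _ _
  have hcon : ∀ (p : R) (y : K), IsConj c (p • y) ↔ IsConj c y := by
    have : ∀ (p : R) (y : K), IsConj c y → IsConj c (p • y) := fun p y h => by
      have := (MulAut.conjNormal (p : G) : MulAut K).toMonoidHom.map_isConj h
      rwa [show (MulAut.conjNormal (p : G) : MulAut K).toMonoidHom c = c from hactc p] at this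
    exact fun p y => ⟨fun h => by simpa using this p⁻¹ _ h, this p y⟩
  obtain ⟨k, _, _, ⟨red⟩⟩ := exists_residueField hr.out
  let f : K → AlgInt := fun y => if IsConj c y then ⟨χ.1 (y * c⁻¹), χ.2.isIntegral _⟩ else 0
  have hsum : ∑ y, f y = 0 := by
    refine Subtype.ext ?_
    have := χ.2.sum_conj_mul_eq_zero hc c⁻¹
    push_cast
    rw [← this]
    refine Finset.sum_congr rfl fun y _ => ?_
    simp only [f]
    split_ifs <;> rfl
  have h2 := IsPGroup.sum_eq_sum_fixedPoints (k := k) R.2 (fun y => red (f y)) (fun p y => by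
    simp only [f, hcon]
    congr 1
    split_ifs
    · refine Subtype.ext ?_
      change χ.1 (p • y * c⁻¹) = χ.1 (y * c⁻¹)
      have h3 : p • c⁻¹ = c⁻¹ := by
        rw [hact, map_inv]; exact congrArg _ (hactc p)
      rw [← hinv' p (y * c⁻¹), ← hact, hmul, h3]
    · rfl)
  rw [← map_sum, hsum, map_zero, Finset.sum_eq_single c] at h2
  · simp only [f, IsConj.refl, if_true] at h2
    refine χ.degree_ne_zero red hA.not_dvd ?_
    rw [h2, ← map_natCast red]
    congr 1
    refine Subtype.ext ?_
    change _ = χ.1 (c * c⁻¹)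
    rw [mul_inv_cancel, Irr.map_one]
    simp
  · intro y hy hyc
    simp only [f]
    rw [if_neg, map_zero]
    intro hcy
    obtain ⟨m, hm⟩ := isConj_iff.mp hcy
    have hya : (y : G) ∈ Subgroup.centralizer {a} := by
      have := (Finset.mem_filter.mp hy).2 ⟨a, hA.mem⟩
      have := congrArg Subtype.val this
      rw [hact, MulAut.conjNormal_apply, mul_inv_eq_iff_eq_mul] at this
      exact Subgroup.mem_centralizer_singleton_iff.mpr this.symm
    have e : (m⁻¹ : G)⁻¹ * c * (m⁻¹ : G) = y := by simpa using congrArg Subtype.val hm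
    refine hyc (Subtype.ext ?_)
    rw [← e]
    exact hA.conj_eq_self hcM (e ▸ hya)
  · intro h
    exact absurd (Finset.mem_filter.mpr ⟨Finset.mem_univ _, fun p => hactc p⟩) h

/-- The element `a` acts without non-trivial fixed points on the derived subgroup of `K`. -/
theorem eq_one_of_mem_commutator (hA : AbelianCentralizer s r K R a) (hrs : ¬ r ∣ s) {c : G}
    (hcK : c ∈ ⁅K, K⁆) (hc : a * c = c * a) : c = 1 := by
  have := hA.normal
  obtain ⟨k, _, _, ⟨red⟩⟩ := exists_residueField hr.out
  by_contra hc1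
  rw [← Subgroup.map_subtype_commutator] at hcK
  obtain ⟨c, hcK, rfl⟩ := hcK
  have hcM : (c : G) ∈ Subgroup.centralizer {a} :=
    Subgroup.mem_centralizer_singleton_iff.mpr hc.symm
  have hdeg : ∀ (g : R) (χ : Irr K), (g • χ).degree = χ.degree := fun g χ => by
    have h : ((g : G) • χ).1 1 = χ.1 1 := by rw [irr_smul_apply, map_one]
    rw [Irr.map_one, Irr.map_one] at h
    exact_mod_cast h
  have hval : ∀ (g : R) (χ : Irr K), (g • χ).1 c = χ.1 c := fun g χ => by
    have h : ((g : G) • χ).1 c = χ.1 c := by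
      rw [irr_smul_apply]
      refine congrArg χ.1 (Subtype.ext ?_)
      rw [MulAut.conjNormal_apply]
      rw [← hA.comm c hcM _ (inv_mem (hA.le g.2)), mul_inv_cancel_right]
    exact h
  have key : ∀ y : K, (∀ (g : R) (χ : Irr K), (g • χ).1 y = χ.1 y) → y ∈ commutator K →
      red (∑ χ : Irr K, (χ.degree : AlgInt) * ⟨χ.1 y, χ.2.isIntegral _⟩) =
      ∑ χ : Irr K with χ ∈ MulAction.fixedPoints R (Irr K), 1 := by
    intro y hy hyc
    rw [map_sum, IsPGroup.sum_eq_sum_fixedPoints R.2 _ fun g χ => by simp only [hdeg, hy]]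
    refine Finset.sum_congr rfl fun χ hχ => ?_
    have h1 := hA.map_one_of_invariant hrs (χ := χ)
      fun g hg => (Finset.mem_filter.mp hχ).2 ⟨g, hg⟩
    obtain ⟨f, hf⟩ := χ.2.exists_monoidHom h1
    have h2 : χ.1 y = 1 := by
      rw [hf, show f y = 1 from Abelianization.commutator_subset_ker f hyc, Units.val_one]
    rw [Irr.map_one] at h1
    have h3 : χ.degree = 1 := by exact_mod_cast h1
    rw [h3, Nat.cast_one, one_mul, ← map_one red]
    congr 1
    exact Subtype.ext h2
  have h1 := key c hval hcK
  rw [← key 1 (fun g χ => by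
    rw [Irr.map_one, Irr.map_one, hdeg]) (one_mem _)] at h1
  have hs : ∀ y : K, ((∑ χ : Irr K, (χ.degree : AlgInt) * ⟨χ.1 y, χ.2.isIntegral _⟩ : AlgInt) : ℂ)
      = Nat.card K * if y = 1 then 1 else 0 := fun y => by
    have := sum_irr_mul_charLin (MonoidAlgebra.single y (1 : ℂ))
    rw [MonoidAlgebra.coeff_single, Finsupp.single_apply] at this
    rw [← this]
    push_cast
    exact Finset.sum_congr rfl fun χ _ => by rw [charLin_single, one_mul, Irr.map_one]
  have e1 : (∑ χ : Irr K, (χ.degree : AlgInt) * ⟨χ.1 c, χ.2.isIntegral _⟩ : AlgInt) = 0 :=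
    Subtype.ext (by
      rw [hs, if_neg fun h => hc1 (by rw [h]; rfl), mul_zero]; rfl)
  have e2 : (∑ χ : Irr K, (χ.degree : AlgInt) * ⟨χ.1 1, χ.2.isIntegral _⟩ : AlgInt) = Nat.card K :=
    Subtype.ext (by rw [hs, if_pos rfl, mul_one]; simp)
  rw [e1, e2, map_zero, map_natCast, eq_comm, CharP.cast_eq_zero_iff k r] at h1
  exact hA.not_dvd h1

end AbelianCentralizer

section

open MonoidHom (FixedPointFree)

theorem Function.End.pow_eq_iterate {X : Type*} (f : Function.End X) (n : ℕ) :
    f ^ n = (f : X → X)^[n] := by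
  induction n with
  | zero => rfl
  | succ n ih => rw [pow_succ, ih]; rfl

theorem exists_fixed_of_iterate {X : Type*} [Finite X] {r : ℕ} [Fact r.Prime] {f : X → X}
    (hf : f^[r] = id) (hX : ¬ r ∣ Nat.card X) : ∃ x, f x = x := by
  have := Fintype.ofFinite X
  by_contra! hno
  have h := Equiv.Perm.card_fixedPoints_modEq (α := X) (f := f) (p := r) (n := 1)
    (by rw [pow_one]; exact (Function.End.pow_eq_iterate f r).trans hf)
  have : IsEmpty (Function.fixedPoints f) := ⟨fun x => hno x.1 x.2⟩
  rw [Fintype.card_eq_zero (α := Function.fixedPoints f)] at h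
  exact hX (Nat.card_eq_fintype_card (α := X) ▸ (Nat.modEq_zero_iff_dvd.mp h))

namespace MonoidHom.FixedPointFree

variable {L : Type*} [Group L] [Finite L]

theorem not_dvd_card {r : ℕ} [hr : Fact r.Prime] {α : L →* L} (hα : FixedPointFree α)
    (hit : α^[r] = _root_.id) : ¬ r ∣ Nat.card L := by
  have := Fintype.ofFinite L
  have h := Equiv.Perm.card_fixedPoints_modEq (α := L) (f := ⇑α) (p := r) (n := 1)
    (by rw [pow_one]; exact (Function.End.pow_eq_iterate (X := L) ⇑α r).trans hit)
  have h1 : Fintype.card (Function.fixedPoints α) = 1 :=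
    Fintype.card_eq_one_iff.mpr ⟨⟨1, map_one α⟩, fun x => Subtype.ext (hα x.1 x.2)⟩
  intro hd
  have h2 : 0 ≡ 1 [MOD r] :=
    (Nat.modEq_zero_iff_dvd.mpr (Nat.card_eq_fintype_card (α := L) ▸ hd)).symm.trans
      (h.trans (by rw [h1]))
  exact hr.out.one_lt.ne' (Nat.dvd_one.mp (Nat.modEq_zero_iff_dvd.mp h2.symm))

theorem quotient {α : L →* L} (hα : FixedPointFree α) {N : Subgroup L} [N.Normal]
    (hN : N ≤ N.comap α) : FixedPointFree (QuotientGroup.map N N α hN) := by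
  intro x hx
  obtain ⟨x, rfl⟩ := QuotientGroup.mk_surjective x
  rw [QuotientGroup.map_mk, eq_comm, QuotientGroup.eq] at hx
  let β : N →* N := (α.comp N.subtype).codRestrict N fun y => hN y.2
  have hβ : FixedPointFree β := fun y hy => Subtype.ext (hα y (congrArg Subtype.val hy))
  obtain ⟨m, hm⟩ := hβ.commutatorMap_surjective ⟨_, hx⟩
  have hm : (m : L) / α m = x⁻¹ * α x := congrArg Subtype.val hm
  have : x * (m : L) = 1 := hα _ (by
    rw [map_mul]
    rw [div_eq_mul_inv, mul_inv_eq_iff_eq_mul, mul_assoc, eq_inv_mul_iff_mul_eq] at hm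
    exact hm.symm)
  rw [QuotientGroup.eq_one_iff, mul_eq_one_iff_eq_inv.mp this]
  exact inv_mem m.2

end MonoidHom.FixedPointFree

theorem iterate_eq_self_of_iterate_eq_self {X : Type*} {f : X → X} {r : ℕ} [hr : Fact r.Prime]
    (hf : f^[r] = id) {i : ℕ} (h0 : 0 < i) (hi : i < r) {x : X} (hx : f^[i] x = x) : f x = x := by
  have h1 : Function.IsPeriodicPt f r x := congrFun hf x
  have h2 := h1.gcd (show Function.IsPeriodicPt f i x from hx)
  rwa [(Nat.coprime_of_lt_prime h0.ne' hi hr.out).gcd_eq_one] at h2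

/-- A group acting compatibly with fixed-point-free automorphisms of prime order, on an abelian
group of coprime order, acts trivially. -/
theorem smul_eq_self_of_fixedPointFree {W Q : Type*} [CommGroup W] [Group Q]
    [Finite Q] {r : ℕ} [hr : Fact r.Prime] {α : W →* W} {β : Q →* Q} (ρ : Q →* MulAut W)
    [Finite W] (hαr : α^[r] = id) (hβr : β^[r] = id) (hα : FixedPointFree α)
    (hβ : FixedPointFree β)
    (hρ : ∀ x w, α (ρ x w) = ρ (β x) (α w)) (hco : (Nat.card W).Coprime (Nat.card Q)) (x : Q)
    (v : W) : ρ x v = v := by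
  have := Fintype.ofFinite Q
  let T : W → W := fun w => ∏ y, ρ y w
  have hTmul : ∀ s : Finset ℕ, ∀ f : ℕ → W, T (∏ i ∈ s, f i) = ∏ i ∈ s, T (f i) := fun s f => by
    simp only [T, map_prod]
    exact Finset.prod_comm
  have hTinv : ∀ w, T w⁻¹ = (T w)⁻¹ := fun w => by simp [T]
  have hTfix : ∀ x w, ρ x (T w) = T w := fun x w => by
    simp only [T, map_prod, ← MulAut.mul_apply, ← map_mul]
    exact Equiv.prod_comp (Equiv.mulLeft x) fun y => ρ y w
  have htr : ∀ w, ∏ i ∈ Finset.range r, α^[i] w = 1 := fun w =>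
    Eq.trans rfl (hα.prod_pow_eq_one hαr w)
  have hit : ∀ i x w, α^[i] (ρ x w) = ρ (β^[i] x) (α^[i] w) := fun i => by
    induction i with
    | zero => exact fun _ _ => rfl
    | succ i ih =>
      intro x w
      simp only [Function.iterate_succ_apply', ih, hρ]
  have hsplit : ∀ f : ℕ → W, ∏ i ∈ Finset.range r, f i =
      f 0 * ∏ i ∈ Finset.range (r - 1), f (i + 1) := fun f => by
    obtain ⟨n, hn⟩ := Nat.exists_eq_succ_of_ne_zero hr.out.ne_zero
    rw [hn, Nat.succ_eq_add_one, Finset.prod_range_succ', mul_comm, Nat.add_sub_cancel]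
  have h1 : ∏ i ∈ Finset.range r, ∏ y, ρ y (α^[i] (ρ y⁻¹ v)) = 1 := by
    rw [Finset.prod_comm]
    refine Finset.prod_eq_one fun y _ => ?_
    rw [← map_prod, htr, map_one]
  have h2 : ∀ i ∈ Finset.range (r - 1), ∏ y, ρ y (α^[i + 1] (ρ y⁻¹ v)) = T (α^[i + 1] v) := by
    intro i hi
    have hb : FixedPointFree (β^[i + 1]) := fun y hy =>
      hβ y (iterate_eq_self_of_iterate_eq_self hβr i.succ_pos
        (by have := Finset.mem_range.mp hi; omega) hy)
    let b : Monoid.End Q := β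
    have hbe : ⇑(b ^ (i + 1)) = β^[i + 1] := Monoid.End.coe_pow Q b (i + 1)
    replace hb : FixedPointFree (b ^ (i + 1)) := by rwa [hbe]
    have hb' : Function.Bijective (MonoidHom.commutatorMap (b ^ (i + 1))) :=
      ⟨hb.commutatorMap_injective, hb.commutatorMap_surjective⟩
    change _ = ∏ y, ρ y (α^[i + 1] v)
    rw [← Equiv.prod_comp (Equiv.ofBijective _ hb') fun y => ρ y (α^[i + 1] v)]
    refine Finset.prod_congr rfl fun y _ => ?_
    rw [hit, ← MulAut.mul_apply, ← map_mul, iterate_map_inv, ← div_eq_mul_inv,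
      Equiv.ofBijective_apply, MonoidHom.commutatorMap_apply, hbe]
  rw [hsplit] at h1
  have h3 : ∏ y, ρ y (α^[0] (ρ y⁻¹ v)) = v ^ Nat.card Q := by
    rw [Finset.prod_congr rfl fun y _ => (?_ : _ = v), Finset.prod_const, Finset.card_univ,
      Nat.card_eq_fintype_card]
    rw [Function.iterate_zero_apply, ← MulAut.mul_apply, ← map_mul, mul_inv_cancel, map_one,
      MulAut.one_apply]
  rw [h3, Finset.prod_congr rfl h2, ← hTmul] at h1
  have h4 := htr v
  rw [hsplit] at h4
  have h5 : ∏ i ∈ Finset.range (r - 1), α^[i + 1] v = v⁻¹ := (inv_eq_of_mul_eq_one_right h4).symm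
  rw [h5, hTinv, mul_inv_eq_one] at h1
  have h6 := hTfix x v
  rw [← h1, map_pow] at h6
  exact (powCoprime hco).injective h6

theorem injective_of_iterate_eq_id {X : Type*} {f : X → X} {r : ℕ} [hr : Fact r.Prime]
    (hf : f^[r] = id) : Function.Injective f := by
  intro x y h
  rw [← id_def x, ← id_def y, ← hf, ← Nat.sub_add_cancel hr.out.one_le, Function.iterate_succ_apply,
    h, ← Function.iterate_succ_apply]

theorem surjective_of_iterate_eq_id {X : Type*} {f : X → X} {r : ℕ} [hr : Fact r.Prime]
    (hf : f^[r] = id) : Function.Surjective f := fun x =>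
  ⟨f^[r - 1] x, by
    rw [← Function.iterate_succ_apply' f, Nat.succ_eq_add_one, Nat.sub_add_cancel hr.out.one_le, hf,
      id]⟩

theorem smul_eq_self_of_fixed {W Q : Type*} [CommGroup W] [Group Q]
    [Finite Q] {r : ℕ} [hr : Fact r.Prime] {α : W →* W} {β : Q →* Q} (ρ : Q →* MulAut W)
    [Finite W] (hαr : α^[r] = id) (hβr : β^[r] = id) (hα : FixedPointFree α)
    (hβ : ∀ x, β x = x → ρ x = 1) (hrQ : ¬ r ∣ Nat.card Q)
    (hρ : ∀ x w, α (ρ x w) = ρ (β x) (α w)) (hco : (Nat.card W).Coprime (Nat.card Q)) (x : Q)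
    (v : W) : ρ x v = v := by
  have hker : ρ.ker ≤ ρ.ker.comap β := fun x hx => by
    rw [MonoidHom.mem_ker] at hx
    change ρ (β x) = 1
    ext w
    obtain ⟨w, rfl⟩ := surjective_of_iterate_eq_id hαr w
    rw [← hρ, hx]
    rfl
  let γ : Q ⧸ ρ.ker →* Q ⧸ ρ.ker := QuotientGroup.map _ _ β hker
  have hsemi : Function.Semiconj (QuotientGroup.mk (s := ρ.ker)) β γ := fun x => rfl
  refine smul_eq_self_of_fixedPointFree (β := γ) (QuotientGroup.kerLift ρ) hαr ?_ hα ?_ ?_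
    (hco.coprime_dvd_right (Subgroup.card_quotient_dvd_card _)) (x : Q ⧸ ρ.ker) v
  · funext y
    obtain ⟨y, rfl⟩ := QuotientGroup.mk_surjective y
    rw [← (hsemi.iterate_right r) y, hβr, id, id]
  · intro y hy
    obtain ⟨y, rfl⟩ := QuotientGroup.mk_surjective y
    replace hy : ((β y : Q) : Q ⧸ ρ.ker) = y := hy
    rw [eq_comm, QuotientGroup.eq] at hy
    let f : ρ.ker → ρ.ker := fun z => ⟨y⁻¹ * β (y * z), by
      rw [map_mul, ← mul_assoc]
      exact mul_mem hy (hker z.2)⟩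
    have hf : Function.Semiconj (fun z : ρ.ker => y * (z : Q)) f β := fun z =>
      mul_inv_cancel_left y _
    obtain ⟨z, hz⟩ := exists_fixed_of_iterate (f := f) (r := r) (by
      funext z
      have := (hf.iterate_right r) z
      rw [hβr] at this
      exact Subtype.ext (mul_left_cancel this))
      fun h => hrQ (h.trans (Subgroup.card_subgroup_dvd_card _))
    have h1 := hf z
    simp only [hz] at h1
    have h2 := hβ _ h1.symm
    rw [map_mul, z.2, mul_one] at h2
    exact (QuotientGroup.eq_one_iff y).mpr h2
  · intro y w
    obtain ⟨y, rfl⟩ := QuotientGroup.mk_surjective y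
    exact hρ y w

theorem MonoidHom.coe_codRestrict_iterate {H : Type*} [Group H] {α : H →* H} {P : Subgroup H}
    (hP : ∀ x ∈ P, α x ∈ P) (n : ℕ) (x : P) :
    (((α.comp P.subtype).codRestrict P fun y => hP y y.2)^[n] x : P) = α^[n] (x : H) := by
  have h : Function.Semiconj (Subtype.val : P → H)
    ((α.comp P.subtype).codRestrict P fun y => hP y y.2) α := fun x => rfl
  exact h.iterate_right n x

theorem commute_of_fixed_commute {H : Type*} [Group H] [Finite H] {r : ℕ} [hr : Fact r.Prime]
    {α : H →* H} (hαr : α^[r] = id) {Q : Subgroup H} (hQ : ∀ x ∈ Q, α x ∈ Q)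
    (hrQ : ¬ r ∣ Nat.card Q) (P : Subgroup H) (hs : Group.IsSolvable P) (hP : ∀ x ∈ P, α x ∈ P)
    (hQP : Q ≤ Subgroup.normalizer (P : Set H)) (hco : (Nat.card P).Coprime (Nat.card Q))
    (hfix : ∀ x ∈ P, α x = x → x = 1)
    (hc : ∀ y ∈ Q, α y = y → ∀ x ∈ P, y * x = x * y) : ∀ y ∈ Q, ∀ x ∈ P, y * x = x * y := by
  by_cases htriv : P = ⊥
  · intro y _ x hx
    rw [htriv, Subgroup.mem_bot] at hx
    rw [hx, mul_one, one_mul]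
  have hlt : ⁅P, P⁆ < P := by
    have : Nontrivial P := (Subgroup.nontrivial_iff_ne_bot P).mpr htriv
    have h1 := Group.IsSolvable.commutator_lt_top_of_nontrivial P
    rw [← Subgroup.map_subtype_commutator]
    refine lt_of_le_of_ne (Subgroup.map_subtype_le _) fun h => h1.ne ?_
    rw [← Subgroup.map_subtype_inj, h, ← MonoidHom.range_eq_map, Subgroup.range_subtype]
  have hcard : Nat.card (⁅P, P⁆ : Subgroup H) < Nat.card P :=
    Set.Finite.card_lt_card (Set.toFinite (P : Set H)) hlt
  have ih := commute_of_fixed_commute hαr hQ hrQ (⁅P, P⁆ : Subgroup H)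
    (Group.isSolvable_of_isSolvable_injective (Subgroup.inclusion_injective hlt.le)) ?_ ?_ ?_ ?_ ?_
  rotate_left
  · intro x hx
    have h1 : ⁅P, P⁆ ≤ ⁅P, P⁆.comap α := by
      rw [← Subgroup.map_le_iff_le_comap, Subgroup.map_commutator]
      exact Subgroup.commutator_mono (Subgroup.map_le_iff_le_comap.mpr hP)
        (Subgroup.map_le_iff_le_comap.mpr hP)
    exact h1 hx
  · intro y hy
    have h1 := hQP hy
    rw [Subgroup.mem_normalizer_iff_map_conj_eq] at h1 ⊢
    rw [Subgroup.map_commutator, h1]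
  · exact hco.coprime_dvd_left (Subgroup.card_dvd_of_le hlt.le)
  · exact fun x hx => hfix x (hlt.le hx)
  · exact fun y hy hf x hx => hc y hy hf x (hlt.le hx)
  let αP : P →* P := (α.comp P.subtype).codRestrict P fun y => hP y y.2
  let αQ : Q →* Q := (α.comp Q.subtype).codRestrict Q fun y => hQ y y.2
  have hPr : αP^[r] = id := by
    funext x
    exact Subtype.ext ((MonoidHom.coe_codRestrict_iterate hP r x).trans (by rw [hαr]; rfl))
  have hQr : αQ^[r] = id := by
    funext x
    exact Subtype.ext ((MonoidHom.coe_codRestrict_iterate hQ r x).trans (by rw [hαr]; rfl))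
  have hDP : commutator P ≤ (commutator P).comap αP := by
    rw [← Subgroup.map_le_iff_le_comap, commutator_def, Subgroup.map_commutator]
    exact Subgroup.commutator_mono le_top le_top
  let αW : Abelianization P →* Abelianization P := QuotientGroup.map _ _ αP hDP
  have hsemi : Function.Semiconj Abelianization.of αP αW := fun x => rfl
  have hsur : Function.Surjective (Abelianization.of (G := P)) := QuotientGroup.mk_surjective
  let ρ : Q →* MulAut (Abelianization P) :=
    { toFun y := (P.normalizerMonoidHom (Subgroup.inclusion hQP y)).abelianizationCongr
      map_one' := by
        ext x
        obtain ⟨x, rfl⟩ := hsur x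
        rw [map_one, map_one]
        rfl
      map_mul' y z := by
        ext x
        obtain ⟨x, rfl⟩ := hsur x
        rw [map_mul, map_mul]
        rfl }
  have hρ : ∀ (y : Q) (x : P), ρ y (Abelianization.of x) =
      Abelianization.of (P.normalizerMonoidHom (Subgroup.inclusion hQP y) x) :=
    fun _ _ => rfl
  have hρv : ∀ (y : Q) (x : P), (P.normalizerMonoidHom (Subgroup.inclusion hQP y) x : H) =
      y * x * (y : H)⁻¹ := fun _ _ => rfl
  have key := smul_eq_self_of_fixed (α := αW) (β := αQ) ρ (r := r) (by
      funext x
      obtain ⟨x, rfl⟩ := hsur x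
      rw [← (hsemi.iterate_right r) x, hPr, id, id]) hQr
    (FixedPointFree.quotient (α := αP)
      (fun x hx => Subtype.ext (hfix x x.2 (congrArg Subtype.val hx))) hDP) (by
      intro y hy
      ext x
      obtain ⟨x, rfl⟩ := hsur x
      rw [hρ]
      refine congrArg Abelianization.of (Subtype.ext ?_)
      rw [hρv, hc y y.2 (congrArg Subtype.val hy) x x.2, mul_inv_cancel_right]) hrQ (by
      intro y w
      obtain ⟨x, rfl⟩ := hsur w
      change Abelianization.of (αP _) = Abelianization.of _
      congr 1
      refine Subtype.ext ?_
      change α (y * x * (y : H)⁻¹) = α y * α x * (α y)⁻¹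
      simp only [map_mul, map_inv])
    (hco.coprime_dvd_left (Subgroup.card_quotient_dvd_card _))
  intro y hy x hx
  have h1 := key ⟨y, hy⟩ (Abelianization.of ⟨x, hx⟩)
  rw [hρ, eq_comm] at h1
  replace h1 := QuotientGroup.eq.mp h1
  have h2 : x⁻¹ * (y * x * y⁻¹) ∈ ⁅P, P⁆ := by
    rw [← Subgroup.map_subtype_commutator]
    exact ⟨_, h1, rfl⟩
  set z := x⁻¹ * (y * x * y⁻¹) with hz
  have h3 : ∀ n : ℕ, y ^ n * x * (y ^ n)⁻¹ = x * z ^ n := by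
    intro n
    induction n with
    | zero => simp
    | succ n ih' =>
      have h4 : y * z ^ n = z ^ n * y := ih y hy _ (pow_mem h2 n)
      calc y ^ (n + 1) * x * (y ^ (n + 1))⁻¹ = y * (y ^ n * x * (y ^ n)⁻¹) * y⁻¹ := by group
        _ = y * x * (z ^ n) * y⁻¹ := by rw [ih']; group
        _ = y * x * y⁻¹ * (y * z ^ n * y⁻¹) := by group
        _ = x * z * z ^ n := by rw [h4, hz]; group
        _ = x * z ^ (n + 1) := by rw [pow_succ' z, mul_assoc]
  have h5 := h3 (Nat.card Q)
  have h6 : y ^ Nat.card Q = 1 := congrArg Subtype.val (pow_card_eq_one' (x := (⟨y, hy⟩ : Q)))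
  rw [h6, one_mul, inv_one, mul_one, left_eq_mul] at h5
  have h7 : z ^ Nat.card P = 1 :=
    congrArg Subtype.val (pow_card_eq_one' (x := (⟨z, hlt.le h2⟩ : P)))
  have h8 := pow_gcd_eq_one.mpr ⟨h7, h5⟩
  rw [hco.gcd_eq_one, pow_one] at h8
  rw [hz, inv_mul_eq_one] at h8
  exact (eq_mul_inv_iff_mul_eq.mp h8).symm
termination_by Nat.card P

theorem isPGroup_zpowers_of_pow_eq_one {A : Type*} [Group A] {p k : ℕ} {x : A}
    (hx : x ^ p ^ k = 1) : IsPGroup p (Subgroup.zpowers x) := by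
  rintro ⟨_, n, rfl⟩
  refine ⟨k, Subtype.ext ?_⟩
  change (x ^ n) ^ p ^ k = 1
  rw [← zpow_natCast, zpow_comm, zpow_natCast, hx, one_zpow]

theorem Sylow.mem_iff_exists_pow {A : Type*} [Group A] [Finite A] {p : ℕ} [Fact p.Prime]
    (P : Sylow p A) (hP : (P : Subgroup A).Normal) {x : A} :
    x ∈ P ↔ ∃ k, x ^ p ^ k = 1 := by
  refine ⟨fun h => ?_, fun ⟨k, hk⟩ => ?_⟩
  · obtain ⟨k, hk⟩ := P.2 ⟨x, h⟩
    exact ⟨k, congrArg Subtype.val hk⟩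
  · obtain ⟨S, hS⟩ := (isPGroup_zpowers_of_pow_eq_one hk).exists_le_sylow
    have := P.unique_of_normal hP
    rw [Subsingleton.elim P S]
    exact hS (Subgroup.mem_zpowers x)

theorem Group.IsNilpotent.sylow_normal {A : Type*} [Group A] [Finite A] (hA : Group.IsNilpotent A)
    (p : ℕ) [hp : Fact p.Prime] (P : Sylow p A) : (P : Subgroup A).Normal := by
  have h := ((Group.isNilpotent_of_finite_tfae (G := A)).out 0 3).mp hA
  exact h p hp P

theorem Group.IsNilpotent.of_sylow_normal {A : Type*} [Group A] [Finite A]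
    (h : ∀ (p : ℕ) (_ : Fact p.Prime) (P : Sylow p A), (P : Subgroup A).Normal) :
    Group.IsNilpotent A :=
  ((Group.isNilpotent_of_finite_tfae (G := A)).out 0 3).mpr h

/-- The number of Sylow subgroups is prime to `r`, so a group of automorphisms of order `r`
leaves one invariant. -/
theorem exists_sylow_invariant {H : Type*} [Group H] [Finite H] {r : ℕ} [Fact r.Prime]
    {α : H →* H} (hαr : α^[r] = id) (hr : ¬ r ∣ Nat.card H) (q : ℕ) [Fact q.Prime] :
    ∃ Q : Sylow q H, ∀ x ∈ Q, α x ∈ Q := by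
  let e : MulAut H := MulEquiv.ofBijective α
    ⟨injective_of_iterate_eq_id hαr, surjective_of_iterate_eq_id hαr⟩
  have he : e ^ r = 1 := by
    ext x
    exact (congrFun (hom_coe_pow (fun f : MulAut H => (f : H → H)) rfl (fun _ _ => rfl) e r)
      x).trans (congrFun hαr x)
  obtain ⟨Q, hQ⟩ := exists_fixed_of_iterate (f := fun Q : Sylow q H => e • Q) (r := r) (by
    rw [smul_iterate, he]
    funext Q
    exact one_smul _ Q) fun h => hr ((h.trans (Sylow.card_dvd_index default)).trans
      (Subgroup.index_dvd_card _))
  refine ⟨Q, fun x hx => ?_⟩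
  rw [← hQ]
  exact Subgroup.smul_mem_pointwise_smul x e Q hx

theorem isNilpotent_of_fixed_commute {H : Type*} [Group H] [Finite H] {r : ℕ} [Fact r.Prime]
    {α : H →* H} (hαr : α^[r] = id) (hr : ¬ r ∣ Nat.card H) (A : Subgroup H) [A.Normal]
    (hA : ∀ x ∈ A, α x ∈ A) (hnA : Group.IsNilpotent A) (hnq : Group.IsNilpotent (H ⧸ A))
    (hfix : ∀ x ∈ A, α x = x → x = 1)
    (hc : ∀ (q p : ℕ) (_ : q.Prime) (_ : p.Prime) (_ : p ≠ q) (c : H), α c = c →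
      IsPGroup q (Subgroup.zpowers c) → ∀ x ∈ A, IsPGroup p (Subgroup.zpowers x) →
      c * x = x * c) : Group.IsNilpotent H := by
  refine Group.IsNilpotent.of_sylow_normal fun q hq S => ?_
  obtain ⟨Q, hQα⟩ := exists_sylow_invariant hαr hr q
  suffices hQ : (Q : Subgroup H).Normal by
    have := Q.unique_of_normal hQ
    rwa [Subsingleton.elim S Q]
  have hPn : ∀ (p : ℕ) [Fact p.Prime] (P : Sylow p A),
      (Subgroup.map A.subtype (P : Subgroup A)).Normal := fun p _ P => by
    have := P.characteristic_of_normal (hnA.sylow_normal p P)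
    exact ConjAct.normal_of_characteristic_of_normal
  have hPg : ∀ (p : ℕ) [Fact p.Prime] (P : Sylow p A),
      IsPGroup p (Subgroup.map A.subtype (P : Subgroup A)) := fun p _ P => P.2.map _
  have hle : A ≤ Subgroup.normalizer (Q : Set H) := by
    rw [← Subgroup.relIndex_eq_one, Nat.eq_one_iff_not_exists_prime_dvd]
    intro p hp hd
    have := Fact.mk hp
    let P : Sylow p A := default
    have hN := hPn p P
    have hle : Subgroup.map A.subtype (P : Subgroup A) ≤ Subgroup.normalizer (Q : Set H) := by
      by_cases hpq : p = q
      · subst hpq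
        exact ((hPg p P).le_sylow_of_normal Q).trans Subgroup.le_normalizer
      · have hcom := commute_of_fixed_commute hαr hQα
          (fun h => hr (h.trans (Subgroup.card_subgroup_dvd_card _))) (Subgroup.map A.subtype P)
          (by have := (hPg p P).isNilpotent; infer_instance) ?_ ?_ ?_ ?_ ?_
        · intro x hx
          refine Subgroup.centralizer_le_normalizer _ fun y hy => ?_
          exact hcom y hy x hx
        · rintro _ ⟨x, hx, rfl⟩
          obtain ⟨k, hk⟩ := (P.mem_iff_exists_pow (hnA.sylow_normal p P)).mp hx
          refine ⟨⟨α x, hA x x.2⟩, ?_, rfl⟩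
          refine (P.mem_iff_exists_pow (hnA.sylow_normal p P)).mpr ⟨k, Subtype.ext ?_⟩
          have h1 := congrArg α (congrArg Subtype.val hk)
          simpa using h1
        · rw [Subgroup.normalizer_eq_top]
          exact le_top
        · exact IsPGroup.coprime_card_of_ne p q hpq _ _ (hPg p P) Q.2
        · exact fun x hx => hfix x (Subgroup.map_subtype_le _ hx)
        · intro c hcQ hcα x hx
          exact hc q p hq.out hp hpq c hcα (isPGroup_zpowers_of_mem Q.2 hcQ) x
            (Subgroup.map_subtype_le _ hx) (isPGroup_zpowers_of_mem (hPg p P) hx)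
    have h1 : (P : Subgroup A) ≤ (Subgroup.normalizer (Q : Set H)).subgroupOf A :=
      fun x hx => hle ⟨x, hx, rfl⟩
    exact P.not_dvd_index (hd.trans (Subgroup.index_dvd_of_le h1))
  have hsup : ((Q : Subgroup H) ⊔ A).Normal := by
    have h1 := hnq.sylow_normal q (Q.mapSurjective (QuotientGroup.mk'_surjective A))
    have h2 := h1.comap (QuotientGroup.mk' A)
    rwa [Sylow.coe_mapSurjective, Subgroup.comap_map_eq, QuotientGroup.ker_mk'] at h2
  have h3 := Q.normalizer_sup_eq_top' (N := (Q : Subgroup H) ⊔ A) le_sup_left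
  rw [← Subgroup.normalizer_eq_top_iff, ← h3]
  exact (sup_eq_left.mpr (sup_le Subgroup.le_normalizer hle)).symm

/-- A finite solvable group with a fixed-point-free automorphism of prime order is nilpotent. -/
theorem isNilpotent_of_isSolvable_of_fixedPointFree {L : Type*} [Group L] [Finite L]
    (hs : Group.IsSolvable L) {r : ℕ} [Fact r.Prime] {α : L →* L} (hαr : α^[r] = id)
    (hα : FixedPointFree α) : Group.IsNilpotent L := by
  rcases subsingleton_or_nontrivial L with h | h
  · infer_instance
  have hlt := Group.IsSolvable.commutator_lt_top_of_nontrivial L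
  have hcard : Nat.card (commutator L) < Nat.card L := by
    refine lt_of_le_of_ne (Subgroup.card_le_card_group _) fun h => hlt.ne ?_
    exact Subgroup.eq_top_of_card_eq _ h
  have hD : ∀ x ∈ commutator L, α x ∈ commutator L := by
    change commutator L ≤ (commutator L).comap α
    rw [← Subgroup.map_le_iff_le_comap, commutator_def, Subgroup.map_commutator]
    exact Subgroup.commutator_mono le_top le_top
  have hn : Group.IsNilpotent (commutator L) :=
    isNilpotent_of_isSolvable_of_fixedPointFree
      (α := (α.comp (commutator L).subtype).codRestrict (commutator L) fun y => hD y y.2)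
      inferInstance
      (by
        funext x
        exact Subtype.ext ((MonoidHom.coe_codRestrict_iterate hD r x).trans (by rw [hαr]; rfl)))
      fun x hx => Subtype.ext (hα x (congrArg Subtype.val hx))
  refine isNilpotent_of_fixed_commute hαr (hα.not_dvd_card hαr) (commutator L) hD hn
    (inferInstanceAs (Group.IsNilpotent (Abelianization L))) (fun x _ => hα x) ?_
  intro _ _ _ _ _ c hc _ x _ _
  rw [hα c hc, one_mul, mul_one]
termination_by Nat.card L

end

/-- A group with a normal `p`-complement. -/
def IsPNilpotent (p : ℕ) (G : Type*) [Group G] : Prop :=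
  ∃ K : Subgroup G, K.Normal ∧ ¬ p ∣ Nat.card K ∧ ∃ n, K.index = p ^ n

theorem mem_iff_not_dvd_orderOf {G : Type*} [Group G] {p n : ℕ} [hp : Fact p.Prime]
    {K : Subgroup G} [Finite K] [K.Normal] (hK : ¬ p ∣ Nat.card K) (hn : K.index = p ^ n) {x : G} :
    x ∈ K ↔ ¬ p ∣ orderOf x := by
  refine ⟨fun hx h => hK (h.trans ?_), fun h => ?_⟩
  · rw [← Subgroup.orderOf_mk x hx]
    exact orderOf_dvd_natCard _
  · rw [← QuotientGroup.eq_one_iff, ← orderOf_eq_one_iff]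
    have h1 : orderOf (x : G ⧸ K) ∣ p ^ n := hn ▸ orderOf_dvd_natCard _
    have h2 : orderOf (x : G ⧸ K) ∣ orderOf x := orderOf_map_dvd (QuotientGroup.mk' K) x
    exact Nat.eq_one_of_dvd_coprimes (((hp.out.coprime_iff_not_dvd).mpr h).pow_left n) h1 h2

namespace IsPNilpotent

universe u

variable {p : ℕ} [hp : Fact p.Prime] {G H : Type*} [Group G] [Group H]

theorem of_injective (hG : IsPNilpotent p G) (f : H →* G) (hf : Function.Injective f) :
    IsPNilpotent p H := by
  obtain ⟨K, hK, hKp, n, hn⟩ := hG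
  refine ⟨K.comap f, inferInstance,
    fun h => hKp (h.trans (Subgroup.card_comap_dvd_of_injective K f hf)), ?_⟩
  have h1 : K.relIndex f.range ∣ p ^ n := hn ▸ Subgroup.relIndex_dvd_index_of_normal K f.range
  obtain ⟨m, -, hm⟩ := (Nat.dvd_prime_pow hp.out).mp h1
  exact ⟨m, (Subgroup.index_comap K f).trans hm⟩

theorem of_surjective (hG : IsPNilpotent p G) (f : G →* H) (hf : Function.Surjective f) :
    IsPNilpotent p H := by
  obtain ⟨K, hK, hKp, n, hn⟩ := hG
  refine ⟨K.map f, hK.map f hf, fun h => hKp (h.trans (Subgroup.card_map_dvd K f)), ?_⟩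
  obtain ⟨m, -, hm⟩ := (Nat.dvd_prime_pow hp.out).mp (hn ▸ K.index_map_dvd hf)
  exact ⟨m, hm⟩

theorem of_quotient [Finite G] {M : Subgroup G} [M.Normal] (hM : ¬ p ∣ Nat.card M)
    (hG : IsPNilpotent p (G ⧸ M)) : IsPNilpotent p G := by
  obtain ⟨K, hK, hKp, n, hn⟩ := hG
  have hi := Subgroup.index_comap_of_surjective K (QuotientGroup.mk'_surjective M)
  refine ⟨K.comap (QuotientGroup.mk' M), inferInstance, fun h => ?_, n, hi.trans hn⟩
  have h1 : Nat.card (K.comap (QuotientGroup.mk' M)) * K.index =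
      Nat.card M * Nat.card K * K.index := by
    rw [← hi, Subgroup.card_mul_index, hi, mul_assoc, Subgroup.card_mul_index,
      mul_comm, ← Subgroup.card_eq_card_quotient_mul_card_subgroup]
  rw [Nat.eq_of_mul_eq_mul_right (Nat.pos_of_ne_zero K.index_ne_zero_of_finite) h1] at h
  exact (hp.out.dvd_mul.mp h).elim hM hKp

theorem of_normal [Finite G] {M : Subgroup G} [hMn : M.Normal] {m : ℕ} (hm : M.index = p ^ m)
    (hM : IsPNilpotent p M) : IsPNilpotent p G := by
  obtain ⟨K, hK, hKp, n, hn⟩ := hM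
  have hc : K.Characteristic := by
    refine Subgroup.characteristic_iff_comap_le.mpr fun φ x hx => ?_
    rw [Subgroup.mem_comap, mem_iff_not_dvd_orderOf hKp hn, MulEquiv.coe_toMonoidHom,
      MulEquiv.orderOf_eq] at hx
    rwa [mem_iff_not_dvd_orderOf hKp hn]
  refine ⟨K.map M.subtype, ConjAct.normal_of_characteristic_of_normal,
    fun h => hKp (h.trans (Subgroup.card_map_dvd _ _)), n + m, ?_⟩
  rw [Subgroup.index_map_subtype, hn, hm, pow_add]

theorem normalizer_of_map {X : Subgroup H} (f : H →* G) (hf : Function.Injective f)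
    (h : IsPNilpotent p (Subgroup.normalizer (X.map f : Set G))) :
    IsPNilpotent p (Subgroup.normalizer (X : Set H)) := by
  refine h.of_injective ((f.comp (Subgroup.normalizer (X : Set H)).subtype).codRestrict _
    fun x => Subgroup.le_normalizer_map f ⟨x, x.2, rfl⟩) fun x y hxy => ?_
  exact Subtype.ext (hf (congrArg Subtype.val hxy))

theorem of_not_dvd {p : ℕ} {G : Type*} [Group G] (h : ¬ p ∣ Nat.card G) : IsPNilpotent p G :=
  ⟨⊤, inferInstance, by rwa [Subgroup.card_top], 0, by simp⟩

theorem exists_complement [Finite G] (hG : IsPNilpotent p G) : ∃ K : Subgroup G, K.Normal ∧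
    ¬ p ∣ Nat.card K ∧ (∀ P : Sylow p G, (P : Subgroup G) ⊔ K = ⊤) ∧
    ∀ U : Subgroup G, U.Normal → IsPGroup p U → K ≤ Subgroup.centralizer U := by
  obtain ⟨K, hK, hKp, n, hn⟩ := hG
  refine ⟨K, hK, hKp, fun P => P.sup_eq_top_of_index hn, fun U hU hUp x hx y hy => ?_⟩
  exact (Subgroup.commute_of_normal_of_disjoint U K hU hK
    (Subgroup.disjoint_def.mpr fun h1 h2 => eq_one_of_mem_of_mem hUp hKp h1 h2) y x hy hx)

theorem exists_smul_eq [Finite G] (hG : IsPNilpotent p G) (S T : Sylow p G) (U : Subgroup G)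
    (hU : U.Normal) (hUp : IsPGroup p U) : ∃ k ∈ Subgroup.centralizer (U : Set G), k • S = T := by
  obtain ⟨K, hK, -, hsup, hcen⟩ := hG.exists_complement
  obtain ⟨g, rfl⟩ := MulAction.exists_smul_eq G S T
  have hg : g ∈ K ⊔ (S : Subgroup G) := by
    rw [sup_comm, hsup]
    trivial
  obtain ⟨k, hk, t, ht, rfl⟩ := Subgroup.mem_sup_of_normal_left.mp hg
  refine ⟨k, hcen U hU hUp hk, ?_⟩
  rw [mul_smul]
  congr 1
  exact (Sylow.smul_eq_iff_mem_normalizer.mpr (Subgroup.le_normalizer ht)).symm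

end IsPNilpotent

theorem IsPGroup.lt_inf_normalizer {G : Type*} [Group G] [Finite G] {p : ℕ} [Fact p.Prime]
    {S D : Subgroup G} (hS : IsPGroup p S) (h : D < S) :
    D < S ⊓ Subgroup.normalizer (D : Set G) := by
  have hn := hS.isNilpotent
  have h1 : D.subgroupOf S < ⊤ := lt_top_iff_ne_top.mpr fun h2 =>
    h.not_ge (Subgroup.subgroupOf_eq_top.mp h2)
  have h2 := Group.normalizerCondition_of_isNilpotent (G := S) _ h1
  obtain ⟨x, hx, hxD⟩ := SetLike.exists_of_lt h2
  refine lt_of_le_of_ne (le_inf h.le Subgroup.le_normalizer) fun h3 => hxD ?_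
  rw [Subgroup.mem_subgroupOf, h3]
  refine ⟨x.2, Subgroup.mem_normalizer_iff.mpr ?_⟩
  intro y
  rw [Subgroup.mem_normalizer_iff] at hx
  refine ⟨fun hy => (hx ⟨y, h.le hy⟩).mp hy, fun hy => ?_⟩
  have hyS : y ∈ S := by
    have := mul_mem (mul_mem (inv_mem x.2) (h.le hy)) x.2
    rwa [show (x : G)⁻¹ * (x * y * (x : G)⁻¹) * x = y by group] at this
  exact (hx ⟨y, hyS⟩).mpr hy

theorem Sylow.mem_smul_iff {G : Type*} [Group G] {p : ℕ} {g x : G} {P : Sylow p G} :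
    x ∈ g • P ↔ g⁻¹ * x * g ∈ P := by
  change x ∈ ((g • P : Sylow p G) : Subgroup G) ↔ _
  rw [Sylow.coe_subgroup_smul, Subgroup.mem_pointwise_smul_iff_inv_smul_mem, ← map_inv,
    MulAut.smul_def, MulAut.conj_apply, inv_inv]
  rfl

section Frobenius

variable {p : ℕ} [hp : Fact p.Prime]

theorem exists_mem_centralizer_smul_eq {G : Type*} [Group G] [Finite G]
    (hG : ∀ X : Subgroup G, X ≠ ⊥ → IsPGroup p X →
      IsPNilpotent p (Subgroup.normalizer (X : Set G))) (S P : Sylow p G) :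
    ∃ g ∈ Subgroup.centralizer ((S : Subgroup G) ⊓ P : Set G), g • S = P := by
  by_cases hSP : S = P
  · exact ⟨1, one_mem _, hSP ▸ one_smul _ _⟩
  set D : Subgroup G := (S : Subgroup G) ⊓ P with hD
  have hDc : ((S : Subgroup G) ⊓ P : Set G) = D := rfl
  rw [hDc]
  by_cases hbot : D = ⊥
  · obtain ⟨g, hg⟩ := MulAction.exists_smul_eq G S P
    refine ⟨g, fun x hx => ?_, hg⟩
    rw [SetLike.mem_coe, hbot, Subgroup.mem_bot] at hx
    rw [hx, one_mul, mul_one]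
  have hDS : D < S := lt_of_le_of_ne inf_le_left fun h => hSP (Sylow.ext
    (S.3 P.2 (inf_eq_left.mp h)).symm)
  have hDP : D < P := lt_of_le_of_ne inf_le_right fun h => hSP (Sylow.ext
    (P.3 S.2 (inf_eq_right.mp h)))
  have hDp : IsPGroup p D := S.2.to_le hDS.le
  set N : Subgroup G := Subgroup.normalizer (D : Set G) with hN
  obtain ⟨T₁, hT₁⟩ := ((S.2.to_le (inf_le_left (b := N))).comap_subtype (K := N)).exists_le_sylow
  obtain ⟨T₂, hT₂⟩ := ((P.2.to_le (inf_le_left (b := N))).comap_subtype (K := N)).exists_le_sylow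
  have hDn : (D.subgroupOf N).Normal := Subgroup.normal_in_normalizer
  obtain ⟨k, hkD, hk⟩ := (hG D hbot hDp).exists_smul_eq T₁ T₂ (D.subgroupOf N) hDn
    hDp.comap_subtype
  obtain ⟨R, hR⟩ := (T₂.2.map N.subtype).exists_le_sylow
  have hkD' : (k : G) ∈ Subgroup.centralizer (D : Set G) := fun x hx =>
    congrArg Subtype.val (hkD ⟨x, Subgroup.le_normalizer hx⟩ hx)
  have h1 : (S : Subgroup G) ⊓ N ≤ (S : Subgroup G) ⊓ ((k : G)⁻¹ • R : Sylow p G) := by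
    refine le_inf inf_le_left fun x hx => ?_
    refine Sylow.mem_smul_iff.mpr ?_
    rw [inv_inv]
    have h2 : (⟨x, hx.2⟩ : N) ∈ T₁ := hT₁ hx
    refine hR ⟨k * ⟨x, hx.2⟩ * k⁻¹, ?_, rfl⟩
    rw [← hk]
    refine Sylow.mem_smul_iff.mpr ?_
    rwa [show k⁻¹ * (k * ⟨x, hx.2⟩ * k⁻¹) * k = ⟨x, hx.2⟩ by group]
  have h2 : (P : Subgroup G) ⊓ N ≤ (R : Subgroup G) ⊓ P :=
    le_inf (fun x hx => hR ⟨⟨x, hx.2⟩, hT₂ hx, rfl⟩) inf_le_left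
  have hlt1 : D < (S : Subgroup G) ⊓ ((k : G)⁻¹ • R : Sylow p G) :=
    (S.2.lt_inf_normalizer hDS).trans_le h1
  have hlt2 : D < (R : Subgroup G) ⊓ P := (P.2.lt_inf_normalizer hDP).trans_le h2
  have hc1 := Set.Finite.card_lt_card (Set.toFinite _) (SetLike.coe_ssubset_coe.mpr hlt1)
  have hc2 := Set.Finite.card_lt_card (Set.toFinite _) (SetLike.coe_ssubset_coe.mpr hlt2)
  have hb1 := Subgroup.card_le_card_group ((S : Subgroup G) ⊓ ((k : G)⁻¹ • R : Sylow p G))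
  have hb2 := Subgroup.card_le_card_group ((R : Subgroup G) ⊓ P)
  obtain ⟨g₁, hg₁, hg₁'⟩ := exists_mem_centralizer_smul_eq hG S ((k : G)⁻¹ • R)
  obtain ⟨g₂, hg₂, hg₂'⟩ := exists_mem_centralizer_smul_eq hG R P
  refine ⟨g₂ * k * g₁, mul_mem (mul_mem ?_ hkD') ?_, ?_⟩
  · exact Subgroup.centralizer_le (SetLike.coe_subset_coe.mpr hlt2.le) hg₂
  · exact Subgroup.centralizer_le (SetLike.coe_subset_coe.mpr hlt1.le) hg₁
  · rw [mul_smul, mul_smul, hg₁', smul_inv_smul, hg₂']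
termination_by Nat.card G - Nat.card ((S : Subgroup G) ⊓ P : Subgroup G)
decreasing_by
  · exact Nat.sub_lt_sub_left (hc1.trans_le hb1) hc1
  · exact Nat.sub_lt_sub_left (hc2.trans_le hb2) hc2

/-- **Frobenius' criterion** for the existence of a normal `p`-complement. -/
theorem isPNilpotent_of_normalizer {G : Type*} [Group G] [Finite G]
    (hG : ∀ X : Subgroup G, X ≠ ⊥ → IsPGroup p X →
      IsPNilpotent p (Subgroup.normalizer (X : Set G))) : IsPNilpotent p G := by
  by_cases hdvd : p ∣ Nat.card G
  swap
  · exact IsPNilpotent.of_not_dvd hdvd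
  let P : Sylow p G := default
  have hPbot : (P : Subgroup G) ≠ ⊥ := P.ne_bot_of_dvd_card hdvd
  have hnt : Nontrivial P := (Subgroup.nontrivial_iff_ne_bot _).mpr hPbot
  have hfus : ∀ x ∈ P, ∀ g : G, g * x * g⁻¹ ∈ P → ∃ u ∈ P, g * x * g⁻¹ = u * x * u⁻¹ := by
    intro x hx g hg
    obtain ⟨h, hh, hh'⟩ := exists_mem_centralizer_smul_eq hG (g • P) P
    rw [← mul_smul, Sylow.smul_eq_iff_mem_normalizer] at hh'
    obtain ⟨K, hK, -, hsup, hcen⟩ := (hG P hPbot P.2).exists_complement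
    have hxg : g * x * g⁻¹ ∈ g • P := by
      rw [Sylow.mem_smul_iff, show g⁻¹ * (g * x * g⁻¹) * g = x by group]
      exact hx
    have h1 := hh _ ⟨hxg, hg⟩
    have h2 : (⟨h * g, hh'⟩ : Subgroup.normalizer (P : Set G)) ∈
        ((P.subtype Subgroup.le_normalizer : Sylow p (Subgroup.normalizer (P : Set G))) :
          Subgroup _) ⊔ K := by
      rw [hsup]
      trivial
    obtain ⟨u, hu, k, hk, huk⟩ := Subgroup.mem_sup_of_normal_right.mp h2
    have hk' := hcen ((P : Subgroup G).subgroupOf _) Subgroup.normal_in_normalizer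
      P.2.comap_subtype hk ⟨x, Subgroup.le_normalizer hx⟩ hx
    replace hk' : x * (k : G) = k * x := congrArg Subtype.val hk'
    replace huk : (u : G) * k = h * g := congrArg Subtype.val huk
    refine ⟨u, hu, ?_⟩
    calc g * x * g⁻¹ = h * (g * x * g⁻¹) * h⁻¹ := by rw [← h1, mul_inv_cancel_right]
      _ = (h * g) * x * (h * g)⁻¹ := by group
      _ = u * (k * x * (k : G)⁻¹) * (u : G)⁻¹ := by rw [← huk]; group
      _ = u * x * (u : G)⁻¹ := by rw [← hk', mul_inv_cancel_right]
  have hfoc : Subgroup.focalSubgroupOf (P : Subgroup G) ≤ commutator P := by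
    rw [Subgroup.focalSubgroupOf_eq_closure, Subgroup.closure_le]
    rintro z ⟨x, hx, g, hz⟩
    rw [commutatorElement_def] at hz
    have h1 : g * x⁻¹ * g⁻¹ ∈ P := by
      have h2 := mul_mem (inv_mem hx) z.2
      rw [hz, ← mul_assoc, ← mul_assoc, ← mul_assoc, inv_mul_cancel, one_mul] at h2
      exact h2
    obtain ⟨u, hu, h3⟩ := hfus x⁻¹ (inv_mem hx) g h1
    have h4 : z = ⟨x, hx⟩ * ⟨u, hu⟩ * (⟨x, hx⟩ : P)⁻¹ * (⟨u, hu⟩ : P)⁻¹ := Subtype.ext (by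
      rw [hz, mul_assoc x, mul_assoc x, h3]
      simp [mul_assoc])
    rw [h4]
    exact Subgroup.commutator_mem_commutator (Subgroup.mem_top _) (Subgroup.mem_top _)
  have hPs : Group.IsSolvable P := by
    have := P.2.isNilpotent
    infer_instance
  have hlt := Group.IsSolvable.commutator_lt_top_of_nontrivial P
  set M := Subgroup.transferFocal (P : Subgroup G) |>.ker with hM
  have hcard : Nat.card (G ⧸ M) = _ := Nat.card_congr
    (Subgroup.transferFocal.quotientKerMulEquivQuotientFocalSubroupOf P).toEquiv
  obtain ⟨n, hn⟩ := (P.2.to_quotient (Subgroup.focalSubgroupOf (P : Subgroup G))).exists_card_eq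
  have hMi : M.index = p ^ n := hcard.trans hn
  have hne : M.index ≠ 1 := fun h => (hfoc.trans_lt hlt).ne
    (Subgroup.index_eq_one.mp (hcard.symm.trans h))
  have hlt' : Nat.card M < Nat.card G := by
    refine lt_of_le_of_ne (Subgroup.card_le_card_group _) fun h => hne ?_
    exact Subgroup.index_eq_one.mpr (Subgroup.eq_top_of_card_eq _ h)
  refine IsPNilpotent.of_normal hMi (isPNilpotent_of_normalizer fun X hX hXp => ?_)
  refine IsPNilpotent.normalizer_of_map M.subtype M.subtype_injective (hG _ ?_ (hXp.map _))
  rwa [Ne, Subgroup.map_eq_bot_iff_of_injective _ M.subtype_injective]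
termination_by Nat.card G

end Frobenius

theorem one_add_pow_of_pow_three {R : Type*} [Ring R] {d : R} (hd : d * d * d = 0) (n : ℕ) :
    (1 + d) ^ n = 1 + n • d + n.choose 2 • (d * d) := by
  induction n with
  | zero => simp
  | succ n ih =>
    rw [pow_succ, ih, Nat.choose_succ_succ' n 1, Nat.choose_one_right]
    simp only [add_mul, mul_add, one_mul, mul_one, smul_mul_assoc, add_smul, one_smul, hd,
      smul_zero]
    abel

theorem mul_comm_of_mul_mul_eq_zsmul {X R : Type*} [Group X] [Finite X] [Ring R] {p : ℕ}
    [hp : Fact p.Prime] (ρ : X →* R) (hX : Odd (Nat.card X)) (hp0 : ∀ T : R, p • T = 0)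
    (hρ : Function.Injective ρ) {x e : X} (hx : x ^ p = 1)
    (hf : ¬ p ∣ orderOf (e * x * e⁻¹ * x⁻¹)) {a : R} (hxa : ρ x = 1 + a)
    (hrank : ∀ S : R, ∃ c : ℤ, a * S * a = c • a) : e * x = x * e := by
  have hdvd : ∀ (m : ℤ) (T : R), (p : ℤ) ∣ m → m • T = 0 := by
    rintro _ T ⟨m, rfl⟩
    rw [mul_comm, mul_smul, natCast_zsmul, hp0, smul_zero]
  have hzero : ∀ (m : ℤ) (T : R), m • T = 0 → (p : ℤ) ∣ m ∨ T = 0 := by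
    intro m T h
    by_cases hm : (p : ℤ) ∣ m
    · exact Or.inl hm
    · obtain ⟨a, b, hab⟩ := ((Nat.prime_iff_prime_int.mp hp.out).coprime_iff_not_dvd).mpr hm
      right
      rw [← one_zsmul T, ← hab, add_smul, mul_smul b, h, smul_zero, add_zero]
      exact hdvd _ _ (dvd_mul_left _ _)
  by_contra hne
  have hx1 : x ≠ 1 := fun h => hne (by rw [h, one_mul, mul_one])
  have ha0 : a ≠ 0 := fun h => hx1 (hρ (by rw [map_one, hxa, h, add_zero]))
  have hp2 : p ≠ 2 := by
    rintro rfl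
    have : orderOf x = 2 := orderOf_eq_prime hx hx1
    exact (Nat.not_even_iff_odd.mpr hX) (even_iff_two_dvd.mpr (this ▸ orderOf_dvd_natCard x))
  have haa : a * a = 0 := by
    obtain ⟨m, hm⟩ := hrank 1
    rw [mul_one] at hm
    have h1 : ∀ n : ℕ, ρ x ^ n * a = ((1 + m) ^ n) • a := by
      intro n
      induction n with
      | zero => simp
      | succ n ih =>
        rw [pow_succ', mul_assoc, ih, mul_smul_comm, hxa, add_mul, one_mul, hm, pow_succ, mul_smul,
          add_smul, one_smul]
    have h2 := h1 p
    rw [← map_pow, hx, map_one, one_mul, eq_comm, ← sub_eq_zero] at h2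
    nth_rw 2 [← one_zsmul a] at h2
    rw [← sub_smul] at h2
    rcases hzero _ _ h2 with h3 | h3
    · have h4 : (p : ℤ) ∣ m := by
        rw [← ZMod.intCast_zmod_eq_zero_iff_dvd] at h3 ⊢
        push_cast at h3
        rwa [ZMod.pow_card, add_sub_cancel_left] at h3
      rw [hm, hdvd _ _ h4]
    · exact absurd h3 ha0
  obtain ⟨b, hb⟩ : ∃ b, b = ρ e * a * ρ e⁻¹ := ⟨_, rfl⟩
  have hee : ρ e⁻¹ * ρ e = 1 := by rw [← map_mul, inv_mul_cancel, map_one]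
  have hee' : ρ e * ρ e⁻¹ = 1 := by rw [← map_mul, mul_inv_cancel, map_one]
  have hyb : ρ (e * x * e⁻¹) = 1 + b := by
    rw [map_mul, map_mul, hxa, mul_add, add_mul, mul_one, hee', hb]
  have hbb : b * b = 0 := by
    rw [hb, show ρ e * a * ρ e⁻¹ * (ρ e * a * ρ e⁻¹) = ρ e * a * (ρ e⁻¹ * ρ e) * a * ρ e⁻¹ by
      noncomm_ring, hee, mul_one, mul_assoc (ρ e), haa, mul_zero, zero_mul]
  obtain ⟨c, hc⟩ := hrank b
  obtain ⟨c', hc'⟩ := hrank (ρ e⁻¹ * a * ρ e)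
  have hbab : b * a * b = c' • b := by
    rw [hb, show ρ e * a * ρ e⁻¹ * a * (ρ e * a * ρ e⁻¹) =
      ρ e * (a * (ρ e⁻¹ * a * ρ e) * a) * ρ e⁻¹ by noncomm_ring, hc', mul_smul_comm, smul_mul_assoc]
  by_cases hpc : (p : ℤ) ∣ c
  · have haba : a * b * a = 0 := hc.trans (hdvd _ _ hpc)
    replace hbab : b * a * b = 0 := by
      have h1 : c' • (a * b) = 0 := by
        rw [← mul_smul_comm, ← hbab, ← mul_assoc, ← mul_assoc, haba, zero_mul]
      rcases hzero _ _ h1 with h | h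
      · rw [hbab, hdvd _ _ h]
      · rw [mul_assoc, h, mul_zero]
    have hxi : ρ x⁻¹ = 1 - a := by
      have h1 : ρ x * (1 - a) = 1 := by
        rw [hxa, show (1 + a) * (1 - a) = 1 - a * a by noncomm_ring, haa, sub_zero]
      have h2 : ρ x⁻¹ * ρ x = 1 := by rw [← map_mul, inv_mul_cancel, map_one]
      calc ρ x⁻¹ = ρ x⁻¹ * (ρ x * (1 - a)) := by rw [h1, mul_one]
        _ = 1 - a := by rw [← mul_assoc, h2, one_mul]
    obtain ⟨d, hd⟩ : ∃ d, d = b - a - b * a := ⟨_, rfl⟩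
    have hdd : d * d = - (b * a) - a * b := by
      rw [hd, show (b - a - b * a) * (b - a - b * a) = b * b - b * a - b * b * a - a * b + a * a +
        a * b * a - b * a * b + b * (a * a) + b * a * b * a by noncomm_ring, hbb, haa, haba, hbab]
      noncomm_ring
    have hddd : d * d * d = 0 := by
      rw [hdd, hd, show (-(b * a) - a * b) * (b - a - b * a) = -(b * a * b) + b * (a * a) +
        b * a * b * a - a * (b * b) + a * b * a + a * (b * b) * a by noncomm_ring, hbb, haa, haba,
        hbab]
      noncomm_ring
    have hfd : ρ (e * x * e⁻¹ * x⁻¹) = 1 + d := by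
      rw [map_mul, hyb, hxi, hd]
      noncomm_ring
    have hfp : (e * x * e⁻¹ * x⁻¹) ^ p = 1 := by
      apply hρ
      have h3 : p ∣ p.choose 2 := hp.out.dvd_choose_self two_ne_zero
        (lt_of_le_of_ne hp.out.two_le hp2.symm)
      obtain ⟨k, hk⟩ := h3
      rw [map_pow, hfd, one_add_pow_of_pow_three hddd, hk, mul_comm, mul_smul, hp0, hp0, map_one,
        smul_zero, add_zero, add_zero]
    have hf1 : orderOf (e * x * e⁻¹ * x⁻¹) = 1 := by
      rcases (Nat.dvd_prime hp.out).mp (orderOf_dvd_of_pow_eq_one hfp) with h | h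
      · exact h
      · exact absurd (h ▸ dvd_rfl) hf
    rw [orderOf_eq_one_iff, mul_inv_eq_one, mul_inv_eq_iff_eq_mul] at hf1
    exact hne hf1
  · obtain ⟨j, hj⟩ : ∃ j : ℕ, (p : ℤ) ∣ j * c + 2 := by
      have hcz : (c : ZMod p) ≠ 0 := fun h => hpc ((ZMod.intCast_zmod_eq_zero_iff_dvd c p).mp h)
      refine ⟨(-2 * (c : ZMod p)⁻¹).val, ?_⟩
      rw [← ZMod.intCast_zmod_eq_zero_iff_dvd]
      push_cast
      rw [ZMod.natCast_val, ZMod.cast_id, mul_assoc, inv_mul_cancel₀ hcz]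
      ring
    obtain ⟨t, ht⟩ : ∃ t, t = x * (e * x * e⁻¹) ^ j := ⟨_, rfl⟩
    have hyj : ρ ((e * x * e⁻¹) ^ j) = 1 + j • b := by
      rw [map_pow, hyb, one_add_pow_of_pow_three (by rw [hbb, zero_mul]), hbb, smul_zero, add_zero]
    have hjc : (j * c : ℤ) • a = - (2 : ℤ) • a := by
      have := hdvd _ a hj
      rw [add_smul] at this
      rw [neg_smul]
      exact eq_neg_of_add_eq_zero_left this
    have hta : ρ t * a = - a + j • (b * a) := by
      rw [ht, map_mul, hyj, hxa, show (1 + a) * (1 + j • b) * a = a + a * a + j • (b * a) +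
        j • (a * b * a) by simp only [add_mul, mul_add, smul_mul_assoc, mul_smul_comm, smul_add,
          one_mul, mul_one]; abel, haa, hc, ← natCast_zsmul (c • a), ← mul_smul, hjc]
      abel
    have htba : ρ t * (b * a) = b * a + c • a := by
      rw [ht, map_mul, hyj, hxa, show (1 + a) * (1 + j • b) * (b * a) = b * a + a * b * a +
        j • (b * b * a) + j • (a * (b * b) * a) by
          simp only [add_mul, mul_add, smul_mul_assoc, mul_smul_comm, smul_add, one_mul,
            mul_one, mul_assoc]
          abel, hbb, hc]
      simp
    have htt : ρ t * ρ t * a = - a := by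
      rw [mul_assoc, hta, mul_add, mul_neg, hta, mul_smul_comm, htba, smul_add,
        ← natCast_zsmul (c • a), ← mul_smul, hjc]
      abel
    have hpow : ∀ n : ℕ, (ρ t * ρ t) ^ n * a = (-1) ^ n * a := by
      intro n
      induction n with
      | zero => simp
      | succ n ih =>
        rw [pow_succ, mul_assoc, htt, mul_neg, ih, pow_succ, mul_assoc, neg_one_mul, mul_neg]
    have h1 := hpow (Nat.card X)
    rw [← map_mul, ← map_pow, pow_card_eq_one', map_one, one_mul, hX.neg_one_pow, neg_one_mul,
      eq_neg_iff_add_eq_zero, ← two_zsmul] at h1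
    rcases hzero _ _ h1 with h2 | h2
    · have h3 : p ∣ 2 := by exact_mod_cast h2
      exact hp2 ((Nat.prime_dvd_prime_iff_eq hp.out Nat.prime_two).mp h3)
    · exact ha0 h2

section Transvection

variable {X V : Type*} [Group X] [Finite X] [AddCommGroup V] [Finite V] {p : ℕ} [hp : Fact p.Prime]
  (ρ : X →* AddMonoid.End V)

theorem exists_mul_mul_eq_zsmul (hV : ∀ v : V, p • v = 0) {T : AddMonoid.End V}
    (hT : Nat.card V ≤ p * Nat.card (AddMonoidHom.ker T)) (S : AddMonoid.End V) :
    ∃ c : ℤ, T * S * T = c • T := by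
  have hcard : Nat.card V = Nat.card (AddMonoidHom.range T) * Nat.card (AddMonoidHom.ker T) := by
    rw [AddSubgroup.card_eq_card_quotient_mul_card_addSubgroup (AddMonoidHom.ker T)]
    congr 1
    exact Nat.card_congr (QuotientAddGroup.quotientKerEquivRange T).toEquiv
  have hle : Nat.card (AddMonoidHom.range T) ≤ p := by
    rw [hcard] at hT
    exact Nat.le_of_mul_le_mul_right hT Nat.card_pos
  have hcyc : IsAddCyclic (AddMonoidHom.range T) := by
    have hpg : IsPGroup p (Multiplicative (AddMonoidHom.range T)) := fun x => ⟨1, by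
      rw [pow_one]
      exact Subtype.ext (hV _)⟩
    obtain ⟨n, hn⟩ := hpg.exists_card_eq
    have hn' : Nat.card (AddMonoidHom.range T) = p ^ n := hn
    rw [hn'] at hle
    rcases Nat.lt_or_ge n 1 with h | h
    · rw [Nat.lt_one_iff.mp h, pow_zero] at hn'
      have := (Nat.card_eq_one_iff_unique.mp hn').1
      infer_instance
    · have h1 : n ≤ 1 := (Nat.pow_le_pow_iff_right hp.out.one_lt).mp (by rwa [pow_one])
      rw [le_antisymm h1 h, pow_one] at hn'
      exact isAddCyclic_of_prime_card hn'
  let σ : AddMonoidHom.range T →+ AddMonoidHom.range T :=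
    ((AddMonoidHom.comp T S).comp (AddMonoidHom.range T).subtype).codRestrict _
      fun x => ⟨S x, rfl⟩
  obtain ⟨c, hc⟩ := AddMonoidHom.map_addCyclic σ
  refine ⟨c, ?_⟩
  ext v
  exact congrArg Subtype.val (hc ⟨T v, v, rfl⟩)

theorem mul_comm_of_card_le (hX : Odd (Nat.card X)) (hV : ∀ v : V, p • v = 0)
    (hρ : Function.Injective ρ) {x e : X} (hx : x ^ p = 1)
    (hf : ¬ p ∣ orderOf (e * x * e⁻¹ * x⁻¹))
    (hcard : Nat.card V ≤ p * Nat.card (AddMonoidHom.ker (ρ x - 1))) : e * x = x * e := by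
  refine mul_comm_of_mul_mul_eq_zsmul ρ hX (fun T => ?_) hρ hx hf
    (add_sub_cancel 1 (ρ x)).symm (exists_mul_mul_eq_zsmul hV hcard)
  ext v
  exact hV _

end Transvection

section CoprimeAction

variable {B : Type*} [Group B]

def fixedSubgroup {W : Type*} [Group W] (σ : B →* MulAut W) : Subgroup W where
  carrier := {w | ∀ b, σ b w = w}
  mul_mem' hv hw b := by rw [map_mul, hv b, hw b]
  one_mem' b := map_one _
  inv_mem' hv b := by rw [map_inv, hv b]

theorem map_prod_pow_eq_self {W : Type*} [CommGroup W] (σ : B →* MulAut W) {p : ℕ} {c : B}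
    (hc : c ^ p = 1) (w : W) :
    σ c (∏ i ∈ Finset.range p, σ (c ^ i) w) = ∏ i ∈ Finset.range p, σ (c ^ i) w := by
  have h := Finset.prod_range_succ' (fun i => σ (c ^ i) w) p
  rw [Finset.prod_range_succ, hc, pow_zero] at h
  rw [map_prod, mul_right_cancel h]
  refine Finset.prod_congr rfl fun i _ => ?_
  rw [pow_succ', map_mul]
  rfl

theorem pow_mem_fixedSubgroup {W : Type*} [CommGroup W] (σ : B →* MulAut W) {p : ℕ}
    (hp : 0 < p) (hB : ∀ b : B, b ^ p = 1) {b₁ b₂ : B} (hcomm : Commute b₁ b₂)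
    (h₁ : ∀ k, 0 < k → k < p → ∀ w, σ (b₁ ^ k) w = w → w ∈ fixedSubgroup σ)
    (h₂ : ∀ i w, σ (b₁ ^ i * b₂) w = w → w ∈ fixedSubgroup σ) (w : W) :
    w ^ p ∈ fixedSubgroup σ := by
  obtain ⟨n, rfl⟩ := Nat.exists_eq_succ_of_ne_zero hp.ne'
  have hid : ∏ i ∈ Finset.range (n + 1), ∏ k ∈ Finset.range (n + 1), σ ((b₁ ^ i * b₂) ^ k) w =
      (∏ k ∈ Finset.range n, ∏ i ∈ Finset.range (n + 1),
        σ ((b₁ ^ (k + 1)) ^ i) (σ (b₂ ^ (k + 1)) w)) * w ^ (n + 1) := by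
    rw [Finset.prod_comm, Finset.prod_range_succ']
    congr 1
    · refine Finset.prod_congr rfl fun k _ => Finset.prod_congr rfl fun i _ => ?_
      rw [(hcomm.pow_left i).mul_pow, map_mul, ← pow_mul, ← pow_mul, mul_comm i]
      rfl
    · simp
  refine ((fixedSubgroup σ).mul_mem_cancel_left ?_).mp (hid.subst (motive := (· ∈ _)) ?_)
  · refine Subgroup.prod_mem _ fun k hk => h₁ (k + 1) k.succ_pos ?_ _
      (map_prod_pow_eq_self σ (hB _) _)
    exact Nat.succ_lt_succ (Finset.mem_range.mp hk)
  · exact Subgroup.prod_mem _ fun i _ => h₂ i _ (map_prod_pow_eq_self σ (hB _) _)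

theorem exists_sylow_invariant_of_isPGroup {E : Type*} [Group E] [Finite E] [Finite B] {p : ℕ}
    [Fact p.Prime] (hB : IsPGroup p B) (φ : B →* MulAut E) (hE : ¬ p ∣ Nat.card E) (q : ℕ)
    [Fact q.Prime] : ∃ Q : Sylow q E, ∀ b, ∀ x ∈ Q, φ b x ∈ Q := by
  let _ : MulAction B (Sylow q E) := MulAction.compHom _ φ
  obtain ⟨Q, hQ⟩ := hB.nonempty_fixed_point_of_prime_not_dvd_card (Sylow q E)
    fun h => hE ((h.trans (Sylow.card_dvd_index default)).trans (Subgroup.index_dvd_card _))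
  refine ⟨Q, fun b x hx => ?_⟩
  have h : φ b • Q = Q := hQ b
  rw [← h]
  exact Subgroup.smul_mem_pointwise_smul x (φ b) Q hx

def abelianizationAction {D : Type*} [Group D] (φ : B →* MulAut D) :
    B →* MulAut (Abelianization D) where
  toFun b := (φ b).abelianizationCongr
  map_one' := by
    ext x
    obtain ⟨x, rfl⟩ : ∃ y, Abelianization.of y = x := QuotientGroup.mk_surjective x
    rw [map_one]
    rfl
  map_mul' b c := by
    ext x
    obtain ⟨x, rfl⟩ : ∃ y, Abelianization.of y = x := QuotientGroup.mk_surjective x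
    rw [map_mul]
    rfl

end CoprimeAction

theorem commute_of_forall_card_eq {X : Type*} [Group X] [Finite X] {p : ℕ} [hp : Fact p.Prime]
    {B E : Subgroup X} (hB : ∀ b ∈ B, b ^ p = 1) (hcomm : ∀ b ∈ B, ∀ c ∈ B, b * c = c * b)
    (hE : ¬ p ∣ Nat.card E) (hBE : ∀ b ∈ B, ∀ e ∈ E, b * e * b⁻¹ ∈ E)
    (h : ∀ B' ≤ B, p * Nat.card B' = Nat.card B → ∀ e ∈ E, (∀ b ∈ B', b * e = e * b) →
      ∀ b ∈ B, b * e = e * b) : ∀ b ∈ B, ∀ e ∈ E, b * e = e * b := by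
  have hBp : IsPGroup p B := fun b => ⟨1, by
    rw [pow_one]
    exact Subtype.ext (hB b b.2)⟩
  have hnorm : ∀ D : Subgroup X, (∀ b ∈ B, ∀ e ∈ D, b * e * b⁻¹ ∈ D) →
      B ≤ Subgroup.normalizer (D : Set X) := fun D hD b hb => by
    refine Subgroup.mem_normalizer_iff.mpr fun x => ⟨hD b hb x, fun hx => ?_⟩
    have := hD b⁻¹ (inv_mem hb) _ hx
    rwa [inv_inv, mul_assoc, inv_mul_cancel_right, ← mul_assoc, inv_mul_cancel, one_mul] at this
  let conj : ∀ D : Subgroup X, (∀ b ∈ B, ∀ e ∈ D, b * e * b⁻¹ ∈ D) → B →* MulAut D :=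
    fun D hD => D.normalizerMonoidHom.comp (Subgroup.inclusion (hnorm D hD))
  have hconj : ∀ (D : Subgroup X) hD (b : B) (x : D), (conj D hD b x : X) = b * x * (b : X)⁻¹ :=
    fun _ _ _ _ => rfl
  by_contra hne
  obtain ⟨q, hq, D₀, hD₀⟩ : ∃ q, q.Prime ∧ ∃ D : Subgroup X, IsPGroup q D ∧ D ≤ E ∧
      (∀ b ∈ B, ∀ x ∈ D, b * x * b⁻¹ ∈ D) ∧ ¬ ∀ b ∈ B, ∀ x ∈ D, b * x = x * b := by
    by_contra! hno
    have hrel : (Subgroup.centralizer (B : Set X)).relIndex E = 1 := by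
      rw [Nat.eq_one_iff_not_exists_prime_dvd]
      intro q hq hd
      have := Fact.mk hq
      obtain ⟨Q, hQ⟩ := exists_sylow_invariant_of_isPGroup hBp (conj E hBE) hE q
      have hc := hno q hq (Subgroup.map E.subtype Q) (Q.2.map _) (Subgroup.map_subtype_le _) (by
        rintro b hb _ ⟨x, hx, rfl⟩
        exact ⟨_, hQ ⟨b, hb⟩ x hx, rfl⟩)
      refine Q.not_dvd_index (hd.trans (Subgroup.index_dvd_of_le fun x hx => ?_))
      exact Subgroup.mem_centralizer_iff.mpr fun b hb => hc b hb x ⟨x, hx, rfl⟩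
    rw [Subgroup.relIndex_eq_one] at hrel
    exact hne fun b hb e he => Subgroup.mem_centralizer_iff.mp (hrel he) b hb
  have := Fact.mk hq
  obtain ⟨D, ⟨hDq, hDE, hDB, hDne⟩, hmin⟩ := exists_minimal_of_wellFoundedLT
    (fun D : Subgroup X => IsPGroup q D ∧ D ≤ E ∧ (∀ b ∈ B, ∀ x ∈ D, b * x * b⁻¹ ∈ D) ∧
      ¬ ∀ b ∈ B, ∀ x ∈ D, b * x = x * b) ⟨D₀, hD₀⟩
  have hlt : ∀ C < D, (∀ b ∈ B, ∀ x ∈ C, b * x * b⁻¹ ∈ C) → ∀ b ∈ B, ∀ x ∈ C, b * x = x * b := by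
    intro C hC hCB
    by_contra hno
    exact hC.not_ge (hmin ⟨hDq.to_le hC.le, hC.le.trans hDE, hCB, hno⟩ hC.le)
  have hD' : ∀ b ∈ B, ∀ x ∈ ⁅D, D⁆, b * x = x * b := by
    have hnil : Group.IsNilpotent D := hDq.isNilpotent
    have hnt : Nontrivial D := by
      rw [Subgroup.nontrivial_iff_ne_bot]
      rintro rfl
      refine hDne fun b _ x hx => ?_
      rw [Subgroup.mem_bot.mp hx, mul_one, one_mul]
    refine hlt _ ?_ fun b hb x hx => ?_
    · have h1 := (Subgroup.map_lt_map_iff_of_injective D.subtype_injective).mpr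
        (Group.IsSolvable.commutator_lt_top_of_nontrivial D)
      rwa [Subgroup.map_subtype_commutator, ← MonoidHom.range_eq_map, Subgroup.range_subtype] at h1
    · have hle : D.map (MulAut.conj b).toMonoidHom ≤ D := by
        rintro _ ⟨y, hy, rfl⟩
        exact hDB b hb y hy
      have h1 : b * x * b⁻¹ ∈ ⁅D, D⁆.map (MulAut.conj b).toMonoidHom := ⟨x, hx, rfl⟩
      rw [Subgroup.map_commutator] at h1
      exact Subgroup.commutator_mono hle hle h1
  let B₀ : Subgroup X := B ⊓ Subgroup.centralizer (D : Set X)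
  have hB₀ : ∀ b ∈ B, b ∉ B₀ → ∀ x ∈ D, b * x = x * b → ∀ c ∈ B, c * x = x * c := by
    intro b hb hb0 x hx hbx c hc
    refine hlt (D ⊓ Subgroup.centralizer {b}) (lt_of_le_of_ne inf_le_left fun heq => hb0 ?_) ?_ c hc
      x ⟨hx, Subgroup.mem_centralizer_singleton_iff.mpr hbx.symm⟩
    · refine ⟨hb, Subgroup.mem_centralizer_iff.mpr fun y hy => ?_⟩
      rw [← heq] at hy
      exact Subgroup.mem_centralizer_singleton_iff.mp hy.2
    · rintro d hd y ⟨hy, hyb⟩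
      refine ⟨hDB d hd y hy, Subgroup.mem_centralizer_singleton_iff.mpr ?_⟩
      have h1 : Commute b d := hcomm b hb d hd
      have h2 : Commute b y := (Subgroup.mem_centralizer_singleton_iff.mp hyb).symm
      exact ((h1.mul_right h2).mul_right h1.inv_right).symm
  have hkey : ∀ b ∈ B, b ∉ B₀ → ∀ x ∈ D, x⁻¹ * (b * x * b⁻¹) ∈ ⁅D, D⁆ →
      ∀ c ∈ B, c * x = x * c := by
    intro b hb hb0 x hx hz
    obtain ⟨z, hzdef⟩ : ∃ z, z = x⁻¹ * (b * x * b⁻¹) := ⟨_, rfl⟩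
    rw [← hzdef] at hz
    have hbz : Commute b z := hD' b hb z hz
    have hbx : b * x = x * z * b := by
      rw [hzdef]
      group
    have hpow : ∀ n : ℕ, b ^ n * x = x * z ^ n * b ^ n := by
      intro n
      induction n with
      | zero => simp
      | succ n ih =>
        rw [pow_succ' b, mul_assoc, ih, ← mul_assoc, ← mul_assoc, hbx, mul_assoc (x * z),
          (hbz.pow_right n).eq, pow_succ' z]
        simp only [mul_assoc]
    have hzp := hpow p
    rw [hB b hb, one_mul, mul_one, eq_comm, mul_eq_left] at hzp
    have hzE : z ∈ E := hzdef ▸ mul_mem (inv_mem (hDE hx)) (hBE b hb x (hDE hx))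
    have hz1 : z = 1 := by
      rw [← orderOf_eq_one_iff]
      rcases (Nat.dvd_prime hp.out).mp (orderOf_dvd_of_pow_eq_one hzp) with h1 | h1
      · exact h1
      · exact absurd (h1 ▸ Subgroup.orderOf_dvd_natCard E hzE) hE
    refine hB₀ b hb hb0 x hx ?_
    rw [hbx, hz1, mul_one]
  obtain ⟨B', hB₀B', hB'B, hcard⟩ : ∃ B', B₀ ≤ B' ∧ B' ≤ B ∧ p * Nat.card B' = Nat.card B := by
    obtain ⟨n, hn⟩ := hBp.exists_card_eq
    obtain ⟨m, hm⟩ := (hBp.to_subgroup (B₀.subgroupOf B)).exists_card_eq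
    have hlt : m < n := by
      rw [← Nat.pow_lt_pow_iff_right hp.out.one_lt, ← hm, ← hn]
      refine lt_of_le_of_ne (Subgroup.card_le_card_group _) fun heq => ?_
      have h1 := Subgroup.subgroupOf_eq_top.mp (Subgroup.eq_top_of_card_eq _ heq)
      exact hDne fun b hb x hx => (Subgroup.mem_centralizer_iff.mp (h1 hb).2 x hx).symm
    obtain ⟨K, hK, hle⟩ := Sylow.exists_subgroup_card_pow_prime_le p (m := n - 1)
      (hn ▸ pow_dvd_pow p (Nat.sub_le n 1)) (B₀.subgroupOf B) hm (by lia)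
    refine ⟨K.map B.subtype, fun b hb => ⟨⟨b, hb.1⟩, hle hb, rfl⟩, Subgroup.map_subtype_le _, ?_⟩
    rw [Subgroup.card_map_of_injective B.subtype_injective, hK, hn, ← pow_succ',
      Nat.sub_add_cancel (by lia)]
  obtain ⟨b₁, hb₁, hb₁0⟩ : ∃ b ∈ B', b ∉ B₀ := by
    by_contra! hle
    refine hDne fun b hb x hx => h B' hB'B hcard x (hDE hx) (fun c hc => ?_) b hb
    exact (Subgroup.mem_centralizer_iff.mp (hle c hc).2 x hx).symm
  obtain ⟨b₂, hb₂, hb₂'⟩ : ∃ b ∈ B, b ∉ B' := by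
    by_contra! hle
    rw [le_antisymm hB'B hle] at hcard
    exact hp.out.one_lt.ne' (Nat.eq_of_mul_eq_mul_right Nat.card_pos (hcard.trans (one_mul _).symm))
  let σ := abelianizationAction (conj D hDB)
  have hsur : Function.Surjective (Abelianization.of (G := D)) := QuotientGroup.mk_surjective
  have hσ : ∀ (b : B) (x : D), σ b (Abelianization.of x) = Abelianization.of (conj D hDB b x) :=
    fun _ _ => rfl
  have hmem : ∀ (b : B) (x : D), σ b (Abelianization.of x) = Abelianization.of x →
      (x : X)⁻¹ * (b * x * (b : X)⁻¹) ∈ ⁅D, D⁆ := by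
    intro b x hx
    rw [hσ, eq_comm] at hx
    have h1 := QuotientGroup.eq.mp hx
    rw [← Subgroup.map_subtype_commutator]
    exact ⟨_, h1, rfl⟩
  have hfix : ∀ b : B, (b : X) ∉ B₀ → ∀ w, σ b w = w → w ∈ fixedSubgroup σ := by
    intro b hb w hw c
    obtain ⟨x, rfl⟩ := hsur w
    rw [hσ]
    refine congrArg Abelianization.of (Subtype.ext ?_)
    rw [hconj D hDB, hkey b b.2 hb x x.2 (hmem b x hw) c c.2, mul_inv_cancel_right]
  have hfixed : ∀ w, w ∈ fixedSubgroup σ := by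
    intro w
    have hco : (Nat.card (Abelianization D)).Coprime p := by
      refine ((Nat.Prime.coprime_iff_not_dvd hp.out).mpr fun hd => hE ?_).symm
      exact (hd.trans (Subgroup.card_quotient_dvd_card _)).trans (Subgroup.card_dvd_of_le hDE)
    obtain ⟨v, rfl⟩ := (powCoprime hco).surjective w
    refine pow_mem_fixedSubgroup σ hp.out.pos (fun b => Subtype.ext (hB b b.2))
      (b₁ := ⟨b₁, hB'B hb₁⟩) (b₂ := ⟨b₂, hb₂⟩) (Subtype.ext (hcomm _ (hB'B hb₁) _ hb₂)) ?_ ?_ v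
    · intro k hk0 hkp
      refine hfix _ fun hk => hb₁0 ?_
      obtain ⟨j, -, hj⟩ := Nat.exists_mul_mod_eq_one_of_coprime
        (Nat.coprime_of_lt_prime hk0.ne' hkp hp.out).symm hp.out.one_lt
      have h1 := pow_eq_pow_mod (k * j) (hB b₁ (hB'B hb₁))
      rw [hj, pow_one, pow_mul] at h1
      exact h1.subst (motive := (· ∈ B₀)) (pow_mem hk j)
    · intro i
      refine hfix _ fun hi => hb₂' ?_
      exact (B'.mul_mem_cancel_left (pow_mem hb₁ i)).mp (hB₀B' hi)
  exact hDne fun b hb x hx => hkey b₁ (hB'B hb₁) hb₁0 x hx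
    (hmem ⟨b₁, hB'B hb₁⟩ ⟨x, hx⟩ (hfixed _ _)) b hb

section ElementaryAbelian

variable {X W : Type*} [Group X] [CommGroup W] [Finite W] {p : ℕ} [hp : Fact p.Prime]
  (φ : X →* MulAut W)

theorem eq_one_of_forall_mem_fixedSubgroup (hW : ∀ w : W, w ^ p = 1) {B : Subgroup X}
    (hB : IsPGroup p B) {f : X} (hf : ¬ p ∣ orderOf f) (hfB : ∀ b ∈ B, b * f = f * b)
    (hfix : ∀ w ∈ fixedSubgroup (φ.comp B.subtype), φ f w = w) : φ f = 1 := by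
  obtain ⟨m, hm⟩ : ∃ m, m = orderOf f := ⟨_, rfl⟩
  have hfm : f ^ m = 1 := hm ▸ pow_orderOf_eq_one f
  let N : W →* W :=
    { toFun w := ∏ i ∈ Finset.range m, φ (f ^ i) w
      map_one' := by simp
      map_mul' v w := by simp only [map_mul, Finset.prod_mul_distrib] }
  have hN : ∀ w, N w = ∏ i ∈ Finset.range m, φ (f ^ i) w := fun _ => rfl
  have hcomm : ∀ x, Commute x f → ∀ w, N (φ x w) = φ x (N w) := fun x hx w => by
    rw [hN, hN, map_prod]
    refine Finset.prod_congr rfl fun i _ => ?_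
    rw [← MulAut.mul_apply, ← MulAut.mul_apply, ← map_mul, ← map_mul, (hx.pow_right i).eq]
  have hker : ∀ w, N w = 1 → w = 1 := by
    by_contra! hne
    obtain ⟨w, hw, hw1⟩ := hne
    let _ : MulAction B N.ker :=
      { smul b w := ⟨φ b w, by
          rw [MonoidHom.mem_ker, hcomm b (hfB b b.2), w.2, map_one]⟩
        one_smul w := Subtype.ext (by
          change φ (1 : B) w = (w : W)
          rw [Subgroup.coe_one, map_one]
          rfl)
        mul_smul b c w := Subtype.ext (by
          change φ (b * c : B) w = φ b (φ c w)
          rw [Subgroup.coe_mul, map_mul]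
          rfl) }
    have hdvd : p ∣ Nat.card N.ker := by
      have h1 : orderOf w = p := orderOf_eq_prime (hW w) hw1
      exact h1 ▸ Subgroup.orderOf_dvd_natCard N.ker hw
    obtain ⟨v, hv, hv1⟩ := hB.exists_fixed_point_of_prime_dvd_card_of_fixed_point N.ker hdvd
      (a := 1) (fun b => Subtype.ext (map_one (φ b)))
    have hfv : φ f v = v := hfix v fun b => congrArg Subtype.val (hv b)
    have hpow : ∀ i, φ (f ^ i) v = v := by
      intro i
      induction i with
      | zero => simp
      | succ i ih => rw [pow_succ, map_mul, MulAut.mul_apply, hfv, ih]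
    have hvm : (v : W) ^ m = 1 := by
      have h1 := v.2
      rw [MonoidHom.mem_ker, hN] at h1
      simpa only [hpow, Finset.prod_const, Finset.card_range] using h1
    have hgcd := pow_gcd_eq_one.mpr ⟨hW v, hvm⟩
    rw [hm, Nat.Coprime.gcd_eq_one ((Nat.Prime.coprime_iff_not_dvd hp.out).mpr hf), pow_one] at hgcd
    exact hv1 (Subtype.ext hgcd.symm)
  ext w
  refine mul_inv_eq_one.mp (hker _ ?_)
  rw [map_mul, map_inv, hcomm f rfl, mul_inv_eq_one]
  exact map_prod_pow_eq_self φ hfm w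

theorem card_mul_card_fixedSubgroup_lt [Finite X] (hφ : Function.Injective φ)
    (hX : Odd (Nat.card X)) (hW : ∀ w : W, w ^ p = 1) {A E : Subgroup X} (hA : ∀ a ∈ A, a ^ p = 1)
    (hcomm : ∀ a ∈ A, ∀ b ∈ A, a * b = b * a) (hE : ¬ p ∣ Nat.card E)
    (hAE : ∀ a ∈ A, ∀ e ∈ E, a * e * a⁻¹ ∈ E) (hC : ∀ a ∈ A, (∀ e ∈ E, a * e = e * a) → a = 1)
    (hA1 : A ≠ ⊥) :
    Nat.card A * Nat.card (fixedSubgroup (φ.comp A.subtype)) < Nat.card W := by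
  by_contra! hle
  obtain ⟨B, ⟨hBA, hB1, hB⟩, hmin⟩ := exists_minimal_of_wellFoundedLT
    (fun B : Subgroup X => B ≤ A ∧ B ≠ ⊥ ∧
      Nat.card W ≤ Nat.card B * Nat.card (fixedSubgroup (φ.comp B.subtype))) ⟨A, le_rfl, hA1, hle⟩
  suffices hcB : ∀ b ∈ B, ∀ e ∈ E, b * e = e * b by
    refine hB1 ((Subgroup.eq_bot_iff_forall _).mpr fun b hb => hC b (hBA hb) (hcB b hb))
  have hBE : ∀ b ∈ B, ∀ e ∈ E, e * b * e⁻¹ * b⁻¹ ∈ E := fun b hb e he => by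
    rw [mul_assoc, mul_assoc, ← mul_assoc b]
    exact mul_mem he (hAE b (hBA hb) _ (inv_mem he))
  have hord : ∀ e ∈ E, ¬ p ∣ orderOf e := fun e he hd =>
    hE (hd.trans (Subgroup.orderOf_dvd_natCard E he))
  refine commute_of_forall_card_eq (fun b hb => hA b (hBA hb))
    (fun b hb c hc => hcomm b (hBA hb) c (hBA hc)) hE (fun b hb => hAE b (hBA hb)) ?_
  intro B' hB' hcard e he heB' b hb
  have hmono : fixedSubgroup (φ.comp B.subtype) ≤ fixedSubgroup (φ.comp B'.subtype) :=
    fun w hw c => hw ⟨c, hB' c.2⟩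
  by_cases hB'1 : B' = ⊥
  · rw [hB'1, Subgroup.card_bot, mul_one] at hcard
    let ρ : X →* AddMonoid.End (Additive W) :=
      (monoidEndToAdditive W).toMonoidHom.comp
        ((MulDistribMulAction.toMonoidEnd (MulAut W) W).comp φ)
    have hρ : ∀ x w, ρ x (Additive.ofMul w) = Additive.ofMul (φ x w) := fun _ _ => rfl
    refine (mul_comm_of_card_le (p := p) (V := Additive W) ρ hX hW (fun x y hxy => hφ ?_)
      (hA b (hBA hb)) (hord _ (hBE b hb e he)) ?_).symm
    · ext w
      exact DFunLike.congr_fun hxy (Additive.ofMul w)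
    · refine hB.trans (hcard ▸ Nat.mul_le_mul_left _ ?_)
      refine Nat.card_le_card_of_injective
        (fun w : fixedSubgroup (φ.comp B.subtype) => (⟨Additive.ofMul (w : W), ?_⟩ :
          AddMonoidHom.ker (ρ b - 1))) ?_
      · exact sub_eq_zero.mpr (w.2 ⟨b, hb⟩)
      · intro v w hvw
        have h1 := congrArg Subtype.val hvw
        exact Subtype.ext h1
  · have hlt : Nat.card (fixedSubgroup (φ.comp B'.subtype)) <
        p * Nat.card (fixedSubgroup (φ.comp B.subtype)) := by
      by_contra! hge
      have h1 := hmin ⟨hB'.trans hBA, hB'1, hB.trans ?_⟩ hB'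
      · rw [le_antisymm hB' h1] at hcard
        exact hp.out.one_lt.ne' (Nat.eq_of_mul_eq_mul_right Nat.card_pos
          (hcard.trans (one_mul _).symm))
      · rw [← hcard, mul_comm p, mul_assoc]
        exact Nat.mul_le_mul_left _ hge
    have heq : fixedSubgroup (φ.comp B'.subtype) ≤ fixedSubgroup (φ.comp B.subtype) := by
      have hWp : IsPGroup p (fixedSubgroup (φ.comp B'.subtype)) := fun w => ⟨1, by
        rw [pow_one]
        exact Subtype.ext (hW w)⟩
      obtain ⟨n, hn⟩ := hWp.index ((fixedSubgroup (φ.comp B.subtype)).subgroupOf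
        (fixedSubgroup (φ.comp B'.subtype)))
      have h1 := Subgroup.relIndex_mul_relIndex ⊥ _ _ bot_le hmono
      rw [Subgroup.relIndex_bot_left, Subgroup.relIndex_bot_left, mul_comm] at h1
      rw [← Subgroup.relIndex_eq_one]
      change Subgroup.relIndex _ _ = _ at hn
      rw [← h1] at hlt
      have h2 := Nat.lt_of_mul_lt_mul_right hlt
      rw [hn] at h2 ⊢
      have h3 : n < 1 := (Nat.pow_lt_pow_iff_right hp.out.one_lt).mp (by rwa [pow_one])
      rw [Nat.lt_one_iff.mp h3, pow_zero]
    have hB'p : IsPGroup p B' := fun c => ⟨1, by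
      rw [pow_one]
      exact Subtype.ext (hA c (hBA (hB' c.2)))⟩
    have hf1 : φ (e * b * e⁻¹ * b⁻¹) = 1 := by
      refine eq_one_of_forall_mem_fixedSubgroup φ hW hB'p (hord _ (hBE b hb e he)) ?_ ?_
      · intro c hc
        have h1 : Commute c e := heB' c hc
        have h2 : Commute c b := hcomm c (hBA (hB' hc)) b (hBA hb)
        exact ((h1.mul_right h2).mul_right h1.inv_right).mul_right h2.inv_right
      · intro w hw
        have hb' : ∀ v ∈ fixedSubgroup (φ.comp B'.subtype), φ b⁻¹ v = v := fun v hv =>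
          heq hv ⟨b⁻¹, inv_mem hb⟩
        have hb'' : ∀ v ∈ fixedSubgroup (φ.comp B'.subtype), φ b v = v := fun v hv =>
          heq hv ⟨b, hb⟩
        have he' : φ e⁻¹ w ∈ fixedSubgroup (φ.comp B'.subtype) := fun c => by
          have h1 : Commute (c : X) e⁻¹ := Commute.inv_right (heB' c c.2)
          change φ c (φ e⁻¹ w) = φ e⁻¹ w
          rw [← MulAut.mul_apply, ← map_mul, h1.eq, map_mul, MulAut.mul_apply]
          exact congrArg _ (hw c)
        simp only [map_mul, MulAut.mul_apply]
        rw [hb' w hw, hb'' _ he', ← MulAut.mul_apply, ← map_mul, mul_inv_cancel, map_one]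
        rfl
    have h2 := hφ (hf1.trans (map_one φ).symm)
    rw [mul_inv_eq_one, mul_inv_eq_iff_eq_mul] at h2
    exact h2.symm

end ElementaryAbelian

def IsCharIn {G : Type*} [Group G] (X P : Subgroup G) : Prop :=
  X ≤ P ∧ ∀ (f : MulAut P) (x : P), (x : G) ∈ X → (f x : G) ∈ X

namespace IsCharIn

variable {G H : Type*} [Group G] [Group H]

theorem of_equiv {X P : Subgroup G} {Y Q : Subgroup H} (hY : IsCharIn Y Q) (e : P ≃* Q)
    (hXP : X ≤ P) (he : ∀ x : P, (x : G) ∈ X ↔ (e x : H) ∈ Y) : IsCharIn X P := by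
  refine ⟨hXP, fun f x hx => (he _).mpr ?_⟩
  have h1 := hY.2 ((e.symm.trans f).trans e) (e x) ((he x).mp hx)
  change (e (f (e.symm (e x))) : H) ∈ Y at h1
  rwa [e.symm_apply_apply] at h1

theorem map {X P : Subgroup G} (h : IsCharIn X P) {f : G →* H} (hf : Function.Injective f) :
    IsCharIn (X.map f) (P.map f) := by
  refine h.of_equiv (P.equivMapOfInjective f hf).symm (Subgroup.map_mono h.1) fun x => ?_
  obtain ⟨x, rfl⟩ := (P.equivMapOfInjective f hf).surjective x
  rw [MulEquiv.symm_apply_apply, Subgroup.coe_equivMapOfInjective_apply]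
  exact Subgroup.mem_map_iff_mem hf

theorem normalizer_le {X P : Subgroup G} (h : IsCharIn X P) :
    Subgroup.normalizer (P : Set G) ≤ Subgroup.normalizer (X : Set G) := by
  have h1 : ∀ g ∈ Subgroup.normalizer (P : Set G), ∀ x ∈ X, g * x * g⁻¹ ∈ X := fun g hg x hx =>
    h.2 (P.normalizerMonoidHom ⟨g, hg⟩) ⟨x, h.1 hx⟩ hx
  intro g hg
  refine Subgroup.mem_normalizer_iff.mpr fun x => ⟨h1 g hg x, fun hx => ?_⟩
  have := h1 g⁻¹ (inv_mem hg) _ hx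
  rwa [inv_inv, mul_assoc, inv_mul_cancel_right, ← mul_assoc, inv_mul_cancel, one_mul] at this

theorem normal {X P : Subgroup G} (h : IsCharIn X P) (hP : P.Normal) : X.Normal := by
  rw [← Subgroup.normalizer_eq_top_iff] at hP ⊢
  exact top_le_iff.mp (hP ▸ h.normalizer_le)

end IsCharIn

theorem exists_mul_mem_normalizer {G : Type*} [Group G] [Finite G] {p : ℕ} [hp : Fact p.Prime]
    {M X : Subgroup G} [M.Normal] (hM : ¬ p ∣ Nat.card M) (hX : IsPGroup p X) {g : G}
    (hg : ∀ x ∈ X, g * x * g⁻¹ ∈ X ⊔ M) :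
    ∃ y ∈ X ⊔ M, y * g ∈ Subgroup.normalizer (X : Set G) := by
  have hidx : ¬ p ∣ (X.subgroupOf (X ⊔ M)).index := by
    have h1 := Subgroup.relIndex_mul_relIndex ⊥ X (X ⊔ M) bot_le le_sup_left
    have h2 := Subgroup.relIndex_mul_relIndex ⊥ M (X ⊔ M) bot_le le_sup_right
    have h3 : M.relIndex X ∣ Nat.card X := Subgroup.relIndex_dvd_card M X
    rw [Subgroup.relIndex_bot_left, Subgroup.relIndex_bot_left] at h1 h2
    rw [← h1, Subgroup.relIndex_sup_right, mul_comm] at h2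
    intro h4
    refine hM (h4.trans ?_)
    have h5 := h2 ▸ mul_dvd_mul_right h3 (Nat.card M)
    exact Nat.dvd_of_mul_dvd_mul_left Nat.card_pos h5
  let P : Subgroup ↥(X ⊔ M) := (X.map (MulAut.conj g).toMonoidHom).subgroupOf (X ⊔ M)
  have hP : IsPGroup p P := (hX.map _).comap_subtype
  obtain ⟨y, hy⟩ := hP.exists_conj_mem _ hidx
  refine ⟨y, y.2, Subgroup.mem_normalizer_iff_map_conj_eq.mpr ?_⟩
  refine Subgroup.eq_of_le_of_card_ge ?_ ?_
  · rintro _ ⟨x, hx, rfl⟩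
    have h1 := hy ⟨g * x * g⁻¹, hg x hx⟩ ⟨x, hx, rfl⟩
    have h2 : (y : G) * (g * x * g⁻¹) * (y : G)⁻¹ ∈ X := h1
    change (y : G) * g * x * ((y : G) * g)⁻¹ ∈ X
    simpa only [mul_inv_rev, mul_assoc] using h2
  · exact (Subgroup.card_map_of_injective (MulAut.conj _).injective).ge

def HasPNilpotentNormalizers (p : ℕ) (G : Type*) [Group G] : Prop :=
  ∀ (P : Sylow p G) (X : Subgroup G), IsCharIn X P → X ≠ ⊥ →
    IsPNilpotent p (Subgroup.normalizer (X : Set G))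

theorem HasPNilpotentNormalizers.quotient {G : Type*} [Group G] [Finite G] {p : ℕ}
    [hp : Fact p.Prime] (h : HasPNilpotentNormalizers p G) {M : Subgroup G} [M.Normal]
    (hM : ¬ p ∣ Nat.card M) : HasPNilpotentNormalizers p (G ⧸ M) := by
  intro Q Y hY hY1
  obtain ⟨P, rfl⟩ := Sylow.mapSurjective_surjective (QuotientGroup.mk'_surjective M) p Q
  rw [Sylow.coe_mapSurjective] at hY
  let X := Y.comap (QuotientGroup.mk' M) ⊓ P
  have hXY : X.map (QuotientGroup.mk' M) = Y := by
    refine le_antisymm (Subgroup.map_le_iff_le_comap.mpr inf_le_left) fun y hy => ?_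
    obtain ⟨x, hx, rfl⟩ := hY.1 hy
    exact ⟨x, ⟨hy, hx⟩, rfl⟩
  have hX : IsCharIn X P := by
    refine hY.of_equiv (MulEquiv.ofBijective
      ((QuotientGroup.mk' M).subgroupMap (P : Subgroup G)) ⟨?_, ?_⟩) inf_le_right fun x => ?_
    · rw [injective_iff_map_eq_one]
      intro x hx
      exact Subtype.ext (eq_one_of_mem_of_mem P.2 hM x.2
        ((QuotientGroup.eq_one_iff _).mp (congrArg Subtype.val hx)))
    · exact MonoidHom.subgroupMap_surjective _ _
    · exact and_iff_left x.2
  have hX1 : X ≠ ⊥ := fun h1 => hY1 (by rw [← hXY, h1, Subgroup.map_bot])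
  have hN := h P X hX hX1
  let f : Subgroup.normalizer (X : Set G) →* G ⧸ M :=
    (QuotientGroup.mk' M).comp (Subgroup.normalizer (X : Set G)).subtype
  refine (hN.of_surjective f.rangeRestrict f.rangeRestrict_surjective).of_injective
    (Subgroup.inclusion fun y hy => ?_) (Subgroup.inclusion_injective _)
  obtain ⟨g, rfl⟩ := QuotientGroup.mk'_surjective M y
  have hgm : ∀ x ∈ X, g * x * g⁻¹ ∈ X ⊔ M := fun x hx => by
    have h1 := (Subgroup.mem_normalizer_iff.mp hy _).mp hx.1
    have h2 : g * x * g⁻¹ ∈ (X.map (QuotientGroup.mk' M)).comap (QuotientGroup.mk' M) := by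
      rw [hXY]
      exact h1
    rwa [Subgroup.comap_map_eq, QuotientGroup.ker_mk'] at h2
  obtain ⟨z, hz, hzg⟩ := exists_mul_mem_normalizer hM (P.2.to_le inf_le_right) hgm
  obtain ⟨x, hx, m, hm, rfl⟩ := Subgroup.mem_sup_of_normal_right.mp hz
  refine ⟨⟨m * g, ?_⟩, ?_⟩
  · rw [mul_assoc] at hzg
    exact ((Subgroup.normalizer (X : Set G)).mul_mem_cancel_left (Subgroup.le_normalizer hx)).mp hzg
  · change ((m * g : G) : G ⧸ M) = g
    rw [QuotientGroup.mk_mul, (QuotientGroup.eq_one_iff m).mpr hm, one_mul]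

theorem IsPNilpotent.isPGroup_of_normal {G : Type*} [Group G] [Finite G] {p : ℕ}
    [hp : Fact p.Prime] (hO : ∀ N : Subgroup G, N.Normal → ¬ p ∣ Nat.card N → N = ⊥)
    {N : Subgroup G} [N.Normal] (hN : IsPNilpotent p N) : IsPGroup p N := by
  obtain ⟨K, hK, hKp, n, hn⟩ := hN
  have hc : K.Characteristic := by
    refine Subgroup.characteristic_iff_comap_le.mpr fun φ x hx => ?_
    rw [Subgroup.mem_comap, mem_iff_not_dvd_orderOf hKp hn, MulEquiv.coe_toMonoidHom,
      MulEquiv.orderOf_eq] at hx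
    exact (mem_iff_not_dvd_orderOf hKp hn).mpr hx
  have h1 : K.map N.subtype = ⊥ := hO _ inferInstance
    (by rwa [Subgroup.card_map_of_injective N.subtype_injective])
  rw [Subgroup.map_eq_bot_iff_of_injective _ N.subtype_injective] at h1
  rw [h1, Subgroup.index_bot] at hn
  exact IsPGroup.of_card hn

theorem isPNilpotent_of_le_center {G : Type*} [Group G] [Finite G] {p : ℕ} [hp : Fact p.Prime]
    {U : Subgroup G} (hU : IsPGroup p U) (hc : U ≤ Subgroup.center G) (hi : ¬ p ∣ U.index) :
    IsPNilpotent p G := by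
  obtain ⟨n, hn⟩ := IsPGroup.iff_card.mp hU
  have hUn : U.Normal := ⟨fun x hx g => by
    rwa [Subgroup.mem_center_iff.mp (hc hx) g, mul_inv_cancel_right]⟩
  obtain ⟨K, hK⟩ := Subgroup.exists_right_complement'_of_coprime (N := U)
    (hn ▸ ((hp.out.coprime_iff_not_dvd).mpr hi).pow_left n)
  refine ⟨K, ?_, ?_, n, hK.index_eq_card.trans hn⟩
  · rw [← Subgroup.normalizer_eq_top_iff, ← top_le_iff, ← hK.sup_eq_top]
    refine sup_le (hc.trans ?_) Subgroup.le_normalizer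
    exact (Subgroup.center_le_centralizer (K : Set G)).trans (Subgroup.centralizer_le_normalizer _)
  · rwa [← hK.symm.index_eq_card]

theorem isPNilpotent_centralizer {G : Type*} [Group G] [Finite G] {p n : ℕ} [hp : Fact p.Prime]
    {U E : Subgroup G} [U.Normal] [E.Normal] (hU : IsPGroup p U)
    (hi : ¬ p ∣ U.relIndex E) (hn : E.index = p ^ n) :
    IsPNilpotent p (Subgroup.centralizer (U : Set G)) := by
  obtain ⟨C, hC⟩ : ∃ C, C = Subgroup.centralizer (U : Set G) := ⟨_, rfl⟩
  rw [← hC]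
  have h1 : IsPNilpotent p ↥(E ⊓ C) := by
    refine isPNilpotent_of_le_center (U := U.subgroupOf (E ⊓ C)) hU.comap_subtype ?_ ?_
    · intro x hx
      refine Subgroup.mem_center_iff.mpr fun g => Subtype.ext ?_
      have h2 : (g : G) ∈ Subgroup.centralizer (U : Set G) := hC ▸ g.2.2
      exact (Subgroup.mem_centralizer_iff.mp h2 x hx).symm
    · intro h
      refine hi (h.trans ?_)
      have h2 := Subgroup.index_comap (U.subgroupOf E)
        (Subgroup.inclusion (inf_le_left : E ⊓ C ≤ E))
      have h3 := Subgroup.relIndex_dvd_index_of_normal (U.subgroupOf E)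
        (Subgroup.inclusion (inf_le_left : E ⊓ C ≤ E)).range
      rw [← h2] at h3
      exact h3
  have h2 : E.relIndex C ∣ p ^ n := hn ▸ Subgroup.relIndex_dvd_index_of_normal E C
  obtain ⟨m, -, hm⟩ := (Nat.dvd_prime_pow hp.out).mp h2
  refine IsPNilpotent.of_normal (M := E.subgroupOf C) hm (h1.of_injective
    ((C.subtype.comp (E.subgroupOf C).subtype).codRestrict _ fun x => ⟨x.2, x.1.2⟩) ?_)
  intro x y hxy
  have := congrArg Subtype.val hxy
  exact Subtype.ext (Subtype.ext this)

/-- The elements of order dividing `p` in the centre of `P`. -/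
def omegaCenter {G : Type*} [Group G] (p : ℕ) (P : Subgroup G) : Subgroup G where
  carrier := {x | x ∈ P ∧ (∀ y ∈ P, x * y = y * x) ∧ x ^ p = 1}
  mul_mem' := fun {a b} ha hb => ⟨mul_mem ha.1 hb.1,
    fun y hy => by rw [mul_assoc, hb.2.1 y hy, ← mul_assoc, ha.2.1 y hy, mul_assoc],
    by rw [Commute.mul_pow (ha.2.1 b hb.1), ha.2.2, hb.2.2, one_mul]⟩
  one_mem' := ⟨one_mem P, fun y _ => by rw [one_mul, mul_one], one_pow p⟩
  inv_mem' := fun {a} ha => ⟨inv_mem ha.1,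
    fun y hy => Commute.inv_left (ha.2.1 y hy), by rw [inv_pow, ha.2.2, inv_one]⟩

theorem isCharIn_omegaCenter {G : Type*} [Group G] (p : ℕ) (P : Subgroup G) :
    IsCharIn (omegaCenter p P) P := by
  refine ⟨fun x hx => hx.1, fun f x hx => ⟨(f x).2, fun y hy => ?_, ?_⟩⟩
  · obtain ⟨z, hz⟩ := f.surjective ⟨y, hy⟩
    have h1 : x * z = z * x := Subtype.ext (hx.2.1 z z.2)
    have h2 := congrArg Subtype.val (congrArg f h1)
    rw [map_mul, map_mul, hz] at h2
    exact h2
  · have h1 : x ^ p = 1 := Subtype.ext hx.2.2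
    have h2 := congrArg Subtype.val (congrArg f h1)
    rwa [map_pow, map_one] at h2

theorem omegaCenter_ne_bot {G : Type*} [Group G] [Finite G] {p : ℕ} [hp : Fact p.Prime]
    {P : Subgroup G} (hP : IsPGroup p P) (hP1 : P ≠ ⊥) : omegaCenter p P ≠ ⊥ := by
  have _ := (Subgroup.nontrivial_iff_ne_bot P).mpr hP1
  have _ := hP.center_nontrivial
  have h1 : p ∣ Nat.card (Subgroup.center P) :=
    (IsPGroup.nontrivial_iff_card (hP.to_subgroup _)).mp inferInstance |>.elim fun n hn =>
      hn.2 ▸ dvd_pow_self p hn.1.ne'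
  obtain ⟨x, hx⟩ := exists_prime_orderOf_dvd_card' p h1
  intro h
  have h2 : ((x : P) : G) ∈ omegaCenter p P := by
    refine ⟨x.1.2, fun y hy => ?_, ?_⟩
    · have := congrArg Subtype.val (Subgroup.mem_center_iff.mp x.2 ⟨y, hy⟩)
      exact this.symm
    · have h3 : x ^ p = 1 := hx ▸ pow_orderOf_eq_one x
      exact congrArg (fun z : Subgroup.center P => ((z : P) : G)) h3
  rw [h, Subgroup.mem_bot] at h2
  have h3 : x = 1 := Subtype.ext (Subtype.ext h2)
  rw [h3, orderOf_one] at hx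
  exact hp.out.one_lt.ne hx

/-- Elementary abelian `p`-subgroups. -/
def IsElementaryAbelian {G : Type*} [Group G] (p : ℕ) (A : Subgroup G) : Prop :=
  (∀ a ∈ A, a ^ p = 1) ∧ ∀ a ∈ A, ∀ b ∈ A, a * b = b * a

theorem IsElementaryAbelian.map {G H : Type*} [Group G] [Group H] {p : ℕ} {A : Subgroup G}
    (hA : IsElementaryAbelian p A) (f : G →* H) : IsElementaryAbelian p (A.map f) := by
  constructor
  · rintro _ ⟨a, ha, rfl⟩
    rw [← map_pow, hA.1 a ha, map_one]
  · rintro _ ⟨a, ha, rfl⟩ _ ⟨b, hb, rfl⟩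
    rw [← map_mul, hA.2 a ha b hb, map_mul]

theorem IsElementaryAbelian.sup {G : Type*} [Group G] {p : ℕ} {A B : Subgroup G} [A.Normal]
    (hA : IsElementaryAbelian p A) (hB : IsElementaryAbelian p B)
    (h : ∀ a ∈ A, ∀ b ∈ B, a * b = b * a) : IsElementaryAbelian p (A ⊔ B) := by
  constructor
  · intro x hx
    obtain ⟨a, ha, b, hb, rfl⟩ := Subgroup.mem_sup_of_normal_left.mp hx
    rw [Commute.mul_pow (h a ha b hb), hA.1 a ha, hB.1 b hb, one_mul]
  · intro x hx y hy
    obtain ⟨a, ha, b, hb, rfl⟩ := Subgroup.mem_sup_of_normal_left.mp hx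
    obtain ⟨c, hc, d, hd, rfl⟩ := Subgroup.mem_sup_of_normal_left.mp hy
    have h1 : Commute a c := hA.2 a ha c hc
    have h2 : Commute a d := h a ha d hd
    have h3 : Commute b c := (h c hc b hb).symm
    have h4 : Commute b d := hB.2 b hb d hd
    exact (h1.mul_right h2).mul_left (h3.mul_right h4)

/-- The elementary abelian subgroups of `P` of maximal order. -/
def IsMaxElementaryAbelian {G : Type*} [Group G] (p : ℕ) (P A : Subgroup G) : Prop :=
  A ≤ P ∧ IsElementaryAbelian p A ∧
    ∀ B ≤ P, IsElementaryAbelian p B → Nat.card B ≤ Nat.card A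

theorem exists_isMaxElementaryAbelian {G : Type*} [Group G] [Finite G] (p : ℕ) (P : Subgroup G) :
    ∃ A, IsMaxElementaryAbelian p P A := by
  obtain ⟨A, hA, hm⟩ := Set.exists_max_image {A : Subgroup G | A ≤ P ∧ IsElementaryAbelian p A}
    (fun A => Nat.card A) (Set.toFinite _) ⟨⊥, bot_le, fun a ha => by
      rw [Subgroup.mem_bot.mp ha, one_pow], fun a ha b hb => by
      rw [Subgroup.mem_bot.mp ha, Subgroup.mem_bot.mp hb]⟩
  exact ⟨A, hA.1, hA.2, fun B hB hB1 => hm B ⟨hB, hB1⟩⟩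

theorem IsMaxElementaryAbelian.of_card_eq {G : Type*} [Group G] {p : ℕ} {P A B : Subgroup G}
    (hA : IsMaxElementaryAbelian p P A) (hB : B ≤ P) (hB1 : IsElementaryAbelian p B)
    (h : Nat.card B = Nat.card A) : IsMaxElementaryAbelian p P B :=
  ⟨hB, hB1, fun C hC hC1 => h ▸ hA.2.2 C hC hC1⟩

/-- The Thompson subgroup. -/
def thompsonSubgroup {G : Type*} [Group G] (p : ℕ) (P : Subgroup G) : Subgroup G :=
  sSup {A | IsMaxElementaryAbelian p P A}

theorem isCharIn_thompsonSubgroup {G : Type*} [Group G] (p : ℕ) (P : Subgroup G) :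
    IsCharIn (thompsonSubgroup p P) P := by
  refine ⟨sSup_le fun A hA => hA.1, fun f x hx => ?_⟩
  have h1 : thompsonSubgroup p P ≤
      (((thompsonSubgroup p P).subgroupOf P).comap f.toMonoidHom).map P.subtype := by
    refine sSup_le fun A hA a ha => ?_
    refine ⟨⟨a, hA.1 ha⟩, ?_, rfl⟩
    have h2 : IsMaxElementaryAbelian p P (((A.subgroupOf P).map f.toMonoidHom).map P.subtype) := by
      refine hA.of_card_eq (Subgroup.map_subtype_le _) ?_ ?_
      · refine IsElementaryAbelian.map
          (IsElementaryAbelian.map ⟨fun a ha => ?_, fun a ha b hb => ?_⟩ _) _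
        · exact Subtype.ext (hA.2.1.1 a ha)
        · exact Subtype.ext (hA.2.1.2 a ha b hb)
      · rw [Subgroup.card_map_of_injective P.subtype_injective,
          Subgroup.card_map_of_injective f.injective]
        exact Nat.card_congr (Subgroup.subgroupOfEquivOfLe hA.1).toEquiv
    have h3 : (f ⟨a, hA.1 ha⟩ : G) ∈ ((A.subgroupOf P).map f.toMonoidHom).map P.subtype :=
      ⟨_, ⟨⟨a, hA.1 ha⟩, ha, rfl⟩, rfl⟩
    exact le_sSup (a := ((A.subgroupOf P).map f.toMonoidHom).map P.subtype) h2 h3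
  obtain ⟨y, hy, hyx⟩ := h1 hx
  obtain rfl := Subtype.ext hyx
  exact hy

theorem normal_thompsonSubgroup {G : Type*} [Group G] {p : ℕ} {P U : Subgroup G}
    [hUn : U.Normal] (hUP : U ≤ P) (h : ∀ A, IsMaxElementaryAbelian p P A → A ≤ U) :
    (thompsonSubgroup p P).Normal := by
  refine ⟨fun x hx g => ?_⟩
  have h1 : thompsonSubgroup p P ≤ (thompsonSubgroup p P).comap (MulAut.conj g).toMonoidHom := by
    refine sSup_le fun A hA => Subgroup.map_le_iff_le_comap.mp ?_
    refine le_sSup (a := A.map (MulAut.conj g).toMonoidHom) (hA.of_card_eq ?_ (hA.2.1.map _)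
      (Subgroup.card_map_of_injective (MulAut.conj g).injective))
    rintro _ ⟨a, ha, rfl⟩
    exact hUP (hUn.conj_mem a (h A hA ha) g)
  exact h1 hx

theorem isElementaryAbelian_omegaCenter {G : Type*} [Group G] (p : ℕ) (P : Subgroup G) :
    IsElementaryAbelian p (omegaCenter p P) :=
  ⟨fun _ ha => ha.2.2, fun _ ha b hb => ha.2.1 b hb.1⟩

theorem thompsonSubgroup_ne_bot {G : Type*} [Group G] [Finite G] {p : ℕ} {P B : Subgroup G}
    (hB : B ≤ P) (hB1 : IsElementaryAbelian p B) (h : B ≠ ⊥) : thompsonSubgroup p P ≠ ⊥ := by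
  intro h1
  obtain ⟨A, hA⟩ := exists_isMaxElementaryAbelian p P
  have h2 : A = ⊥ := le_bot_iff.mp (h1 ▸ le_sSup (a := A) hA)
  have h3 := hA.2.2 B hB hB1
  rw [h2, Subgroup.card_bot] at h3
  exact h (Subgroup.eq_bot_of_card_le B h3)

theorem IsPNilpotent.of_isPGroup_top {G : Type*} [Group G] [Finite G] {p : ℕ} [Fact p.Prime]
    (h : IsPGroup p (⊤ : Subgroup G)) : IsPNilpotent p G := by
  obtain ⟨n, hn⟩ := IsPGroup.iff_card.mp h
  refine ⟨⊥, inferInstance, ?_, n, ?_⟩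
  · rw [Subgroup.card_bot]
    exact (Fact.out : p.Prime).not_dvd_one
  · rw [Subgroup.index_bot, ← hn, Subgroup.card_top]

theorem eq_one_of_commute_complement {G : Type*} [Group G] [Finite G] {p n : ℕ}
    [hp : Fact p.Prime] {U : Subgroup G} [U.Normal] (P : Sylow p G) (hUp : IsPGroup p U)
    (hU : ∀ N : Subgroup G, N.Normal → IsPGroup p N → N ≤ U) {K : Subgroup (G ⧸ U)} [K.Normal]
    (hn : K.index = p ^ n) {a : G} (ha : a ∈ P) (hc : ∀ e ∈ K, (a : G ⧸ U) * e = e * a) :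
    (a : G ⧸ U) = 1 := by
  obtain ⟨Q, hQ⟩ : ∃ Q, Q = Subgroup.centralizer (K : Set (G ⧸ U)) ⊓
    (P : Subgroup G).map (QuotientGroup.mk' U) := ⟨_, rfl⟩
  have hPK : (P : Subgroup G).map (QuotientGroup.mk' U) ⊔ K = ⊤ := by
    rw [← Sylow.coe_mapSurjective (QuotientGroup.mk'_surjective U)]
    exact Sylow.sup_eq_top_of_index _ hn
  have hQn : Q.Normal := by
    rw [← Subgroup.normalizer_eq_top_iff, ← top_le_iff, ← hPK]
    refine sup_le (Subgroup.le_normalizer_iff.mpr ?_)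
      (le_trans ?_ (Subgroup.centralizer_le_normalizer _))
    · intro g hg x hx
      rw [hQ] at hx ⊢
      exact ⟨Subgroup.Normal.conj_mem inferInstance x hx.1 g,
        Subgroup.mul_mem _ (Subgroup.mul_mem _ hg hx.2) (Subgroup.inv_mem _ hg)⟩
    · intro e he
      refine Subgroup.mem_centralizer_iff.mpr fun x hx => ?_
      rw [hQ] at hx
      exact (Subgroup.mem_centralizer_iff.mp hx.1 e he).symm
  have hQU := hU (Q.comap (QuotientGroup.mk' U)) inferInstance (P.2.to_le (by
    refine (Subgroup.comap_mono (hQ.trans_le inf_le_right)).trans ?_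
    rw [Subgroup.comap_map_eq, QuotientGroup.ker_mk', sup_of_le_left (hUp.le_sylow_of_normal P)]))
  refine (QuotientGroup.eq_one_iff a).mpr (hQU ?_)
  change (a : G ⧸ U) ∈ Q
  rw [hQ]
  exact ⟨Subgroup.mem_centralizer_iff.mpr fun e he => (hc e he).symm, a, ha, rfl⟩

/-- Thompson's argument: `A` is not contained in `U` unless the Thompson subgroup is normal. -/
theorem IsMaxElementaryAbelian.le_of_isPGroup {G : Type*} [Group G] [Finite G] {p n : ℕ}
    [hp : Fact p.Prime] (hodd : Odd (Nat.card G)) {U V A : Subgroup G} [U.Normal] [V.Normal]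
    (P : Sylow p G) (hUp : IsPGroup p U)
    (hU : ∀ N : Subgroup G, N.Normal → IsPGroup p N → N ≤ U)
    (hV : IsElementaryAbelian p V) (hVU : V ≤ U) (hUV : U = Subgroup.centralizer (V : Set G))
    {K : Subgroup (G ⧸ U)} [K.Normal] (hK : ¬ p ∣ Nat.card K) (hn : K.index = p ^ n)
    (hA : IsMaxElementaryAbelian p P A) : A ≤ U := by
  by_contra hAU
  let _ : CommGroup V :=
    { (inferInstance : Group V) with
      mul_comm := fun x y => Subtype.ext (hV.2 x x.2 y y.2) }
  have hker : ∀ g : G, (MulAut.conjNormal g : MulAut V) = 1 ↔ g ∈ U := by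
    intro g
    rw [hUV, Subgroup.mem_centralizer_iff]
    refine ⟨fun h v hv => ?_, fun h => MulEquiv.ext fun v => Subtype.ext ?_⟩
    · have h1 := congrArg Subtype.val (DFunLike.congr_fun h ⟨v, hv⟩)
      rw [MulAut.conjNormal_apply] at h1
      exact (mul_inv_eq_iff_eq_mul.mp h1).symm
    · rw [MulAut.conjNormal_apply]
      exact mul_inv_eq_iff_eq_mul.mpr (h v v.2).symm
  let φ : G ⧸ U →* MulAut V := QuotientGroup.lift U MulAut.conjNormal fun g hg => (hker g).mpr hg
  have hφ : Function.Injective φ := by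
    rw [injective_iff_map_eq_one]
    intro x
    obtain ⟨g, rfl⟩ := QuotientGroup.mk'_surjective U x
    exact fun h => (QuotientGroup.eq_one_iff g).mpr ((hker g).mp h)
  obtain ⟨A₁, hA₁⟩ : ∃ A₁, A₁ = A.map (QuotientGroup.mk' U) := ⟨_, rfl⟩
  have hA₁e : IsElementaryAbelian p A₁ := hA₁ ▸ hA.2.1.map _
  have hlt := card_mul_card_fixedSubgroup_lt (p := p) φ hφ
    (hodd.of_dvd_nat (Subgroup.card_quotient_dvd_card U))
    (fun w => Subtype.ext (hV.1 w w.2)) (A := A₁) (E := K) hA₁e.1 hA₁e.2 hK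
    (fun a _ e he => Subgroup.Normal.conj_mem inferInstance e he a)
    (by
      rw [hA₁]
      rintro _ ⟨a, ha, rfl⟩ hc
      exact eq_one_of_commute_complement P hUp hU hn (hA.1 ha) hc)
    (by
      rw [hA₁, Ne, Subgroup.map_eq_bot_iff, QuotientGroup.ker_mk']
      exact hAU)
  have hB : IsElementaryAbelian p (V ⊔ (U ⊓ A)) :=
    hV.sup ⟨fun a ha => hA.2.1.1 a ha.2, fun a ha b hb => hA.2.1.2 a ha.2 b hb.2⟩
      fun v hv a ha => Subgroup.mem_centralizer_iff.mp (hUV ▸ ha.1) v hv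
  have hBP : V ⊔ (U ⊓ A) ≤ P :=
    sup_le (hVU.trans (hUp.le_sylow_of_normal P)) (inf_le_right.trans hA.1)
  have h1 := hA.2.2 _ hBP hB
  have h2 : Nat.card A₁ * Nat.card ↥(U ⊓ A) = Nat.card A := by
    rw [hA₁, ← Subgroup.relIndex_ker, QuotientGroup.ker_mk', ← Subgroup.inf_relIndex_right,
      mul_comm, ← Subgroup.relIndex_bot_left, ← Subgroup.relIndex_bot_left]
    exact Subgroup.relIndex_mul_relIndex ⊥ _ _ bot_le inf_le_right
  have h3 : Nat.card V * Nat.card ↥(U ⊓ A) =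
      Nat.card ↥(V ⊔ (U ⊓ A)) * Nat.card ↥(V ⊓ (U ⊓ A)) := by
    have h4 := Subgroup.relIndex_mul_relIndex ⊥ V (V ⊔ (U ⊓ A)) bot_le le_sup_left
    have h5 := Subgroup.relIndex_mul_relIndex ⊥ (V ⊓ (U ⊓ A)) (U ⊓ A) bot_le inf_le_right
    rw [Subgroup.relIndex_bot_left, Subgroup.relIndex_bot_left] at h4 h5
    rw [sup_comm, Subgroup.relIndex_sup_right, sup_comm] at h4
    rw [Subgroup.inf_relIndex_right] at h5
    rw [← h4, ← h5]
    ring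
  have h4 : Nat.card ↥(V ⊓ (U ⊓ A)) ≤ Nat.card (fixedSubgroup (φ.comp A₁.subtype)) := by
    rw [← Subgroup.card_map_of_injective V.subtype_injective]
    refine Subgroup.card_le_of_le fun x hx => ⟨⟨x, hx.1⟩, ?_, rfl⟩
    rintro ⟨b, hb⟩
    rw [hA₁] at hb
    obtain ⟨a, ha, rfl⟩ := hb
    refine Subtype.ext ((MulAut.conjNormal_apply a (⟨x, hx.1⟩ : V)).trans ?_)
    exact mul_inv_eq_iff_eq_mul.mpr (hA.2.1.2 a ha x hx.2.2)
  have h5 : 0 < Nat.card ↥(U ⊓ A) := Nat.card_pos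
  have h6 := Nat.mul_lt_mul_of_pos_right hlt h5
  have h7 := Nat.mul_le_mul (h1.trans_eq h2.symm) h4
  rw [← h3] at h7
  refine (h7.trans_lt (lt_of_eq_of_lt ?_ h6)).false
  ring

theorem isPNilpotent_of_quotient_of_hasPNilpotentNormalizers {G : Type*} [Group G] [Finite G]
    {p : ℕ} [hp : Fact p.Prime] (hodd : Odd (Nat.card G)) {U : Subgroup G} [hUn : U.Normal]
    (hUp : IsPGroup p U) (hU : ∀ N : Subgroup G, N.Normal → IsPGroup p N → N ≤ U)
    (hO : ∀ N : Subgroup G, N.Normal → ¬ p ∣ Nat.card N → N = ⊥)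
    (hq : IsPNilpotent p (G ⧸ U)) (h : HasPNilpotentNormalizers p G) : IsPNilpotent p G := by
  by_contra hG
  obtain ⟨K, hKn, hK, n, hn⟩ := hq
  have hi := Subgroup.index_comap_of_surjective K (QuotientGroup.mk'_surjective U)
  have hUE : U ≤ K.comap (QuotientGroup.mk' U) := by
    intro u hu
    rw [Subgroup.mem_comap, QuotientGroup.mk'_apply, (QuotientGroup.eq_one_iff u).mpr hu]
    exact one_mem K
  have hrel : U.relIndex (K.comap (QuotientGroup.mk' U)) = Nat.card K := by
    have h1 := Subgroup.relIndex_mul_index hUE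
    rw [hi] at h1
    refine Nat.eq_of_mul_eq_mul_right (Nat.pos_of_ne_zero K.index_ne_zero_of_finite) ?_
    rw [h1, K.card_mul_index]
    rfl
  have hC : Subgroup.centralizer (U : Set G) ≤ U :=
    hU _ inferInstance
      ((isPNilpotent_centralizer hUp (hrel ▸ hK) (hi.trans hn)).isPGroup_of_normal hO)
  obtain ⟨P⟩ : Nonempty (Sylow p G) := inferInstance
  have hUP : U ≤ P := hUp.le_sylow_of_normal P
  have hN : ∀ X, IsCharIn X (P : Subgroup G) → X ≠ ⊥ →
      IsPGroup p (Subgroup.normalizer (X : Set G)) := by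
    intro X hX hX1
    obtain ⟨L, -, hL, hsup, hcen⟩ := (h P X hX hX1).exists_complement
    obtain ⟨S⟩ : Nonempty (Sylow p (Subgroup.normalizer (X : Set G))) := inferInstance
    have hUX : U ≤ Subgroup.normalizer (X : Set G) :=
      hUP.trans (Subgroup.le_normalizer.trans hX.normalizer_le)
    have h1 := hcen (U.subgroupOf (Subgroup.normalizer (X : Set G))) inferInstance hUp.comap_subtype
    have h2 : L = ⊥ := by
      refine (Subgroup.eq_bot_iff_forall _).mpr fun x hx => ?_
      have h3 : (x : G) ∈ U := hC (Subgroup.mem_centralizer_iff.mpr fun u hu =>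
        congrArg Subtype.val (Subgroup.mem_centralizer_iff.mp (h1 hx) ⟨u, hUX hu⟩ hu))
      exact eq_one_of_mem_of_mem (hUp.comap_subtype (K := Subgroup.normalizer (X : Set G)))
        hL h3 hx
    have h3 := hsup S
    rw [h2, sup_bot_eq] at h3
    have h4 := S.2
    rw [h3] at h4
    exact h4.of_equiv Subgroup.topEquiv
  have hnn : ∀ X, IsCharIn X (P : Subgroup G) → X ≠ ⊥ → ¬ X.Normal := by
    intro X hX hX1 hXn
    have h1 := hN X hX hX1
    rw [Subgroup.normalizer_eq_top_iff.mpr hXn] at h1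
    exact hG (IsPNilpotent.of_isPGroup_top h1)
  have hP1 : (P : Subgroup G) ≠ ⊥ := by
    by_cases hd : p ∣ Nat.card G
    · exact P.ne_bot_of_dvd_card hd
    · exact absurd (IsPNilpotent.of_not_dvd hd) hG
  have hZ := omegaCenter_ne_bot P.2 hP1
  have hVn : (omegaCenter p U).Normal := (isCharIn_omegaCenter p U).normal hUn
  have hZV : omegaCenter p (P : Subgroup G) ≤ omegaCenter p U := fun x hx =>
    ⟨hC (Subgroup.mem_centralizer_iff.mpr fun u hu => (hx.2.1 u (hUP hu)).symm),
      fun u hu => hx.2.1 u (hUP hu), hx.2.2⟩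
  have hUV : U = Subgroup.centralizer (omegaCenter p U : Set G) := by
    refine le_antisymm (fun u hu => Subgroup.mem_centralizer_iff.mpr fun v hv => hv.2.1 u hu) ?_
    refine hU _ inferInstance ((hN _ (isCharIn_omegaCenter p (P : Subgroup G)) hZ).to_le ?_)
    exact (Subgroup.centralizer_le hZV).trans (Subgroup.centralizer_le_normalizer _)
  refine hnn _ (isCharIn_thompsonSubgroup p (P : Subgroup G))
    (thompsonSubgroup_ne_bot (isCharIn_omegaCenter p (P : Subgroup G)).1
      (isElementaryAbelian_omegaCenter p _) hZ) (normal_thompsonSubgroup hUP fun A hA => ?_)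
  exact hA.le_of_isPGroup hodd P hUp hU (isElementaryAbelian_omegaCenter p U)
    (fun v hv => hv.1) hUV hK hn

section

universe u

open MonoidHom (FixedPointFree)

section

variable {G : Type u} [Group G] [Finite G] {p : ℕ} [hp : Fact p.Prime]

theorem hasPNilpotentNormalizers_normalizer (h : HasPNilpotentNormalizers p G) {U : Subgroup G}
    (hm : ∀ X : Subgroup G, X ≠ ⊥ → IsPGroup p X →
      (Nat.card (Subgroup.normalizer (U : Set G))).factorization p <
        (Nat.card (Subgroup.normalizer (X : Set G))).factorization p →
      IsPNilpotent p (Subgroup.normalizer (X : Set G))) :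
    HasPNilpotentNormalizers p (Subgroup.normalizer (U : Set G)) := by
  intro S X hX hX1
  obtain ⟨N, hN⟩ : ∃ N, N = Subgroup.normalizer (U : Set G) := ⟨_, rfl⟩
  subst hN
  have hX2 := hX.map (Subgroup.normalizer (U : Set G)).subtype_injective
  have hX3 : X.map (Subgroup.normalizer (U : Set G)).subtype ≠ ⊥ := fun h1 =>
    hX1 ((Subgroup.map_eq_bot_iff_of_injective _
      (Subgroup.normalizer (U : Set G)).subtype_injective).mp h1)
  refine IsPNilpotent.normalizer_of_map (Subgroup.normalizer (U : Set G)).subtype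
    (Subgroup.normalizer (U : Set G)).subtype_injective ?_
  have hS : IsPGroup p ((S : Subgroup (Subgroup.normalizer (U : Set G))).map
    (Subgroup.normalizer (U : Set G)).subtype) := S.2.map _
  obtain ⟨Q, hQ⟩ := hS.exists_le_sylow
  obtain hSQ | hSQ := hQ.eq_or_lt
  · exact h Q _ (hSQ ▸ hX2) hX3
  · refine hm _ hX3 (hS.to_le hX2.1) ?_
    have h1 := Q.2.lt_inf_normalizer hSQ
    obtain ⟨t, ht⟩ := IsPGroup.iff_card.mp (Q.2.to_le (inf_le_left :
      (Q : Subgroup G) ⊓ Subgroup.normalizer (((S : Subgroup (Subgroup.normalizer (U : Set G))).map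
        (Subgroup.normalizer (U : Set G)).subtype : Subgroup G) : Set G) ≤ Q))
    have h2 := Set.Finite.card_lt_card (Set.toFinite _) (SetLike.coe_ssubset_coe.mpr h1)
    have h3 := Subgroup.card_dvd_of_le ((inf_le_right : (Q : Subgroup G) ⊓ _ ≤ _).trans
      hX2.normalizer_le)
    have h4 : Nat.card ((S : Subgroup (Subgroup.normalizer (U : Set G))).map
        (Subgroup.normalizer (U : Set G)).subtype) < Nat.card ↥((Q : Subgroup G) ⊓
      Subgroup.normalizer (((S : Subgroup (Subgroup.normalizer (U : Set G))).map
        (Subgroup.normalizer (U : Set G)).subtype : Subgroup G) : Set G)) := h2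
    rw [ht, Subgroup.card_map_of_injective (Subgroup.normalizer (U : Set G)).subtype_injective,
      S.card_eq_multiplicity] at h4
    rw [ht] at h3
    exact ((Nat.pow_lt_pow_iff_right hp.out.one_lt).mp h4).trans_le
      ((hp.out.pow_dvd_iff_le_factorization Nat.card_pos.ne').mp h3)

theorem hasPNilpotentNormalizers_quotient_of_isPGroup {U : Subgroup G} [U.Normal]
    (hU : IsPGroup p U)
    (hm : ∀ X : Subgroup G, X ≠ ⊥ → IsPGroup p X →
      (Nat.card G).factorization p ≤ (Nat.card (Subgroup.normalizer (X : Set G))).factorization p →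
      Nat.card U < Nat.card X → IsPNilpotent p (Subgroup.normalizer (X : Set G))) :
    HasPNilpotentNormalizers p (G ⧸ U) := by
  intro Q Y hY hY1
  obtain ⟨P, rfl⟩ := Sylow.mapSurjective_surjective (QuotientGroup.mk'_surjective U) p Q
  have hYn := hY.normalizer_le
  have hYP := hY.1
  rw [Sylow.coe_mapSurjective] at hYn hYP
  have hXP : Y.comap (QuotientGroup.mk' U) ≤ P := by
    refine (Subgroup.comap_mono hYP).trans ?_
    rw [Subgroup.comap_map_eq, QuotientGroup.ker_mk', sup_of_le_left (hU.le_sylow_of_normal P)]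
  have hNX := Subgroup.comap_normalizer_eq_of_surjective Y (QuotientGroup.mk'_surjective U)
  have hUX : U < Y.comap (QuotientGroup.mk' U) := by
    refine lt_of_le_of_ne (fun u hu => ?_) fun h1 => hY1 ?_
    · rw [Subgroup.mem_comap, QuotientGroup.mk'_apply, (QuotientGroup.eq_one_iff u).mpr hu]
      exact one_mem Y
    · refine (Subgroup.eq_bot_iff_forall _).mpr fun y hy => ?_
      obtain ⟨x, rfl⟩ := QuotientGroup.mk'_surjective U y
      exact (QuotientGroup.eq_one_iff x).mpr (h1 ▸ hy)
  have hPN : (P : Subgroup G) ≤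
      Subgroup.normalizer ((Y.comap (QuotientGroup.mk' U) : Subgroup G) : Set G) := by
    rw [← hNX]
    exact fun x hx => hYn (Subgroup.le_normalizer ⟨x, hx, rfl⟩)
  have hN := hm (Y.comap (QuotientGroup.mk' U)) (bot_le.trans_lt hUX).ne' (P.2.to_le hXP)
    (by
      have h1 := Subgroup.card_dvd_of_le hPN
      rw [P.card_eq_multiplicity] at h1
      exact (hp.out.pow_dvd_iff_le_factorization Nat.card_pos.ne').mp h1)
    (Set.Finite.card_lt_card (Set.toFinite _) (SetLike.coe_ssubset_coe.mpr hUX))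
  rw [← hNX] at hN
  let f : (Subgroup.normalizer (Y : Set (G ⧸ U))).comap (QuotientGroup.mk' U) →* G ⧸ U :=
    (QuotientGroup.mk' U).comp (Subgroup.subtype _)
  refine (hN.of_surjective f.rangeRestrict f.rangeRestrict_surjective).of_injective
    (Subgroup.inclusion fun y hy => ?_) (Subgroup.inclusion_injective _)
  obtain ⟨g, rfl⟩ := QuotientGroup.mk'_surjective U y
  exact ⟨⟨g, hy⟩, rfl⟩

end

/-- Thompson's normal `p`-complement criterion for groups of odd order. -/
theorem isPNilpotent_of_hasPNilpotentNormalizers {p : ℕ} [hp : Fact p.Prime] :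
    ∀ (n : ℕ) (G : Type u) [Group G] [Finite G], Nat.card G = n → Odd (Nat.card G) →
      HasPNilpotentNormalizers p G → IsPNilpotent p G := by
  intro n
  induction n using Nat.strong_induction_on with
  | _ n ih =>
  intro G _ _ hn hodd h
  subst hn
  by_contra hG
  have hne : ∃ U : Subgroup G, U ≠ ⊥ ∧ IsPGroup p U ∧
      ¬ IsPNilpotent p (Subgroup.normalizer (U : Set G)) := by
    by_contra! hcon
    exact hG (isPNilpotent_of_normalizer hcon)
  obtain ⟨U, ⟨hU1, hUp, hUn⟩, hmax⟩ := Set.exists_max_image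
    {U : Subgroup G | U ≠ ⊥ ∧ IsPGroup p U ∧ ¬ IsPNilpotent p (Subgroup.normalizer (U : Set G))}
    (fun U => toLex ((Nat.card (Subgroup.normalizer (U : Set G))).factorization p, Nat.card U))
    (Set.toFinite _) hne
  have hm : ∀ X : Subgroup G, X ≠ ⊥ → IsPGroup p X →
      toLex ((Nat.card (Subgroup.normalizer (U : Set G))).factorization p, Nat.card U) <
      toLex ((Nat.card (Subgroup.normalizer (X : Set G))).factorization p, Nat.card X) →
      IsPNilpotent p (Subgroup.normalizer (X : Set G)) := fun X hX1 hXp hlt =>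
    by_contra fun hX => (hmax X ⟨hX1, hXp, hX⟩).not_gt hlt
  have hN : Subgroup.normalizer (U : Set G) = ⊤ := by
    by_contra hN
    refine hUn (ih _ (lt_of_le_of_ne (Subgroup.card_le_card_group _) fun h1 =>
      hN (Subgroup.eq_top_of_card_eq _ h1)) _ rfl
      (hodd.of_dvd_nat (Subgroup.card_subgroup_dvd_card _))
      (hasPNilpotentNormalizers_normalizer h fun X hX1 hXp hlt => hm X hX1 hXp ?_))
    exact Prod.Lex.toLex_lt_toLex.mpr (Or.inl hlt)
  have hUnormal := Subgroup.normalizer_eq_top_iff.mp hN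
  have hcard : Nat.card (Subgroup.normalizer (U : Set G)) = Nat.card G := by
    rw [hN, Subgroup.card_top]
  rw [hcard] at hm
  have hm2 : ∀ X : Subgroup G, X ≠ ⊥ → IsPGroup p X →
      (Nat.card G).factorization p ≤ (Nat.card (Subgroup.normalizer (X : Set G))).factorization p →
      Nat.card U < Nat.card X → IsPNilpotent p (Subgroup.normalizer (X : Set G)) := by
    intro X hX1 hXp hle hlt
    refine hm X hX1 hXp (Prod.Lex.toLex_lt_toLex.mpr ?_)
    obtain h1 | h1 := hle.lt_or_eq
    · exact Or.inl h1
    · exact Or.inr ⟨h1, hlt⟩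
  have hlt : ∀ M : Subgroup G, M ≠ ⊥ → Nat.card (G ⧸ M) < Nat.card G := by
    intro M hM
    have h1 := Subgroup.card_eq_card_quotient_mul_card_subgroup M
    have h2 := Subgroup.one_lt_card_iff_ne_bot M |>.mpr hM
    have h3 : 0 < Nat.card (G ⧸ M) := Nat.card_pos
    rw [h1]
    exact lt_mul_of_one_lt_right h3 h2
  refine hG (isPNilpotent_of_quotient_of_hasPNilpotentNormalizers hodd hUp (fun M hM hMp => ?_)
    (fun M hM hMp => ?_) (ih _ (hlt U hU1) _ rfl
      (hodd.of_dvd_nat (Subgroup.card_quotient_dvd_card U))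
      (hasPNilpotentNormalizers_quotient_of_isPGroup hUp hm2)) h)
  · by_contra hMU
    have h1 : U < M ⊔ U := lt_of_le_of_ne le_sup_right fun h1 => hMU (h1 ▸ le_sup_left)
    have h2 : (M ⊔ U).Normal := Subgroup.sup_normal M U
    have h3 := hm2 (M ⊔ U) (bot_le.trans_lt h1).ne' (hMp.to_sup_of_normal_right hUp)
      (by rw [Subgroup.normalizer_eq_top_iff.mpr h2, Subgroup.card_top])
      (Set.Finite.card_lt_card (Set.toFinite _) (SetLike.coe_ssubset_coe.mpr h1))
    rw [Subgroup.normalizer_eq_top_iff.mpr h2] at h3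
    exact hG (h3.of_injective (Subgroup.topEquiv (G := G)).symm.toMonoidHom
      (Subgroup.topEquiv (G := G)).symm.injective)
  · by_contra hM1
    exact hG (IsPNilpotent.of_quotient hMp (ih _ (hlt M hM1) _ rfl
      (hodd.of_dvd_nat (Subgroup.card_quotient_dvd_card M)) (h.quotient hMp)))

theorem Group.IsNilpotent.isPNilpotent {N : Type*} [Group N] [Finite N]
    (hN : Group.IsNilpotent N) (p : ℕ) [hp : Fact p.Prime] : IsPNilpotent p N := by
  obtain ⟨P⟩ : Nonempty (Sylow p N) := inferInstance
  have hP := hN.sylow_normal p P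
  have hC : ∀ q, q.Prime → q ≠ p → ¬ q ∣ (Subgroup.centralizer (P : Set N)).index := by
    intro q hq hqp h
    have := Fact.mk hq
    obtain ⟨Q⟩ : Nonempty (Sylow q N) := inferInstance
    refine Q.not_dvd_index (h.trans (Subgroup.index_dvd_of_le fun x hx => ?_))
    exact Subgroup.mem_centralizer_iff.mpr fun y hy =>
      Subgroup.commute_of_normal_of_disjoint _ _ hP (hN.sylow_normal q Q)
        (IsPGroup.disjoint_of_ne p q hqp.symm _ _ P.2 Q.2) y x hy hx
  obtain ⟨n, hn⟩ := IsPGroup.iff_card.mp P.2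
  obtain ⟨K, hK⟩ := Subgroup.exists_right_complement'_of_coprime (N := (P : Subgroup N))
    (hn ▸ ((hp.out.coprime_iff_not_dvd).mpr P.not_dvd_index).pow_left n)
  have hKp : ¬ p ∣ Nat.card K := hK.symm.index_eq_card ▸ P.not_dvd_index
  have hKC : K ≤ Subgroup.centralizer (P : Set N) := by
    refine Subgroup.relIndex_eq_one.mp (Nat.eq_one_iff_not_exists_prime_dvd.mpr fun q hq h => ?_)
    by_cases hqp : q = p
    · exact hKp (hqp ▸ h.trans (Subgroup.relIndex_dvd_card _ K))
    · have h1 : (Subgroup.centralizer (P : Set N)).Normal :=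
        Subgroup.normal_centralizer (H := (P : Subgroup N))
      exact hC q hq hqp (h.trans (Subgroup.relIndex_dvd_index_of_normal _ K))
  refine ⟨K, ?_, hKp, n, hK.index_eq_card.trans hn⟩
  rw [← Subgroup.normalizer_eq_top_iff, ← top_le_iff, ← hK.sup_eq_top]
  exact sup_le ((Subgroup.le_centralizer_iff.mp hKC).trans
    (Subgroup.centralizer_le_normalizer _)) Subgroup.le_normalizer

theorem HasPNilpotentNormalizers.of_sylow {G : Type*} [Group G] [Finite G] {p : ℕ}
    [hp : Fact p.Prime] (P : Sylow p G) (h : ∀ X, IsCharIn X (P : Subgroup G) → X ≠ ⊥ →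
      IsPNilpotent p (Subgroup.normalizer (X : Set G))) : HasPNilpotentNormalizers p G := by
  intro Q X hX hX1
  obtain ⟨g, rfl⟩ := MulAction.exists_smul_eq G Q P
  have hX2 := hX.map (MulAut.conj g).injective (f := (MulAut.conj g).toMonoidHom)
  refine IsPNilpotent.normalizer_of_map (MulAut.conj g).toMonoidHom (MulAut.conj g).injective
    (h _ hX2 fun h1 => hX1 ?_)
  exact (Subgroup.map_eq_bot_iff_of_injective _ (MulAut.conj g).injective).mp h1

theorem IsPNilpotent.exists_le_comap {G : Type*} [Group G] [Finite G] {p : ℕ} [hp : Fact p.Prime]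
    (hG : IsPNilpotent p G) {α : G →* G} (hα : Function.Injective α) :
    ∃ K : Subgroup G, K.Normal ∧ (∀ x ∈ K, α x ∈ K) ∧ ¬ p ∣ Nat.card K ∧ ∃ n, K.index = p ^ n := by
  obtain ⟨K, hKn, hK, n, hn⟩ := hG
  refine ⟨K, hKn, fun x hx => ?_, hK, n, hn⟩
  rw [mem_iff_not_dvd_orderOf hK hn] at hx ⊢
  rwa [orderOf_injective α hα]

section

variable {L : Type*} [Group L] {r : ℕ} {α : L →* L}

theorem iterate_codRestrict_eq_id (hαr : α^[r] = id) {N : Subgroup L} (hN : ∀ x ∈ N, α x ∈ N) :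
    ((α.comp N.subtype).codRestrict N fun y => hN y y.2)^[r] = id := by
  funext x
  exact Subtype.ext ((MonoidHom.coe_codRestrict_iterate hN r x).trans (by rw [hαr]; rfl))

theorem fixedPointFree_codRestrict (hα : FixedPointFree α) {N : Subgroup L}
    (hN : ∀ x ∈ N, α x ∈ N) :
    FixedPointFree ((α.comp N.subtype).codRestrict N fun y => hN y y.2) :=
  fun x hx => Subtype.ext (hα x (congrArg Subtype.val hx))

theorem iterate_quotientMap_eq_id (hαr : α^[r] = id) {N : Subgroup L} [N.Normal]
    (hN : N ≤ N.comap α) : (QuotientGroup.map N N α hN)^[r] = id := by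
  funext x
  obtain ⟨x, rfl⟩ := QuotientGroup.mk'_surjective N x
  have h : Function.Semiconj (QuotientGroup.mk' N) α (QuotientGroup.map N N α hN) := fun x => rfl
  rw [← h.iterate_right r x, hαr]
  rfl

/-- The restriction of an injective endomorphism to a finite invariant subgroup. -/
def MonoidHom.restrictMulAut [Finite L] (hα : Function.Injective α) {P : Subgroup L}
    (hP : ∀ x ∈ P, α x ∈ P) : MulAut P :=
  MulEquiv.ofBijective ((α.comp P.subtype).codRestrict P fun y => hP y y.2)
    (Finite.injective_iff_bijective.mp fun _ _ h => Subtype.ext (hα (congrArg Subtype.val h)))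

theorem IsCharIn.map_mem [Finite L] {X P : Subgroup L} (hX : IsCharIn X P)
    (hα : Function.Injective α) (hP : ∀ x ∈ P, α x ∈ P) : ∀ x ∈ X, α x ∈ X := fun x hx =>
  hX.2 (MonoidHom.restrictMulAut hα hP) ⟨x, hX.1 hx⟩ hx

theorem map_mem_normalizer [Finite L] {X : Subgroup L} (hα : Function.Injective α)
    (hX : ∀ x ∈ X, α x ∈ X) :
    ∀ g ∈ Subgroup.normalizer (X : Set L), α g ∈ Subgroup.normalizer (X : Set L) := by
  have h1 : X.map α = X := by
    refine Subgroup.eq_of_le_of_card_ge (Subgroup.map_le_iff_le_comap.mpr hX) ?_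
    rw [Subgroup.card_map_of_injective hα]
  intro g hg
  have h2 := Subgroup.le_normalizer_map (H := X) α
    (Subgroup.mem_map_of_mem α hg)
  rwa [h1] at h2

theorem isNilpotent_of_isPGroup_top {G : Type*} [Group G] [Finite G] {p : ℕ} [Fact p.Prime]
    {P : Subgroup G} (hP : IsPGroup p P) (h : P = ⊤) : Group.IsNilpotent G := by
  subst h
  exact IsPGroup.isNilpotent (hP.of_equiv Subgroup.topEquiv)

end

/-- Thompson: an odd group with a fixed-point-free automorphism of prime order is nilpotent. -/
theorem isNilpotent_of_odd_of_fixedPointFree {r : ℕ} [hr : Fact r.Prime] :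
    ∀ (n : ℕ) (L : Type u) [Group L] [Finite L], Nat.card L = n → Odd (Nat.card L) →
      ∀ α : L →* L, α^[r] = id → FixedPointFree α → Group.IsNilpotent L := by
  intro n
  induction n using Nat.strong_induction_on with
  | _ n ih =>
  intro L _ _ hn hodd α hαr hα
  subst hn
  have hinj : Function.Injective α := injective_of_iterate_eq_id hαr
  have hsub : ∀ N : Subgroup L, (∀ x ∈ N, α x ∈ N) → N ≠ ⊤ → Group.IsNilpotent N := by
    intro N hN hN1
    exact ih _ (lt_of_le_of_ne (Subgroup.card_le_card_group _) fun h1 =>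
      hN1 (Subgroup.eq_top_of_card_eq _ h1)) _ rfl
      (hodd.of_dvd_nat (Subgroup.card_subgroup_dvd_card _)) _
      (iterate_codRestrict_eq_id hαr hN) (fixedPointFree_codRestrict hα hN)
  by_cases hN : ∃ N : Subgroup L, N.Normal ∧ (∀ x ∈ N, α x ∈ N) ∧ N ≠ ⊥ ∧ N ≠ ⊤
  · obtain ⟨N, hNn, hNα, hN1, hN2⟩ := hN
    have h1 := hsub N hNα hN2
    have hlt : Nat.card (L ⧸ N) < Nat.card L := by
      have h2 := N.one_lt_card_iff_ne_bot.mpr hN1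
      have h3 : 0 < Nat.card (L ⧸ N) := Nat.card_pos
      rw [Subgroup.card_eq_card_quotient_mul_card_subgroup N]
      exact lt_mul_of_one_lt_right h3 h2
    have h2 : Group.IsNilpotent (L ⧸ N) := ih _ hlt _ rfl
      (hodd.of_dvd_nat (Subgroup.card_quotient_dvd_card N)) (QuotientGroup.map N N α hNα)
      (iterate_quotientMap_eq_id hαr hNα) (hα.quotient hNα)
    exact isNilpotent_of_isSolvable_of_fixedPointFree
      (Group.isSolvable_of_ker_le_range N.subtype (QuotientGroup.mk' N)
        (by rw [QuotientGroup.ker_mk', Subgroup.range_subtype])) hαr hα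
  · push Not at hN
    rcases subsingleton_or_nontrivial L with h | h
    · infer_instance
    obtain ⟨p, hp, hpL⟩ := Nat.exists_prime_and_dvd (Finite.one_lt_card (α := L)).ne'
    have := Fact.mk hp
    obtain ⟨P, hP⟩ := exists_sylow_invariant hαr (hα.not_dvd_card hαr) p
    by_cases hPtop : (P : Subgroup L) = ⊤
    · exact isNilpotent_of_isPGroup_top P.2 hPtop
    have hpn : IsPNilpotent p L := by
      refine isPNilpotent_of_hasPNilpotentNormalizers _ L rfl hodd
        (HasPNilpotentNormalizers.of_sylow P fun X hX hX1 => ?_)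
      have hXα := hX.map_mem hinj hP
      refine (hsub _ (map_mem_normalizer hinj hXα) fun h1 => hPtop ?_).isPNilpotent p
      exact top_le_iff.mp ((hN X (Subgroup.normalizer_eq_top_iff.mp h1) hXα hX1).ge.trans hX.1)
    obtain ⟨K, hKn, hKα, hKp, n, hn⟩ := hpn.exists_le_comap hinj
    by_cases hK : K = ⊥
    · rw [hK, Subgroup.index_bot] at hn
      exact (IsPGroup.of_card hn).isNilpotent
    · rw [hN K hKn hKα hK, Subgroup.card_top] at hKp
      exact absurd hpL hKp

theorem isSolvable_of_odd_index {L : Type*} [Group L] [Finite L] {r : ℕ} [Fact r.Prime]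
    {α : L →* L} (hαr : α^[r] = id) (hα : FixedPointFree α) {A : Subgroup L} [A.Normal]
    (hA : ∀ x ∈ A, α x ∈ A) (hs : Group.IsSolvable A) (hodd : Odd A.index) :
    Group.IsSolvable L := by
  have h := isNilpotent_of_odd_of_fixedPointFree (r := r) _ (L ⧸ A) rfl hodd
    (QuotientGroup.map A A α hA) (iterate_quotientMap_eq_id hαr hA) (hα.quotient hA)
  exact Group.isSolvable_of_ker_le_range A.subtype (QuotientGroup.mk' A)
    (by rw [QuotientGroup.ker_mk', Subgroup.range_subtype])

theorem isSolvable_sup {G : Type*} [Group G] {N M : Subgroup G} [N.Normal]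
    (hN : Group.IsSolvable N) (hM : Group.IsSolvable M) : Group.IsSolvable ↥(N ⊔ M) := by
  have h1 : Group.IsSolvable (M.map (QuotientGroup.mk' N)) :=
    Group.isSolvable_of_surjective ((QuotientGroup.mk' N).subgroupMap_surjective M)
  have h2 : ∀ x : ↥(N ⊔ M), QuotientGroup.mk' N x ∈ M.map (QuotientGroup.mk' N) := by
    rintro ⟨x, hx⟩
    obtain ⟨n, hn, m, hm, rfl⟩ := Subgroup.mem_sup_of_normal_left.mp hx
    refine ⟨m, hm, ?_⟩
    change (m : G ⧸ N) = ((n * m : G) : G ⧸ N)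
    rw [QuotientGroup.mk_mul, (QuotientGroup.eq_one_iff n).mpr hn, one_mul]
  refine Group.isSolvable_of_ker_le_range (Subgroup.inclusion (le_sup_left : N ≤ N ⊔ M))
    (((QuotientGroup.mk' N).comp (N ⊔ M).subtype).codRestrict _ h2) fun x hx => ?_
  exact ⟨⟨x, (QuotientGroup.eq_one_iff (x : G)).mp (congrArg Subtype.val hx)⟩, rfl⟩

theorem isSolvable_fitting (G : Type) [Group G] [Finite G] : Group.IsSolvable (Fitting G) := by
  obtain ⟨R, ⟨hRn, hRs⟩, hmax⟩ := Set.exists_max_image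
    {R : Subgroup G | R.Normal ∧ Group.IsSolvable R} (fun R => Nat.card R) (Set.toFinite _)
    ⟨⊥, inferInstance, inferInstance⟩
  have hle : Fitting G ≤ R := by
    refine iSup₂_le fun H hH => ?_
    obtain ⟨hHn, hHnil⟩ := hH
    have h1 := hmax (R ⊔ H) ⟨Subgroup.sup_normal R H, isSolvable_sup hRs inferInstance⟩
    have h2 := Subgroup.eq_of_le_of_card_ge (le_sup_left : R ≤ R ⊔ H) h1
    exact h2 ▸ le_sup_right
  exact Group.isSolvable_of_isSolvable_injective (Subgroup.inclusion_injective hle)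

theorem normal_fitting (G : Type) [Group G] : (Fitting G).Normal := by
  refine ⟨fun x hx g => ?_⟩
  have h : Fitting G ≤ (Fitting G).comap (MulAut.conj g).toMonoidHom :=
    iSup₂_le fun H hH y hy => Subgroup.mem_iSup_of_mem H (Subgroup.mem_iSup_of_mem hH
      (hH.1.conj_mem y hy g))
  exact h hx

theorem IsSupersolvable.isSolvable {G : Type} [Group G] (h : IsSupersolvable G) :
    Group.IsSolvable G := by
  obtain ⟨n, c, h0, hn, -, hnormal, hcyc⟩ := h
  have h1 : ∀ i, Group.IsSolvable (c i) := by
    intro i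
    induction i using Fin.induction with
    | zero =>
      rw [h0]
      infer_instance
    | succ i hi =>
      obtain ⟨g, hg⟩ := hcyc i
      rw [← hg]
      have := hnormal i.castSucc
      refine isSolvable_sup hi (Group.isSolvable_of_comm fun x y => ?_)
      obtain ⟨⟨_, m, rfl⟩, ⟨_, k, rfl⟩⟩ := x, y
      exact Subtype.ext (zpow_mul_comm g m k)
  have h2 := h1 (Fin.last n)
  rw [hn] at h2
  exact Group.isSolvable_of_surjective (Subgroup.topEquiv (G := G)).surjective
    (f := (Subgroup.topEquiv (G := G)).toMonoidHom)

theorem conjNormal_iterate_eq_id {G : Type*} [Group G] (N : Subgroup G) [N.Normal] {a : G} {r : ℕ}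
    (ha : a ^ r ∈ Subgroup.center G) : (MulAut.conjNormal a : MulAut N).toMonoidHom^[r] = id := by
  have h : ∀ (n : ℕ) (x : N),
      (((MulAut.conjNormal a : MulAut N).toMonoidHom^[n] x : N) : G) = a ^ n * x * (a ^ n)⁻¹ := by
    intro n x
    induction n with
    | zero => simp
    | succ n ih =>
      rw [Function.iterate_succ_apply', MulEquiv.coe_toMonoidHom, MulAut.conjNormal_apply]
      rw [MulEquiv.coe_toMonoidHom] at ih
      rw [ih, pow_succ', mul_inv_rev]
      simp only [mul_assoc]
  funext x
  refine Subtype.ext ((h r x).trans ?_)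
  rw [← Subgroup.mem_center_iff.mp ha (x : G), mul_inv_cancel_right]
  rfl

theorem Subgroup.mem_iff_exists_pow_of_comm {G : Type*} [Group G] [Finite G] {p : ℕ}
    [Fact p.Prime] {M : Subgroup G} (hM : ∀ x ∈ M, ∀ y ∈ M, x * y = y * x) (Q : Sylow p M) {x : M} :
    x ∈ Q ↔ ∃ k, x ^ p ^ k = 1 := by
  refine Q.mem_iff_exists_pow ⟨fun y hy g => ?_⟩
  rwa [show g * y = y * g from Subtype.ext (hM g g.2 y y.2), mul_inv_cancel_right]

namespace AbelianCentralizer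

variable {G : Type} [Group G] [Finite G] {s r : ℕ} [hr : Fact r.Prime] {K : Subgroup G}
  {R : Sylow r G} {a : G}

theorem isNilpotent_commutator (hA : AbelianCentralizer s r K R a) (hrs : ¬ r ∣ s)
    (hG : IsSupersolvable G ∨ Odd (Fitting G).index) :
    Group.IsNilpotent (⁅K, K⁆ : Subgroup G) := by
  have hK := hA.normal
  obtain ⟨D, hD⟩ : ∃ D : Subgroup G, D = ⁅K, K⁆ := ⟨_, rfl⟩
  have hDn : D.Normal := hD ▸ Subgroup.commutator_normal K K
  rw [← hD]
  have hit := conjNormal_iterate_eq_id D hA.pow_mem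
  have hfpf : FixedPointFree (MulAut.conjNormal a : MulAut D).toMonoidHom := by
    intro x hx
    have h1 := congrArg Subtype.val hx
    rw [MulEquiv.coe_toMonoidHom, MulAut.conjNormal_apply] at h1
    exact Subtype.ext (hA.eq_one_of_mem_commutator hrs (hD ▸ x.2) (mul_inv_eq_iff_eq_mul.mp h1))
  refine isNilpotent_of_isSolvable_of_fixedPointFree ?_ hit hfpf
  obtain hG | hG := hG
  · have := hG.isSolvable
    infer_instance
  · have hFn := normal_fitting G
    have := isSolvable_fitting G
    have h1 : (Fitting G).relIndex D ∣ (Fitting G).index :=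
      Subgroup.relIndex_dvd_index_of_normal _ _
    refine isSolvable_of_odd_index (A := (Fitting G).subgroupOf D) hit hfpf (fun x hx => ?_) ?_
      (hG.of_dvd_nat h1)
    · exact hFn.conj_mem (x : G) hx a
    · exact Group.isSolvable_of_isSolvable_injective (G' := Fitting G)
        (f := (D.subtype.comp ((Fitting G).subgroupOf D).subtype).codRestrict _ fun x => x.2)
        fun x y hxy => by
          have hxy' := congrArg Subtype.val hxy
          exact Subtype.ext (Subtype.ext hxy')

/-- Elements of `K` centralised by `a` are central modulo `⁅K, K⁆`. -/
theorem commutator_mem_commutator (hA : AbelianCentralizer s r K R a) {g : G} (hgK : g ∈ K)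
    (hg : g ∈ Subgroup.centralizer {a}) (h : G) : h * g * h⁻¹ * g⁻¹ ∈ (⁅K, K⁆ : Subgroup G) := by
  have hK := hA.normal
  obtain ⟨n, hn⟩ := hA.index
  have h1 : h ∈ K ⊔ (R : Subgroup G) := by
    rw [sup_comm, R.sup_eq_top_of_index hn]
    trivial
  obtain ⟨k, hk, t, ht, rfl⟩ := Subgroup.mem_sup_of_normal_left.mp h1
  have h2 := hA.comm t (hA.le ht) g hg
  rw [mul_assoc k t g, h2, ← mul_assoc k g t, mul_inv_rev, ← mul_assoc, mul_inv_cancel_right]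
  exact Subgroup.commutator_mem_commutator hk hgK

theorem not_isVanishing (hA : AbelianCentralizer s r K R a) {q : ℕ} [hq : Fact q.Prime]
    (hqs : q ∣ s) {g : G} (hg : g ∈ Subgroup.centralizer {a})
    (hgq : IsPGroup q (Subgroup.zpowers g)) : ¬ IsVanishing G g := by
  intro hv
  obtain ⟨M, hM⟩ : ∃ M, M = Subgroup.centralizer {a} := ⟨_, rfl⟩
  have hcomm := hA.comm
  have hle := hA.le
  have hnR := hA.normalizer_le
  have hiM := hA.index_centralizer
  rw [← hM] at hg hcomm hle hnR hiM
  have hMg : M = Subgroup.centralizer {g} := by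
    refine Subgroup.eq_of_le_of_index_eq_index (fun x hx => ?_) (hiM.trans (hA.vanishing g hv).symm)
    exact Subgroup.mem_centralizer_singleton_iff.mpr (hcomm x hx g hg)
  obtain ⟨Y⟩ : Nonempty (Sylow q M) := inferInstance
  have hgY : (⟨g, hg⟩ : M) ∈ Y := by
    refine (Subgroup.mem_iff_exists_pow_of_comm hcomm Y).mpr ?_
    obtain ⟨k, hk⟩ := hgq ⟨g, Subgroup.mem_zpowers g⟩
    have hk' : g ^ q ^ k = 1 := congrArg Subtype.val hk
    exact ⟨k, Subtype.ext hk'⟩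
  obtain ⟨Z, hZ⟩ : ∃ Z, Z = (Y : Subgroup M).map M.subtype := ⟨_, rfl⟩
  have hZp : IsPGroup q Z := hZ ▸ Y.2.map _
  have hZM : Z ≤ M := hZ ▸ Subgroup.map_subtype_le _
  have hgZ : g ∈ Z := hZ ▸ ⟨_, hgY, rfl⟩
  have hcZ : Subgroup.centralizer (Z : Set G) = M := by
    refine le_antisymm (fun x hx => ?_) fun x hx => ?_
    · rw [hMg]
      exact Subgroup.mem_centralizer_singleton_iff.mpr
        (Subgroup.mem_centralizer_iff.mp hx g hgZ).symm
    · exact Subgroup.mem_centralizer_iff.mpr fun y hy => hcomm y (hZM hy) x hx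
  obtain ⟨Q, hQ⟩ := hZp.exists_le_sylow
  have hlt : Z < Q := lt_of_le_of_ne hQ fun h => Q.not_dvd_index
    (hqs.trans (hiM ▸ h ▸ Subgroup.index_dvd_of_le hZM))
  obtain ⟨n, ⟨hnQ, hnN⟩, hnZ⟩ := SetLike.exists_of_lt (Q.2.lt_inf_normalizer hlt)
  have hnM : ∀ x ∈ M, n * x * n⁻¹ ∈ M := by
    intro x hx
    rw [← hcZ] at hx ⊢
    refine Subgroup.mem_centralizer_iff.mpr fun y hy => ?_
    have h1 := (Subgroup.mem_normalizer_iff.mp (inv_mem hnN) y).mp hy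
    rw [inv_inv] at h1
    have h2 := Subgroup.mem_centralizer_iff.mp hx _ h1
    calc y * (n * x * n⁻¹) = n * ((n⁻¹ * y * n) * x) * n⁻¹ := by group
      _ = n * (x * (n⁻¹ * y * n)) * n⁻¹ := by rw [h2]
      _ = n * x * n⁻¹ * y := by group
  have hnR' : n ∈ Subgroup.normalizer (R : Set G) := by
    refine Subgroup.mem_normalizer_iff_map_conj_eq.mpr ?_
    refine Subgroup.eq_of_le_of_card_ge ?_ ?_
    · rintro _ ⟨x, hx, rfl⟩
      have h1 := hnM x (hle hx)
      have h2 : (⟨n * x * n⁻¹, h1⟩ : M) ∈ R.subtype hle := by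
        refine (Subgroup.mem_iff_exists_pow_of_comm hcomm (R.subtype hle)).mpr ?_
        obtain ⟨k, hk⟩ := R.2 ⟨x, hx⟩
        have hk' : x ^ r ^ k = 1 := congrArg Subtype.val hk
        refine ⟨k, Subtype.ext ?_⟩
        change (n * x * n⁻¹) ^ r ^ k = 1
        rw [conj_pow, hk', mul_one, mul_inv_cancel]
      exact h2
    · exact (Subgroup.card_map_of_injective (MulAut.conj _).injective).ge
  have hnM' := hnR hnR'
  refine hnZ (hZ ▸ ⟨⟨n, hnM'⟩, ?_, rfl⟩)
  refine (Subgroup.mem_iff_exists_pow_of_comm hcomm Y).mpr ?_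
  obtain ⟨k, hk⟩ := Q.2 ⟨n, hnQ⟩
  have hk' : n ^ q ^ k = 1 := congrArg Subtype.val hk
  exact ⟨k, Subtype.ext hk'⟩

theorem commute_of_mem_commutator (hA : AbelianCentralizer s r K R a)
    (hnil : Group.IsNilpotent (⁅K, K⁆ : Subgroup G)) {q p : ℕ} [hq : Fact q.Prime]
    [hp : Fact p.Prime] (hpq : p ≠ q) (hqs : q ∣ s) {g : G} (hgK : g ∈ K)
    (hg : g ∈ Subgroup.centralizer {a}) (hgq : IsPGroup q (Subgroup.zpowers g)) {x : G}
    (hx : x ∈ (⁅K, K⁆ : Subgroup G)) (hxp : IsPGroup p (Subgroup.zpowers x)) : g * x = x * g := by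
  have hK := hA.normal
  have hcm := hA.commutator_mem_commutator hgK hg
  obtain ⟨D, hD⟩ : ∃ D : Subgroup G, D = ⁅K, K⁆ := ⟨_, rfl⟩
  have hDn : D.Normal := hD ▸ Subgroup.commutator_normal K K
  rw [← hD] at hx hnil hcm
  obtain ⟨P⟩ : Nonempty (Sylow p D) := inferInstance
  have hPn := hnil.sylow_normal p P
  have hPc : (P : Subgroup D).Characteristic := P.characteristic_of_normal hPn
  obtain ⟨L, -, -, hsup, hcen⟩ := (hnil.isPNilpotent p).exists_complement
  have hLP := hcen P hPn P.2
  have hP0n : ((P : Subgroup D).map D.subtype).Normal := ConjAct.normal_of_characteristic_of_normal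
  have hxP : x ∈ (P : Subgroup D).map D.subtype := by
    obtain ⟨k, hk⟩ := hxp ⟨x, Subgroup.mem_zpowers x⟩
    have hk' : x ^ p ^ k = 1 := congrArg Subtype.val hk
    exact ⟨⟨x, hx⟩, (P.mem_iff_exists_pow hPn).mpr ⟨k, Subtype.ext hk'⟩, rfl⟩
  have hclass : ∀ d ∈ D, ∀ y ∈ (P : Subgroup D).map D.subtype,
      ∃ n ∈ (P : Subgroup D).map D.subtype, d * y * d⁻¹ = n * y * n⁻¹ := by
    rintro d hd _ ⟨y, hy, rfl⟩
    have h1 : (⟨d, hd⟩ : D) ∈ (P : Subgroup D) ⊔ L := by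
      rw [hsup]
      trivial
    obtain ⟨n, hn, l, hl, hnl⟩ := Subgroup.mem_sup_of_normal_left.mp h1
    have h2 : l * y * l⁻¹ = y :=
      mul_inv_eq_iff_eq_mul.mpr (Subgroup.mem_centralizer_iff.mp (hLP hl) y hy).symm
    have h3 : (⟨d, hd⟩ : D) * y * (⟨d, hd⟩ : D)⁻¹ = n * y * n⁻¹ := by
      rw [← hnl]
      nth_rewrite 2 [← h2]
      group
    exact ⟨n, ⟨n, hn, rfl⟩, congrArg Subtype.val h3⟩
  refine commute_of_fixes_classes ((P : Subgroup D).map D.subtype) hgq ?_ ?_ x hxP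
  · intro h
    obtain ⟨k, hk⟩ := IsPGroup.iff_card.mp (P.2.map D.subtype)
    rw [hk] at h
    exact hpq ((Nat.prime_dvd_prime_iff_eq hq.out hp.out).mp (hq.out.dvd_of_dvd_pow h)).symm
  · refine exists_conj_of_not_isVanishing _ (hA.not_isVanishing hqs hg hgq) fun h y hy => ?_
    obtain ⟨n, hn, hny⟩ := hclass _ (hcm h) _ (hP0n.conj_mem y hy (g * h))
    refine ⟨n, hn, hny ▸ ?_⟩
    group

theorem exists_isNilpotent_hall (hA : AbelianCentralizer s r K R a) (hrs : ¬ r ∣ s)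
    (hG : IsSupersolvable G ∨ Odd (Fitting G).index) :
    ∃ H : Subgroup G, IsHallSubgroup (primesOf s) H ∧ Group.IsNilpotent H := by
  have hK := hA.normal
  have hnil := hA.isNilpotent_commutator hrs hG
  obtain ⟨H, hHn, hHall, hHc⟩ := hA.exists_normal_hall
  obtain ⟨D, hD⟩ : ∃ D : Subgroup G, D = ⁅K, K⁆ := ⟨_, rfl⟩
  have hDn : D.Normal := hD ▸ Subgroup.commutator_normal K K
  have hDH : D ≤ H := by
    rw [hD]
    exact Subgroup.commutator_le.mpr fun x _ y _ => hHc x y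
  have hrH : ¬ r ∣ Nat.card H := fun h => hrs (hHall.1 r hr.out h).2
  obtain ⟨n, hn⟩ := hA.index
  have hHK : H ≤ K := fun x hx => (mem_iff_not_dvd_orderOf hA.not_dvd hn).mpr fun h => by
    refine hrH (h.trans ?_)
    rw [← Subgroup.orderOf_mk x hx]
    exact orderOf_dvd_natCard _
  have hquot : Group.IsNilpotent (H ⧸ D.subgroupOf H) := by
    let _ : CommGroup (H ⧸ D.subgroupOf H) :=
      { (inferInstance : Group (H ⧸ D.subgroupOf H)) with
        mul_comm := fun x y => by
          obtain ⟨x, rfl⟩ := QuotientGroup.mk'_surjective _ x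
          obtain ⟨y, rfl⟩ := QuotientGroup.mk'_surjective _ y
          refine Subgroup.commutator_mem_iff.mp ?_
          change (x * y * x⁻¹ * y⁻¹ : G) ∈ D
          rw [hD]
          exact Subgroup.commutator_mem_commutator (hHK x.2) (hHK y.2) }
    exact CommGroup.isNilpotent
  have hDnil : Group.IsNilpotent (D.subgroupOf H) := by
    have : Group.IsNilpotent D := hD ▸ hnil
    exact Group.nilpotent_of_surjective (Subgroup.subgroupOfEquivOfLe hDH).symm.toMonoidHom
      (Subgroup.subgroupOfEquivOfLe hDH).symm.surjective
  have hfix : ∀ x : H, (MulAut.conjNormal a : MulAut H) x = x → a * (x : G) = x * a := by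
    intro x hx
    have h1 := congrArg Subtype.val hx
    rw [MulAut.conjNormal_apply] at h1
    exact mul_inv_eq_iff_eq_mul.mp h1
  refine ⟨H, hHall, isNilpotent_of_fixed_commute (conjNormal_iterate_eq_id H hA.pow_mem) hrH
    (D.subgroupOf H) (fun x hx => hDn.conj_mem (x : G) hx a) hDnil hquot ?_ ?_⟩
  · intro x hx hxa
    exact Subtype.ext (hA.eq_one_of_mem_commutator hrs (hD ▸ hx) (hfix x hxa))
  · intro q p hq hp hpq c hc hcq x hx hxp
    by_cases hc1 : c = 1
    · rw [hc1, one_mul, mul_one]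
    have := Fact.mk hq
    have := Fact.mk hp
    have hmap : ∀ {m : ℕ} {y : H}, IsPGroup m (Subgroup.zpowers y) →
        IsPGroup m (Subgroup.zpowers (y : G)) := by
      intro m y hy
      have h1 := hy.map H.subtype
      rwa [MonoidHom.map_zpowers] at h1
    have hqH : q ∣ Nat.card H := by
      obtain ⟨k, hk⟩ := IsPGroup.iff_card.mp hcq
      rw [Nat.card_zpowers] at hk
      refine dvd_trans ?_ (orderOf_dvd_natCard c)
      rw [hk]
      refine dvd_pow_self q fun hk0 => hc1 ?_
      rw [hk0, pow_zero] at hk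
      exact orderOf_eq_one_iff.mp hk
    refine Subtype.ext (hA.commute_of_mem_commutator hnil hpq (hHall.1 q hq hqH).2 (hHK c.2)
      (Subgroup.mem_centralizer_singleton_iff.mpr (hfix c hc).symm) (hmap hcq) (hD ▸ hx) (hmap hxp))

end AbelianCentralizer

end

/-- Theorem 4.7: if `π(s)` is strictly contained in `π(G/Z(G))`, `G` is
supersolvable or `G/Fit(G)` has odd order, and `vcs(G) = {s}`, then `G` has a
nilpotent Hall `π(s)`-subgroup. -/
theorem statement17 (G : Type) [Group G] [Finite G] (s : ℕ) (hs : 0 < s)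
    (hlt : primesOf s ⊂ primesOf (Nat.card (G ⧸ Subgroup.center G)))
    (hss : IsSupersolvable G ∨ Odd (Fitting G).index)
    (hvcs : vcs G = {s}) :
    ∃ K : Subgroup G, IsHallSubgroup (primesOf s) K ∧ Group.IsNilpotent ↥K := by
  obtain ⟨r, ⟨hr, hrZ⟩, hrs⟩ := Set.exists_of_ssubset hlt
  have := Fact.mk hr
  have hrs' : ¬ r ∣ s := fun h => hrs ⟨hr, h⟩
  obtain ⟨K, R, a, hA⟩ := exists_abelianCentralizer hrs' (fun x hx => by
    have h : classSize x ∈ vcs G := ⟨x, hx, rfl⟩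
    rw [hvcs] at h
    exact h) hrZ
  exact hA.exists_isNilpotent_hall hrs' hss
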